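/- For every finite simple graph H there exist positive integers r and ξ such that: if H is not an odd minor of a finite simple graph G, then G has a tree-decomposition (B_x : x ∈ V(T)) for some tree T such that for every node x of T, letting R_x be the torso at x, either K_r is not a minor of R_x, or there exists Z ⊆ V(R_x) with |Z| ≤ ξ such that R_x − Z is an induced bipartite subgraph of G and |M − Z| ≤ 1 for every member M of the frame at x. -/

import Mathlib

open SimpleGraph

universe u v

namespace CFPaper

variable {V : Type u} {W : Type v}

/-- A coloring is proper if adjacent vertices get distinct colors. -/
def Proper (G : SimpleGraph V) (φ : V → ℕ) : Prop :=
  ∀ ⦃u w : V⦄, G.Adj u w → φ u ≠ φ w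

/-- A coloring is conflict-free if every non-isolated vertex has a color appearing
exactly once in its open neighborhood. -/
def ConflictFree (G : SimpleGraph V) (φ : V → ℕ) : Prop :=
  ∀ v : V, (G.neighborSet v).Nonempty →
    ∃ c : ℕ, {u : V | G.Adj v u ∧ φ u = c}.ncard = 1

/-- `G` is conflict-free `k`-choosable (k a real number). -/
def CFChoosable (G : SimpleGraph V) (k : ℝ) : Prop :=
  ∀ L : V → Finset ℕ, (∀ v, k ≤ ((L v).card : ℝ)) →
    ∃ φ : V → ℕ, (∀ v, φ v ∈ L v) ∧ Proper G φ ∧ ConflictFree G φ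

/-- A coloring is `S`-achieved if for every non-isolated vertex there are `s ∈ S`
and a color appearing exactly `s` times in its open neighborhood. -/
def SAchieved (S : Set ℕ) (G : SimpleGraph V) (φ : V → ℕ) : Prop :=
  ∀ v : V, (G.neighborSet v).Nonempty →
    ∃ s ∈ S, ∃ c : ℕ, {u : V | G.Adj v u ∧ φ u = c}.ncard = s

/-- `G` is `S`-achieved `t`-choosable. -/
def SChoosable (S : Set ℕ) (G : SimpleGraph V) (t : ℕ) : Prop :=
  ∀ L : V → Finset ℕ, (∀ v, t ≤ (L v).card) →
    ∃ φ : V → ℕ, (∀ v, φ v ∈ L v) ∧ Proper G φ ∧ SAchieved S G φ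

/-- `G` is properly `S`-achieved `t`-colorable (colors from `{1,…,t}`). -/
def SColorable (S : Set ℕ) (G : SimpleGraph V) (t : ℕ) : Prop :=
  ∃ φ : V → ℕ, (∀ v, φ v ∈ Finset.Icc 1 t) ∧ Proper G φ ∧ SAchieved S G φ

/-- `G` has a proper conflict-free coloring with colors from `{1,…,t}`. -/
def PCFColorable (G : SimpleGraph V) (t : ℕ) : Prop :=
  ∃ φ : V → ℕ, (∀ v, φ v ∈ Finset.Icc 1 t) ∧ Proper G φ ∧ ConflictFree G φ

/-- The proper conflict-free chromatic number. -/
noncomputable def chiPCF (G : SimpleGraph V) : ℕ := sInf {t : ℕ | PCFColorable G t}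

/-- `(B x : x : ι)` is a tree-decomposition of `G` with underlying tree `T`. -/
structure IsTreeDecomp (G : SimpleGraph V) {ι : Type*} (T : SimpleGraph ι) (B : ι → Set V) :
    Prop where
  tree : T.IsTree
  bags_connected : ∀ vv : V, (T.induce {x : ι | vv ∈ B x}).Connected
  edge_in_bag : ∀ ⦃a b : V⦄, G.Adj a b → ∃ x : ι, a ∈ B x ∧ b ∈ B x

/-- The torso of a tree-decomposition at a node `x`. -/
def torso (G : SimpleGraph V) {ι : Type*} (T : SimpleGraph ι) (B : ι → Set V) (x : ι) :
    SimpleGraph (B x) :=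
  SimpleGraph.fromRel fun a b =>
    G.Adj a b ∨ ∃ y : ι, T.Adj x y ∧ (a : V) ∈ B y ∧ (b : V) ∈ B y

/-- The frame of a tree-decomposition at a node `x`. -/
def frame (G : SimpleGraph V) {ι : Type*} (T : SimpleGraph ι) (B : ι → Set V) (x : ι) :
    Set (Set (B x)) :=
  {s : Set (B x) | ∃ y : ι, T.Adj x y ∧ s = {a : B x | (a : V) ∈ B y}}

/-- A subgraph `H` of `G` is `C`-compatible: every edge of `H` has both ends in some member
of `C`. -/
def Compatible (C : Set (Set V)) (H : SimpleGraph V) : Prop :=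
  ∀ ⦃a b : V⦄, H.Adj a b → ∃ c ∈ C, a ∈ c ∧ b ∈ c

/-- `G` is `(S,C,L,t)`-extendable. -/
def Extendable (S : Set ℕ) (G : SimpleGraph V) (C : Set (Set V)) (L : V → Finset ℕ)
    (t : ℕ) : Prop :=
  ∀ (Wc : Set V), G.IsClique Wc → Wc.ncard ≤ t →
  ∀ (H : SimpleGraph V), H ≤ G → Compatible C H →
  ∀ (φW : V → ℕ), (∀ w ∈ Wc, φW w ∈ L w) →
    (∀ a ∈ Wc, ∀ b ∈ Wc, G.Adj a b → φW a ≠ φW b) →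
  ∀ (f : V → ℕ) (g : V → Bool),
  ∃ φ : V → ℕ, (∀ w, φ w ∈ L w) ∧ Proper G φ ∧ (∀ w ∈ Wc, φ w = φW w) ∧
    (∀ w ∈ Wc, g w = false → ∀ u : V, G.Adj w u → u ∉ Wc → φ u ≠ f w) ∧
    (∀ w : V, (w ∉ Wc ∨ (w ∈ Wc ∧ g w = true)) →
      (((G \ H).neighborSet w = ∅) ∨
        ∃ c : ℕ, {u : V | (G \ H).Adj w u ∧ φ u = c}.ncard ∈ S))

/-- `H` is a minor of `G` (branch-set definition). -/
def IsMinor (H : SimpleGraph W) (G : SimpleGraph V) : Prop :=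
  ∃ ρ : W → Set V,
    (∀ w : W, (G.induce (ρ w)).Connected) ∧
    (Pairwise fun a b => Disjoint (ρ a) (ρ b)) ∧
    ∀ ⦃a b : W⦄, H.Adj a b → ∃ x ∈ ρ a, ∃ y ∈ ρ b, G.Adj x y

/-- The spanning subgraph of `G` whose edges are those between `A` and its complement. -/
def crossGraph (G : SimpleGraph V) (A : Set V) : SimpleGraph V :=
  SimpleGraph.fromRel fun x y => G.Adj x y ∧ x ∈ A ∧ y ∉ A

/-- The odd contraction of `G` determined by the bipartition `{A, Aᶜ}`: contract each
connected component of the spanning bipartite subgraph between `A` and `Aᶜ`. -/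
def oddContract (G : SimpleGraph V) (A : Set V) :
    SimpleGraph ((crossGraph G A).ConnectedComponent) :=
  SimpleGraph.fromRel fun Ct Dt =>
    ∃ x y : V, (crossGraph G A).connectedComponentMk x = Ct ∧
      (crossGraph G A).connectedComponentMk y = Dt ∧ G.Adj x y

/-- `OddContractions G H`: `H` is obtained from `G` by repeatedly applying odd
contractions. -/
inductive OddContractions : ∀ {α : Type u}, SimpleGraph α → ∀ {β : Type u}, SimpleGraph β → Prop
  | refl {α : Type u} (G : SimpleGraph α) : OddContractions G G
  | step {α : Type u} (G : SimpleGraph α) (A : Set α) {β : Type u} {H : SimpleGraph β} :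
      OddContractions (oddContract G A) H → OddContractions G H

/-- `H` is an odd minor of `G`: `H` is isomorphic to a graph obtained from a subgraph of `G`
by repeatedly applying odd contractions. -/
def IsOddMinor (H : SimpleGraph W) (G : SimpleGraph V) : Prop :=
  ∃ (s : Set V) (G₀ : SimpleGraph s), G₀ ≤ G.induce s ∧
    ∃ (β : Type u) (K : SimpleGraph β), OddContractions G₀ K ∧ Nonempty (H ≃g K)

/-- The graph obtained from `H` by subdividing each edge `e` exactly `n e` times, where
`σ` chooses an orientation of each edge. -/
def subdivGraph (H : SimpleGraph W) (σ : H.edgeSet → W × W) (n : H.edgeSet → ℕ) :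
    SimpleGraph (W ⊕ (Σ e : H.edgeSet, Fin (n e))) :=
  SimpleGraph.fromRel fun a b =>
    (∃ (x y : W) (h : H.Adj x y),
        a = Sum.inl x ∧ b = Sum.inl y ∧ n ⟨s(x, y), H.mem_edgeSet.mpr h⟩ = 0) ∨
    (∃ (x : W) (p : Σ e : H.edgeSet, Fin (n e)), a = Sum.inl x ∧ b = Sum.inr p ∧
        ((x = (σ p.1).1 ∧ (p.2 : ℕ) = 0) ∨ (x = (σ p.1).2 ∧ (p.2 : ℕ) = n p.1 - 1))) ∨
    (∃ p q : Σ e : H.edgeSet, Fin (n e), a = Sum.inr p ∧ b = Sum.inr q ∧ p.1 = q.1 ∧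
        (p.2 : ℕ) + 1 = (q.2 : ℕ))

/-- `σ` is a valid orientation of the edges of `H`. -/
def ValidOrientation (H : SimpleGraph W) (σ : H.edgeSet → W × W) : Prop :=
  ∀ e : H.edgeSet, s((σ e).1, (σ e).2) = (e : Sym2 W)

/-- `G` contains a subdivision of `H` as a subgraph. -/
def ContainsSubdivision (H : SimpleGraph W) (G : SimpleGraph V) : Prop :=
  ∃ (σ : H.edgeSet → W × W) (n : H.edgeSet → ℕ), ValidOrientation H σ ∧
    ∃ f : subdivGraph H σ n →g G, Function.Injective f

/-- The strong product of two graphs. -/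
def strongProd {α : Type*} {β : Type*} (A : SimpleGraph α) (B : SimpleGraph β) :
    SimpleGraph (α × β) :=
  SimpleGraph.fromRel fun p q =>
    (A.Adj p.1 q.1 ∧ p.2 = q.2) ∨ (p.1 = q.1 ∧ B.Adj p.2 q.2) ∨
      (A.Adj p.1 q.1 ∧ B.Adj p.2 q.2)


/-- A layering of `G`. -/
def IsLayering (G : SimpleGraph V) (Vl : ℕ → Set V) : Prop :=
  (∀ vv : V, ∃ i : ℕ, vv ∈ Vl i) ∧ (Pairwise fun i j => Disjoint (Vl i) (Vl j)) ∧
  ∀ ⦃a b : V⦄, G.Adj a b → ∃ i : ℕ, a ∈ Vl i ∪ Vl (i + 1) ∧ b ∈ Vl i ∪ Vl (i + 1)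





section basics
variable {V : Type}

/-- reachability inside a set -/
def Reach (G : SimpleGraph V) (s : Set V) (x y : V) : Prop :=
  Relation.ReflTransGen (fun a b => G.Adj a b ∧ a ∈ s ∧ b ∈ s) x y

/-- connected vertex set -/
def Conn (G : SimpleGraph V) (s : Set V) : Prop :=
  s.Nonempty ∧ ∀ x ∈ s, ∀ y ∈ s, Reach G s x y

theorem Reach.refl (G : SimpleGraph V) (s : Set V) (x : V) : Reach G s x x :=
  Relation.ReflTransGen.refl

theorem Reach.trans {G : SimpleGraph V} {s : Set V} {x y z : V} (h : Reach G s x y)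
    (h' : Reach G s y z) : Reach G s x z := Relation.ReflTransGen.trans h h'

theorem Reach.single {G : SimpleGraph V} {s : Set V} {x y : V} (h : G.Adj x y) (hx : x ∈ s)
    (hy : y ∈ s) : Reach G s x y := Relation.ReflTransGen.single ⟨h, hx, hy⟩

theorem Reach.symm {G : SimpleGraph V} {s : Set V} {x y : V} (h : Reach G s x y) :
    Reach G s y x := by
  induction h with
  | refl => exact Reach.refl _ _ _
  | tail _ hb ih => exact (Reach.single hb.1.symm hb.2.2 hb.2.1).trans ih

theorem Reach.mono {G G' : SimpleGraph V} {s s' : Set V} {x y : V} (h : Reach G s x y)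
    (hG : G ≤ G') (hs : s ⊆ s') : Reach G' s' x y :=
  Relation.ReflTransGen.mono
    (r := fun a b => G.Adj a b ∧ a ∈ s ∧ b ∈ s) (p := fun a b => G'.Adj a b ∧ a ∈ s' ∧ b ∈ s')
    (fun _ _ h => ⟨hG h.1, hs h.2.1, hs h.2.2⟩) _ _ h

/-- edges inside `s` lifted to a graph -/
theorem Reach.mono' {G G' : SimpleGraph V} {s s' : Set V} {x y : V} (h : Reach G s x y)
    (hG : ∀ a ∈ s, ∀ b ∈ s, G.Adj a b → Reach G' s' a b) : Reach G' s' x y := by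
  induction h with
  | refl => exact Reach.refl _ _ _
  | tail _ hb ih => exact ih.trans (hG _ hb.2.1 _ hb.2.2 hb.1)

theorem Reach.mem_of_ne {G : SimpleGraph V} {s : Set V} {x y : V} (h : Reach G s x y)
    (hx : x ∈ s) : y ∈ s := by
  induction h with
  | refl => exact hx
  | tail _ hb _ => exact hb.2.2

theorem Reach.exists_cross {G : SimpleGraph V} {s P : Set V} {x y : V} (h : Reach G s x y)
    (hx : x ∈ P) (hy : y ∉ P) : ∃ a b, G.Adj a b ∧ a ∈ s ∧ b ∈ s ∧ a ∈ P ∧ b ∉ P := by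
  induction h with
  | refl => exact absurd hx hy
  | @tail b c _ hb ih =>
    by_cases hbP : b ∈ P
    · exact ⟨b, c, hb.1, hb.2.1, hb.2.2, hbP, hy⟩
    · exact ih hbP

theorem Reach.invariant {G : SimpleGraph V} {s P : Set V} {x y : V} (h : Reach G s x y)
    (hx : x ∈ P) (hP : ∀ a b, G.Adj a b → a ∈ s → b ∈ s → a ∈ P → b ∈ P) : y ∈ P := by
  by_contra hy
  obtain ⟨a, b, h1, h2, h3, h4, h5⟩ := h.exists_cross hx hy
  exact h5 (hP a b h1 h2 h3 h4)

theorem reach_of_walk {G : SimpleGraph V} {s : Set V} {x y : V} (p : G.Walk x y)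
    (h : ∀ v ∈ p.support, v ∈ s) : Reach G s x y := by
  induction p with
  | nil => exact Reach.refl _ _ _
  | @cons u v w hadj p ih =>
    simp only [Walk.support_cons, List.mem_cons, forall_eq_or_imp] at h
    exact (Reach.single hadj h.1 (h.2 _ p.start_mem_support)).trans (ih h.2)

theorem Reach.exists_walk {G : SimpleGraph V} {s : Set V} {x y : V} (h : Reach G s x y)
    (hx : x ∈ s) : ∃ p : G.Walk x y, ∀ v ∈ p.support, v ∈ s := by
  induction h with
  | refl => exact ⟨Walk.nil, by simpa using hx⟩
  | tail _ hb ih =>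
    obtain ⟨p, hp⟩ := ih
    refine ⟨p.concat hb.1, ?_⟩
    intro v hv
    rw [Walk.support_concat, List.mem_append] at hv
    rcases hv with hv | hv
    · exact hp v hv
    · simp only [List.mem_singleton] at hv
      exact hv ▸ hb.2.2

theorem Reach.exists_path {G : SimpleGraph V} {s : Set V} {x y : V} (h : Reach G s x y)
    (hx : x ∈ s) : ∃ p : G.Walk x y, p.IsPath ∧ ∀ v ∈ p.support, v ∈ s := by
  classical
  obtain ⟨p, hp⟩ := h.exists_walk hx
  exact ⟨p.bypass, p.bypass_isPath, fun v hv => hp v (p.support_bypass_subset_support hv)⟩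

theorem conn_iff {G : SimpleGraph V} {s : Set V} : (G.induce s).Connected ↔ Conn G s := by
  constructor
  · intro h
    have hp := h.preconnected
    obtain ⟨x0⟩ := h.nonempty
    refine ⟨⟨x0, x0.2⟩, fun x hx y hy => ?_⟩
    obtain ⟨p⟩ := hp ⟨x, hx⟩ ⟨y, hy⟩
    have : ∀ (a b : s) (p : (G.induce s).Walk a b), Reach G s a b := by
      intro a b p
      induction p with
      | nil => exact Reach.refl _ _ _
      | @cons u v w hadj p ih =>
        exact (Reach.single (by simpa using hadj) u.2 v.2).trans ih
    exact this _ _ p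
  · rintro ⟨⟨x0, hx0⟩, h⟩
    have key : ∀ x (hx : x ∈ s) y, Reach G s x y → ∀ (hy : y ∈ s),
        (G.induce s).Reachable ⟨x, hx⟩ ⟨y, hy⟩ := by
      intro x hx y hxy
      induction hxy with
      | refl => intro _; exact Reachable.refl _
      | @tail b c _ hb ih =>
        intro hy
        refine (ih hb.2.1).trans (Adj.reachable ?_)
        simpa using hb.1
    have : Nonempty s := ⟨⟨x0, hx0⟩⟩
    exact ⟨fun x y => key x x.2 y (h x x.2 y y.2) y.2⟩

theorem conn_singleton (G : SimpleGraph V) (x : V) : Conn G {x} :=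
  ⟨⟨x, rfl⟩, fun a ha b hb => by
    rw [Set.mem_singleton_iff] at ha hb; subst ha; subst hb; exact Reach.refl _ _ _⟩

theorem Conn.nonempty {G : SimpleGraph V} {s : Set V} (h : Conn G s) : s.Nonempty := h.1

theorem Conn.mono {G G' : SimpleGraph V} {s : Set V} (h : Conn G s) (hG : G ≤ G') : Conn G' s :=
  ⟨h.1, fun x hx y hy => (h.2 x hx y hy).mono hG subset_rfl⟩

theorem Conn.of_root {G : SimpleGraph V} {s : Set V} {r : V} (hr : r ∈ s)
    (h : ∀ x ∈ s, Reach G s x r) : Conn G s :=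
  ⟨⟨r, hr⟩, fun x hx y hy => (h x hx).trans (h y hy).symm⟩

theorem Conn.union_reach {G : SimpleGraph V} {s t : Set V} (hs : Conn G s) (ht : Conn G t)
    {x y : V} (hx : x ∈ s) (hy : y ∈ t) (h : Reach G (s ∪ t) x y) : Conn G (s ∪ t) := by
  refine Conn.of_root (Or.inl hx) ?_
  rintro z (hz | hz)
  · exact (hs.2 z hz x hx).mono le_rfl Set.subset_union_left
  · exact ((ht.2 z hz y hy).mono le_rfl Set.subset_union_right).trans h.symm

theorem Conn.union_adj {G : SimpleGraph V} {s t : Set V} (hs : Conn G s) (ht : Conn G t)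
    {x y : V} (hx : x ∈ s) (hy : y ∈ t) (h : G.Adj x y) : Conn G (s ∪ t) :=
  hs.union_reach ht hx hy (Reach.single h (Or.inl hx) (Or.inr hy))

theorem Conn.union_mem {G : SimpleGraph V} {s t : Set V} (hs : Conn G s) (ht : Conn G t)
    {x : V} (hx : x ∈ s) (hy : x ∈ t) : Conn G (s ∪ t) :=
  hs.union_reach ht hx hy (Reach.refl _ _ _)

theorem Conn.of_walk {G : SimpleGraph V} {x y : V} (p : G.Walk x y) :
    Conn G {v | v ∈ p.support} := by
  classical
  refine Conn.of_root (r := y) p.end_mem_support ?_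
  intro z hz
  exact reach_of_walk (p.dropUntil z hz) fun v hv => p.support_dropUntil_subset_support hz hv

/-- graph of bichromatic edges -/
def biG (G : SimpleGraph V) (c : V → Bool) : SimpleGraph V where
  Adj x y := G.Adj x y ∧ c x ≠ c y
  symm := ⟨fun _ _ h => ⟨h.1.symm, h.2.symm⟩⟩
  loopless := ⟨fun _ h => h.2 rfl⟩

theorem biG_le (G : SimpleGraph V) (c : V → Bool) : biG G c ≤ G := fun _ _ h => h.1

/-- `K_n`-model -/
structure KModel (G : SimpleGraph V) (n : ℕ) (ρ : Fin n → Set V) : Prop where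
  conn : ∀ i, Conn G (ρ i)
  disj : ∀ i j, i ≠ j → Disjoint (ρ i) (ρ j)
  adj : ∀ i j, i ≠ j → ∃ x ∈ ρ i, ∃ y ∈ ρ j, G.Adj x y

theorem KModel.mono {G G' : SimpleGraph V} {n : ℕ} {ρ : Fin n → Set V} (h : KModel G n ρ)
    (hG : G ≤ G') : KModel G' n ρ :=
  ⟨fun i => (h.conn i).mono hG, h.disj, fun i j hij => by
    obtain ⟨x, hx, y, hy, hxy⟩ := h.adj i j hij
    exact ⟨x, hx, y, hy, hG hxy⟩⟩

/-- odd `K_l`-model -/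
def OddModel (G : SimpleGraph V) (l : ℕ) : Prop :=
  ∃ (ρ : Fin l → Set V) (c : V → Bool), (∀ i, Conn (biG G c) (ρ i)) ∧
    (∀ i j, i ≠ j → Disjoint (ρ i) (ρ j)) ∧
    ∀ i j, i ≠ j → ∃ x ∈ ρ i, ∃ y ∈ ρ j, G.Adj x y ∧ c x = c y

theorem OddModel.mono {G G' : SimpleGraph V} {l : ℕ} (h : OddModel G l) (hG : G ≤ G') :
    OddModel G' l := by
  obtain ⟨ρ, c, h1, h2, h3⟩ := h
  refine ⟨ρ, c, fun i => (h1 i).mono fun x y h => ⟨hG h.1, h.2⟩, h2, fun i j hij => ?_⟩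
  obtain ⟨x, hx, y, hy, hxy, hc⟩ := h3 i j hij
  exact ⟨x, hx, y, hy, hG hxy, hc⟩

theorem oddModel_of_index {G : SimpleGraph V} {l : ℕ} (ρ : Fin l → Set V) (c : Fin l → V → Bool)
    (h1 : ∀ i, Conn (biG G (c i)) (ρ i))
    (h2 : ∀ i j, i ≠ j → Disjoint (ρ i) (ρ j))
    (h3 : ∀ i j, i ≠ j → ∃ x ∈ ρ i, ∃ y ∈ ρ j, G.Adj x y ∧ c i x = c j y) : OddModel G l := by
  classical
  let c' : V → Bool := fun v => if h : ∃ i, v ∈ ρ i then c h.choose v else false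
  have hc' : ∀ i v, v ∈ ρ i → c' v = c i v := by
    intro i v hv
    have h : ∃ i, v ∈ ρ i := ⟨i, hv⟩
    have : h.choose = i := by
      by_contra hne
      exact Set.disjoint_left.mp (h2 _ _ hne) h.choose_spec hv
    simp only [c', dif_pos h, this]
  refine ⟨ρ, c', fun i => ⟨(h1 i).1, fun x hx y hy => ((h1 i).2 x hx y hy).mono' ?_⟩, h2, ?_⟩
  · intro a ha b hb hab
    refine Reach.single ⟨hab.1, ?_⟩ ha hb
    rw [hc' i a ha, hc' i b hb]; exact hab.2
  · intro i j hij
    obtain ⟨x, hx, y, hy, hxy, hc⟩ := h3 i j hij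
    exact ⟨x, hx, y, hy, hxy, by rw [hc' i x hx, hc' j y hy, hc]⟩

theorem isOddMinor_of_oddModel {α : Type} [Fintype α] (H : SimpleGraph α) (G : SimpleGraph V)
    (h : OddModel G (Fintype.card α)) : IsOddMinor H G := by
  classical
  obtain ⟨ρ', c, h1', h2', h3'⟩ := h
  let e := Fintype.equivFin α
  let ρ : α → Set V := fun a => ρ' (e a)
  have h1 : ∀ a, Conn (biG G c) (ρ a) := fun a => h1' _
  have h2 : ∀ a b, a ≠ b → Disjoint (ρ a) (ρ b) := fun a b hab => h2' _ _ (by simpa using hab)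
  have h3 : ∀ a b, a ≠ b → ∃ x ∈ ρ a, ∃ y ∈ ρ b, G.Adj x y ∧ c x = c y :=
    fun a b hab => h3' _ _ (by simpa using hab)
  have huniq : ∀ a b x, x ∈ ρ a → x ∈ ρ b → a = b := by
    intro a b x ha hb
    by_contra hne
    exact Set.disjoint_left.mp (h2 _ _ hne) ha hb
  let s : Set V := {v | ∃ a, v ∈ ρ a}
  let idx : s → α := fun v => v.2.choose
  have hidx : ∀ v : s, (v : V) ∈ ρ (idx v) := fun v => v.2.choose_spec
  let G₀ : SimpleGraph s :=
    { Adj := fun x y => G.Adj x y ∧ ((idx x = idx y ∧ c x ≠ c y) ∨ (H.Adj (idx x) (idx y) ∧ c x = c y))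
      symm := ⟨fun x y h => ⟨h.1.symm, h.2.imp (fun h => ⟨h.1.symm, h.2.symm⟩)
        (fun h => ⟨h.1.symm, h.2.symm⟩)⟩⟩
      loopless := ⟨fun x h => G.loopless.irrefl _ h.1⟩ }
  let A : Set s := {v | c v = true}
  have hcross : ∀ x y, (crossGraph G₀ A).Adj x y ↔ G.Adj x y ∧ idx x = idx y ∧ c x ≠ c y := by
    intro x y
    simp only [crossGraph, SimpleGraph.fromRel_adj, A, Set.mem_ofPred_eq, G₀]
    constructor
    · rintro ⟨hne, ⟨⟨h, h'⟩, hx, hy⟩ | ⟨⟨h, h'⟩, hx, hy⟩⟩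
      · rcases h' with h' | h'
        · exact ⟨h, h'⟩
        · exact absurd (h'.2 ▸ hx) hy
      · rcases h' with h' | h'
        · exact ⟨h.symm, h'.1.symm, h'.2.symm⟩
        · exact absurd (h'.2 ▸ hx) hy
    · rintro ⟨h, hi, hc⟩
      refine ⟨fun h' => hc (by rw [h']), ?_⟩
      cases hx : c x <;> cases hy : c y
      · simp [hx, hy] at hc
      · right; exact ⟨⟨h.symm, Or.inl ⟨hi.symm, by simp⟩⟩, by simp, by simp⟩
      · left; exact ⟨⟨h, Or.inl ⟨hi, by simp⟩⟩, by simp, by simp⟩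
      · simp [hx, hy] at hc
  have hreach1 : ∀ x y : s, (crossGraph G₀ A).Reachable x y → idx x = idx y := by
    rintro x y ⟨p⟩
    induction p with
    | nil => rfl
    | cons hadj p ih => exact ((hcross _ _).1 hadj).2.1.trans ih
  have hreach2 : ∀ x y : s, idx x = idx y → (crossGraph G₀ A).Reachable x y := by
    intro x y hxy
    have key : ∀ z, Reach (biG G c) (ρ (idx x)) x z → ∀ (hz : z ∈ s),
        (crossGraph G₀ A).Reachable x ⟨z, hz⟩ := by
      intro z hz
      induction hz with
      | refl => intro _; exact Reachable.refl _
      | @tail b d _ hb ih =>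
        intro hd
        have hbs : b ∈ s := ⟨_, hb.2.1⟩
        refine (ih hbs).trans (Adj.reachable ?_)
        rw [hcross]
        refine ⟨hb.1.1, ?_, hb.1.2⟩
        exact (huniq _ _ _ (hidx ⟨b, hbs⟩) hb.2.1).trans (huniq _ _ _ hb.2.2 (hidx ⟨d, hd⟩))
    have hy : (y : V) ∈ ρ (idx x) := hxy ▸ hidx y
    exact key y ((h1 _).2 x (hidx x) y hy) y.2
  have hrep : ∀ a, ∃ v : s, idx v = a := by
    intro a
    obtain ⟨v, hv⟩ := (h1 a).1
    exact ⟨⟨v, a, hv⟩, huniq _ _ v (hidx ⟨v, a, hv⟩) hv⟩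
  choose rep hrep using hrep
  refine ⟨s, G₀, fun x y h => h.1, _, oddContract G₀ A, .step G₀ A (.refl _), ⟨?_⟩⟩
  refine
    { toFun := fun a => (crossGraph G₀ A).connectedComponentMk (rep a)
      invFun := fun C => C.lift idx (fun x y p _ => hreach1 x y ⟨p⟩)
      left_inv := fun a => by simp [hrep]
      right_inv := ?_
      map_rel_iff' := ?_ }
  · intro C
    induction C using ConnectedComponent.ind with
    | h v =>
      simp only [ConnectedComponent.lift_mk]
      rw [ConnectedComponent.eq]
      exact hreach2 _ _ (hrep _)
  · intro a b
    simp only [Equiv.coe_fn_mk, oddContract, SimpleGraph.fromRel_adj, ne_eq, ConnectedComponent.eq]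
    have aux : ∀ a b, (∃ x y, (crossGraph G₀ A).Reachable x (rep a) ∧
        (crossGraph G₀ A).Reachable y (rep b) ∧ G₀.Adj x y) → a ≠ b → H.Adj a b := by
      rintro a b ⟨x, y, hx, hy, hxy⟩ hab
      have hxa := (hreach1 _ _ hx).trans (hrep a)
      have hyb := (hreach1 _ _ hy).trans (hrep b)
      rcases hxy.2 with h | h
      · exact absurd (hxa.symm.trans (h.1.trans hyb)) hab
      · rw [hxa, hyb] at h; exact h.1
    constructor
    · rintro ⟨hne, h⟩
      have hab : a ≠ b := by
        rintro rfl
        exact hne (Reachable.refl _)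
      rcases h with h | h
      · exact aux a b h hab
      · exact (aux b a h hab.symm).symm
    · intro hab
      refine ⟨fun h => hab.ne ?_, Or.inl ?_⟩
      · have := hreach1 _ _ h
        rwa [hrep, hrep] at this
      · obtain ⟨x, hx, y, hy, hxy, hcc⟩ := h3 a b hab.ne
        have hxa := huniq _ _ x (hidx ⟨x, a, hx⟩) hx
        have hyb := huniq _ _ y (hidx ⟨y, b, hy⟩) hy
        refine ⟨⟨x, a, hx⟩, ⟨y, b, hy⟩, hreach2 _ _ (hxa.trans (hrep a).symm),
          hreach2 _ _ (hyb.trans (hrep b).symm), hxy, Or.inr ⟨?_, hcc⟩⟩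
        rw [hxa, hyb]; exact hab

end basics





section ramsey
variable {V : Type}

theorem ramsey (n : ℕ) : ∀ a b : ℕ, a + b ≤ n → ∃ N, ∀ (ι : Type) (S : Finset ι), N ≤ S.card →
    ∀ R : ι → ι → Prop, (∀ x y, R x y → R y x) →
    (∃ T ⊆ S, T.card = a ∧ ∀ x ∈ T, ∀ y ∈ T, x ≠ y → R x y) ∨
    (∃ T ⊆ S, T.card = b ∧ ∀ x ∈ T, ∀ y ∈ T, x ≠ y → ¬ R x y) := by
  classical
  induction n with
  | zero =>
    intro a b hab
    refine ⟨0, fun ι S _ R _ => Or.inl ⟨∅, by simp, by simp; omega, by simp⟩⟩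
  | succ n ih =>
    intro a b hab
    rcases Nat.eq_zero_or_pos a with rfl | ha
    · exact ⟨0, fun ι S _ R _ => Or.inl ⟨∅, by simp, by simp, by simp⟩⟩
    rcases Nat.eq_zero_or_pos b with rfl | hb
    · exact ⟨0, fun ι S _ R _ => Or.inr ⟨∅, by simp, by simp, by simp⟩⟩
    obtain ⟨N1, h1⟩ := ih (a - 1) b (by omega)
    obtain ⟨N2, h2⟩ := ih a (b - 1) (by omega)
    refine ⟨N1 + N2 + 1, fun ι S hS R hR => ?_⟩
    obtain ⟨v, hv⟩ : S.Nonempty := Finset.card_pos.mp (by omega)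
    have hcard : ((S.erase v).filter (R v)).card + ((S.erase v).filter (fun w => ¬ R v w)).card
        = S.card - 1 := by
      rw [Finset.card_filter_add_card_filter_not, Finset.card_erase_of_mem hv]
    by_cases h : N1 ≤ ((S.erase v).filter (R v)).card
    · rcases h1 ι _ h R hR with ⟨T, hT, hc, hp⟩ | ⟨T, hT, hc, hp⟩
      · left
        have hvT : v ∉ T := fun h => by simpa using hT h
        refine ⟨insert v T, ?_, ?_, ?_⟩
        · intro x hx
          rcases Finset.mem_insert.mp hx with rfl | hx
          · exact hv
          · have := hT hx; simp at this; exact this.1.2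
        · rw [Finset.card_insert_of_notMem hvT]; omega
        · intro x hx y hy hxy
          rcases Finset.mem_insert.mp hx with rfl | hx' <;> rcases Finset.mem_insert.mp hy with rfl | hy'
          · exact absurd rfl hxy
          · have := hT hy'; simp at this; exact this.2
          · have := hT hx'; simp at this; exact hR _ _ this.2
          · exact hp x hx' y hy' hxy
      · right
        refine ⟨T, fun x hx => ?_, hc, hp⟩
        have := hT hx; simp at this; exact this.1.2
    · have h' : N2 ≤ ((S.erase v).filter (fun w => ¬ R v w)).card := by omega
      rcases h2 ι _ h' R hR with ⟨T, hT, hc, hp⟩ | ⟨T, hT, hc, hp⟩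
      · left
        refine ⟨T, fun x hx => ?_, hc, hp⟩
        have := hT hx; simp at this; exact this.1.2
      · right
        have hvT : v ∉ T := fun h => by simpa using hT h
        refine ⟨insert v T, ?_, ?_, ?_⟩
        · intro x hx
          rcases Finset.mem_insert.mp hx with rfl | hx
          · exact hv
          · have := hT hx; simp at this; exact this.1.2
        · rw [Finset.card_insert_of_notMem hvT]; omega
        · intro x hx y hy hxy
          rcases Finset.mem_insert.mp hx with rfl | hx' <;> rcases Finset.mem_insert.mp hy with rfl | hy'
          · exact absurd rfl hxy
          · have := hT hy'; simp at this; exact this.2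
          · have := hT hx'; simp at this; exact fun h => this.2 (hR _ _ h)
          · exact hp x hx' y hy' hxy

theorem exists_biColor [Finite V] {G : SimpleGraph V} {s : Set V} (hs : Conn G s) :
    ∃ c : V → Bool, Conn (biG G c) s := by
  classical
  obtain ⟨r, hr⟩ := hs.1
  let P : Set (Set V) := {t | t ⊆ s ∧ r ∈ t ∧ ∃ c : V → Bool, Conn (biG G c) t}
  have hP : P.Nonempty := ⟨{r}, by simpa using hr, rfl, fun _ => false, conn_singleton _ _⟩
  obtain ⟨t, ht⟩ := (Set.toFinite P).exists_maximal hP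
  obtain ⟨hts, hrt, c, hc⟩ := ht.1
  by_cases hst : t = s
  · exact ⟨c, hst ▸ hc⟩
  exfalso
  obtain ⟨z, hz, hzt⟩ : ∃ z ∈ s, z ∉ t := by
    by_contra h
    push Not at h
    exact hst (hts.antisymm h)
  obtain ⟨a, b, hab, has, hbs, hat, hbt⟩ := (hs.2 r hr z hz).exists_cross hrt hzt
  have hmem : t ∪ {b} ∈ P := by
    refine ⟨Set.union_subset hts (by simpa using hbs), Or.inl hrt, Function.update c b (!c a), ?_⟩
    have hne : ∀ u ∈ t, u ≠ b := fun u hu h => hbt (h ▸ hu)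
    have h1 : Conn (biG G (Function.update c b (!c a))) t := by
      refine ⟨hc.1, fun x hx y hy => (hc.2 x hx y hy).mono' fun u hu w hw huw => ?_⟩
      refine Reach.single ⟨huw.1, ?_⟩ hu hw
      rw [Function.update_of_ne (hne u hu), Function.update_of_ne (hne w hw)]
      exact huw.2
    refine h1.union_adj (conn_singleton _ b) hat rfl ⟨hab, ?_⟩
    rw [Function.update_self, Function.update_of_ne (hne a hat)]
    cases c a <;> simp
  exact hbt (ht.2 hmem Set.subset_union_left (Or.inr rfl))

theorem ramsey_model (l M : ℕ) : ∃ N, ∀ (V : Type) [Finite V] (G : SimpleGraph V)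
    (ρ : Fin N → Set V), KModel G N ρ → OddModel G l ∨
    ∃ (c : V → Bool) (g : Fin M → Fin N), Function.Injective g ∧
      KModel (biG G c) M (fun i => ρ (g i)) := by
  classical
  obtain ⟨N, hN⟩ := ramsey (l + M) l M le_rfl
  refine ⟨N, fun V _ G ρ h => ?_⟩
  choose c hc using fun i => exists_biColor (h.conn i)
  let R : Fin N → Fin N → Prop := fun i j => ∃ x ∈ ρ i, ∃ y ∈ ρ j, G.Adj x y ∧ c i x = c j y
  rcases hN (Fin N) Finset.univ (by simp) R
    (fun i j ⟨x, hx, y, hy, h1, h2⟩ => ⟨y, hy, x, hx, h1.symm, h2.symm⟩) with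
    ⟨T, -, hT, hp⟩ | ⟨T, -, hT, hp⟩
  · left
    let e : Fin l ≃ T := (T.equivFinOfCardEq hT).symm
    refine oddModel_of_index (fun i => ρ (e i)) (fun i => c (e i)) (fun i => hc _) ?_ ?_
    · intro i j hij
      exact h.disj _ _ (fun h => hij (e.injective (Subtype.ext h)))
    · intro i j hij
      exact hp _ (e i).2 _ (e j).2 (fun h => hij (e.injective (Subtype.ext h)))
  · right
    let e : Fin M ≃ T := (T.equivFinOfCardEq hT).symm
    let c' : V → Bool := fun v => if h : ∃ i, v ∈ ρ i then c h.choose v else false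
    have hc' : ∀ i v, v ∈ ρ i → c' v = c i v := by
      intro i v hv
      have h' : ∃ i, v ∈ ρ i := ⟨i, hv⟩
      have : h'.choose = i := by
        by_contra hne
        exact Set.disjoint_left.mp (h.disj _ _ hne) h'.choose_spec hv
      simp only [c', dif_pos h', this]
    have hinj : ∀ i j, i ≠ j → (e i : Fin N) ≠ e j :=
      fun i j hij h => hij (e.injective (Subtype.ext h))
    refine ⟨c', fun i => e i, fun i j hij => e.injective (Subtype.ext hij), ?_, ?_, ?_⟩
    · intro i
      refine ⟨(hc _).1, fun x hx y hy => ((hc (e i)).2 x hx y hy).mono' fun u hu w hw huw => ?_⟩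
      refine Reach.single ⟨huw.1, ?_⟩ hu hw
      rw [hc' _ _ hu, hc' _ _ hw]; exact huw.2
    · intro i j hij
      exact h.disj _ _ (hinj _ _ hij)
    · intro i j hij
      obtain ⟨x, hx, y, hy, hxy⟩ := h.adj _ _ (hinj _ _ hij)
      refine ⟨x, hx, y, hy, hxy, ?_⟩
      rw [hc' _ _ hx, hc' _ _ hy]
      intro heq
      exact hp _ (e i).2 _ (e j).2 (hinj _ _ hij) ⟨x, hx, y, hy, hxy, heq⟩

end ramsey





section supertree
variable {V : Type}

theorem walk_first_hit {G : SimpleGraph V} {x y : V} (p : G.Walk x y) (P : Set V) (hy : y ∈ P) :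
    ∃ (a : V) (q : G.Walk x a) (r : G.Walk a y), p = q.append r ∧ a ∈ P ∧
      ∀ v ∈ q.support, v ∈ P → v = a := by
  induction p with
  | nil => exact ⟨_, Walk.nil, Walk.nil, rfl, hy, by simp⟩
  | @cons u v w h p ih =>
    by_cases hu : u ∈ P
    · exact ⟨u, Walk.nil, Walk.cons h p, rfl, hu, by simp⟩
    · obtain ⟨a, q, r, rfl, ha, hq⟩ := ih hy
      refine ⟨a, Walk.cons h q, r, rfl, ha, ?_⟩
      intro z hz hzP
      rw [Walk.support_cons, List.mem_cons] at hz
      rcases hz with rfl | hz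
      · exact absurd hzP hu
      · exact hq z hz hzP

theorem append_path_inter {G : SimpleGraph V} {x a y : V} {q : G.Walk x a} {r : G.Walk a y}
    (h : (q.append r).IsPath) {v : V} (hv : v ∈ q.support) (hv' : v ∈ r.support) : v = a := by
  by_contra hne
  have h1 := h.support_nodup
  rw [Walk.support_append, List.nodup_append] at h1
  have : v ∈ r.support.tail := by
    rw [← Walk.cons_tail_support r, List.mem_cons] at hv'
    exact hv'.resolve_left hne
  exact h1.2.2 v hv v this rfl

theorem tripod {B : SimpleGraph V} {T : Set V} (hT : Conn B T) (y : Fin 3 → V)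
    (hy : ∀ d, y d ∈ T) : ∃ (a : V) (Q : Fin 3 → Set V), a ∈ T ∧ (∀ d, Q d ⊆ T) ∧
      (∀ d, a ∉ Q d) ∧ (∀ d e, d ≠ e → Disjoint (Q d) (Q e)) ∧
      (∀ d, Conn B (insert a (Q d))) ∧ ∀ d, y d ∈ insert a (Q d) := by
  classical
  obtain ⟨p, hp, hpT⟩ := (hT.2 _ (hy 0) _ (hy 1)).exists_path (hy 0)
  obtain ⟨q0, hqT⟩ := (hT.2 _ (hy 2) _ (hy 0)).exists_walk (hy 2)
  obtain ⟨a, q, r, rfl, ha, hq⟩ := walk_first_hit q0 {v | v ∈ p.support} p.start_mem_support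
  have ha : a ∈ p.support := ha
  obtain ⟨p1, p2, rfl⟩ : ∃ (p1 : B.Walk (y 0) a) (p2 : B.Walk a (y 1)), p = p1.append p2 :=
    ⟨p.takeUntil a ha, p.dropUntil a ha, (p.take_spec ha).symm⟩
  have hs1 : ∀ v ∈ p1.support, v ∈ (p1.append p2).support := fun v hv => by
    rw [Walk.mem_support_append_iff]; exact Or.inl hv
  have hs2 : ∀ v ∈ p2.support, v ∈ (p1.append p2).support := fun v hv => by
    rw [Walk.mem_support_append_iff]; exact Or.inr hv
  have hs3 : ∀ v ∈ q.support, v ∈ (q.append r).support := fun v hv => by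
    rw [Walk.mem_support_append_iff]; exact Or.inl hv
  let S : Fin 3 → Set V := ![{v | v ∈ p1.support}, {v | v ∈ p2.support}, {v | v ∈ q.support}]
  have haS : ∀ d, a ∈ S d := by
    intro d; fin_cases d
    · exact p1.end_mem_support
    · exact p2.start_mem_support
    · exact q.end_mem_support
  have h01 : ∀ v, v ∈ p1.support → v ∈ p2.support → v = a := fun v h h' => append_path_inter hp h h'
  have h02 : ∀ v, v ∈ p1.support → v ∈ q.support → v = a := fun v h h' => hq v h' (hs1 v h)
  have h12 : ∀ v, v ∈ p2.support → v ∈ q.support → v = a := fun v h h' => hq v h' (hs2 v h)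
  have hins : ∀ d, insert a (S d \ {a}) = S d := fun d => by
    rw [Set.insert_sdiff_singleton, Set.insert_eq_of_mem (haS d)]
  refine ⟨a, fun d => S d \ {a}, hpT a ha, ?_, fun d h => h.2 rfl, ?_, ?_, ?_⟩
  · rintro d v ⟨hv, -⟩
    fin_cases d
    · exact hpT v (hs1 v hv)
    · exact hpT v (hs2 v hv)
    · exact hqT v (hs3 v hv)
  · intro d e hde
    rw [Set.disjoint_left]
    rintro v ⟨hv, hva⟩ ⟨hv', -⟩
    apply hva
    fin_cases d <;> fin_cases e
    · exact absurd rfl hde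
    · exact h01 v hv hv'
    · exact h02 v hv hv'
    · exact h01 v hv' hv
    · exact absurd rfl hde
    · exact h12 v hv hv'
    · exact h02 v hv' hv
    · exact h12 v hv' hv
    · exact absurd rfl hde
  · intro d
    simp only [hins]
    fin_cases d
    · exact Conn.of_walk p1
    · exact Conn.of_walk p2
    · exact Conn.of_walk q
  · intro d
    simp only [hins]
    fin_cases d
    · exact p1.start_mem_support
    · exact p2.end_mem_support
    · exact q.start_mem_support

/-- the vertex set of super-tree `i` -/
def stSet {n : ℕ} (a : Fin n → V) (R : Fin n → Fin 3 → Set V) (i : Fin n) : Set V :=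
  {v | v = a i ∨ ∃ d, v ∈ R i d}

/-- a family of super-trees -/
structure SuperTrees (B : SimpleGraph V) (n : ℕ) (a : Fin n → V) (R : Fin n → Fin 3 → Set V) :
    Prop where
  disjR : ∀ i d j e, (i, d) ≠ (j, e) → Disjoint (R i d) (R j e)
  a_notin : ∀ i j d, a i ∉ R j d
  a_inj : Function.Injective a
  conn : ∀ i d, Conn B (insert (a i) (R i d))
  adj : ∀ i j d, i ≠ j → ∃ x ∈ R i d, ∃ y ∈ stSet a R j, B.Adj x y

theorem exists_superTrees {B : SimpleGraph V} {n : ℕ} {ρ : Fin (4 * n) → Set V}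
    (h : KModel B (4 * n) ρ) : ∃ a R, SuperTrees B n a R ∧
      ∀ i, ∃ m, ρ m ⊆ stSet a R i := by
  classical
  let f : Fin n → Fin 4 → Fin (4 * n) := fun i d => ⟨4 * i + d, by omega⟩
  have hf : ∀ i d j e, f i d = f j e → i = j ∧ d = e := by
    intro i d j e h
    simp only [f, Fin.mk.injEq] at h
    constructor <;> ext <;> omega
  have hadj : ∀ i d, ∃ y ∈ ρ (f i 0), ∃ z ∈ ρ (f i (Fin.succ d)), B.Adj y z := fun i d =>
    h.adj _ _ (fun he => by have := (hf _ _ _ _ he).2; exact absurd this.symm (Fin.succ_ne_zero d))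
  choose y hy z hz hyz using hadj
  choose a Q haT hQT haQ hQd hQc hyQ using fun i => tripod (h.conn (f i 0)) (y i) (hy i)
  have hne : ∀ i d j e, (i, d) ≠ (j, e) → Disjoint (ρ (f i d)) (ρ (f j e)) := by
    intro i d j e hh
    refine h.disj _ _ (fun he => hh ?_)
    obtain ⟨rfl, rfl⟩ := hf _ _ _ _ he; rfl
  have h0 : ∀ d : Fin 3, (0 : Fin 4) ≠ d.succ := fun d => (Fin.succ_ne_zero d).symm
  refine ⟨a, fun i d => Q i d ∪ ρ (f i d.succ), ⟨?_, ?_, ?_, ?_, ?_⟩, ?_⟩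
  · intro i d j e hh
    have h1 : Disjoint (Q i d) (Q j e) := by
      by_cases hij : i = j
      · subst hij
        exact hQd i d e (fun he => hh (by rw [he]))
      · exact (hne i 0 j 0 (by simp [hij])).mono (hQT i d) (hQT j e)
    have h2 : Disjoint (Q i d) (ρ (f j e.succ)) := 
      (hne i 0 j e.succ (by simp [h0])).mono_left (hQT i d)
    have h3 : Disjoint (ρ (f i d.succ)) (Q j e) := 
      (hne i d.succ j 0 (by simp [Fin.succ_ne_zero])).mono_right (hQT j e)
    have h4 : Disjoint (ρ (f i d.succ)) (ρ (f j e.succ)) := hne _ _ _ _ (by simpa using hh)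
    rw [Set.disjoint_union_left, Set.disjoint_union_right, Set.disjoint_union_right]
    exact ⟨⟨h1, h2⟩, h3, h4⟩
  · rintro i j d (hm | hm)
    · by_cases hij : i = j
      · subst hij; exact haQ i d hm
      · exact Set.disjoint_left.mp (hne i 0 j 0 (by simp [hij])) (haT i) (hQT j d hm)
    · exact Set.disjoint_left.mp (hne i 0 j d.succ (by simp [h0])) (haT i) hm
  · intro i j hij
    by_contra hne'
    exact Set.disjoint_left.mp (hne i 0 j 0 (by simp [hne'])) (haT i) (hij ▸ haT j)
  · intro i d
    rw [← Set.insert_union]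
    exact (hQc i d).union_adj (h.conn _) (hyQ i d) (hz i d) (hyz i d)
  · intro i j d hij
    obtain ⟨x, hx, y, hy, hxy⟩ := h.adj (f i d.succ) (f j 1) (fun he => hij (hf _ _ _ _ he).1)
    exact ⟨x, Or.inr hx, y, Or.inr ⟨0, Or.inr hy⟩, hxy⟩
  · intro i
    exact ⟨f i 1, fun v hv => Or.inr ⟨0, Or.inr hv⟩⟩

end supertree





section tutteberge

theorem tutte_sets {K : Type} [Finite K] (H : SimpleGraph K) :
    (∃ f : K → K, (∀ x, f (f x) = x) ∧ ∀ x, H.Adj x (f x)) ∨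
    ∃ (u : Set K) (O : Set (Set K)), (∀ C ∈ O, ∀ D ∈ O, C ≠ D → Disjoint C D) ∧
      (∀ C ∈ O, Odd C.ncard) ∧ (∀ C ∈ O, Disjoint C u) ∧
      (∀ C ∈ O, ∀ x ∈ C, ∀ y, y ∉ u → H.Adj x y → y ∈ C) ∧ u.ncard < O.ncard := by
  classical
  by_cases h : ∃ M : Subgraph H, M.IsPerfectMatching
  · left
    obtain ⟨M, hM⟩ := h
    rw [Subgraph.isPerfectMatching_iff] at hM
    choose f hf hf' using hM
    refine ⟨f, fun x => ?_, fun x => (hf x).adj_sub⟩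
    exact (hf' (f x) x (hf x).symm).symm
  · right
    rw [tutte] at h
    push Not at h
    obtain ⟨u, hu⟩ := h
    unfold IsTutteViolator at hu
    set Q := ((⊤ : H.Subgraph).deleteVerts u) with hQ
    let F : Q.coe.ConnectedComponent → Set K := fun C => Subtype.val '' C.supp
    have hF : Function.Injective F := by
      intro C D hCD
      have : C.supp = D.supp := Subtype.val_injective.image_injective hCD
      exact ConnectedComponent.supp_injective this
    refine ⟨u, F '' Q.coe.oddComponents, ?_, ?_, ?_, ?_, ?_⟩
    · rintro _ ⟨C, -, rfl⟩ _ ⟨D, -, rfl⟩ hne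
      rw [Set.disjoint_left]
      rintro _ ⟨x, hx, rfl⟩ ⟨y, hy, hxy⟩
      have : y = x := Subtype.ext hxy
      subst this
      apply hne
      rw [ConnectedComponent.mem_supp_iff] at hx hy
      rw [← hx, ← hy]
    · rintro _ ⟨C, hC, rfl⟩
      simp only [F]
      rw [Set.ncard_image_of_injective _ Subtype.val_injective]
      exact hC
    · rintro _ ⟨C, -, rfl⟩
      rw [Set.disjoint_left]
      rintro _ ⟨x, -, rfl⟩ hxu
      have := x.2
      simp [hQ] at this
      exact this hxu
    · rintro _ ⟨C, -, rfl⟩ _ ⟨x, hx, rfl⟩ y hy hxy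
      have hyQ : y ∈ Q.verts := by simp [hQ, hy]
      refine ⟨⟨y, hyQ⟩, ?_, rfl⟩
      rw [ConnectedComponent.mem_supp_iff] at hx ⊢
      rw [← hx, ConnectedComponent.eq]
      apply Adj.reachable
      have hxu : (x : K) ∉ u := by
        have := x.2
        simp [hQ] at this
        exact this
      simp [hQ, hy, hxu, hxy.symm]
    · rwa [Set.ncard_image_of_injective _ hF]

/-- `H[S]` plus `d` universal vertices -/
def univExt {K : Type} (H : SimpleGraph K) (S : Set K) (d : ℕ) : SimpleGraph (S ⊕ Fin d) where
  Adj x y := match x, y with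
    | Sum.inl a, Sum.inl b => H.Adj a b
    | Sum.inl _, Sum.inr _ => True
    | Sum.inr _, Sum.inl _ => True
    | Sum.inr i, Sum.inr j => i ≠ j
  symm := ⟨by
    rintro (a | i) (b | j) h
    · exact SimpleGraph.Adj.symm (G := H) h
    · trivial
    · trivial
    · exact fun h' => h h'.symm⟩
  loopless := ⟨by
    rintro (a | i) h
    · exact H.loopless.irrefl _ h
    · exact h rfl⟩

theorem tutte_berge {K : Type} [Finite K] (H : SimpleGraph K) (S : Set K) (d : ℕ)
    (hev : Even (S.ncard + d)) :
    (∃ f : S ⊕ Fin d → S ⊕ Fin d, (∀ x, f (f x) = x) ∧ ∀ x, (univExt H S d).Adj x (f x)) ∨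
    ∃ (X : Set K) (O : Set (Set K)), X ⊆ S ∧ (∀ C ∈ O, ∀ D ∈ O, C ≠ D → Disjoint C D) ∧
      (∀ C ∈ O, Odd C.ncard) ∧ (∀ C ∈ O, C ⊆ S \ X) ∧
      (∀ C ∈ O, ∀ x ∈ C, ∀ y ∈ S \ X, H.Adj x y → y ∈ C) ∧ X.ncard + d < O.ncard := by
  classical
  rcases tutte_sets (univExt H S d) with h | ⟨u, O, hO, hodd, hdu, hcl, hlt⟩
  · exact Or.inl h
  right
  have hcardK : Nat.card (S ⊕ Fin d) = S.ncard + d := by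
    rw [Nat.card_sum]
    simp
  by_cases hall : ∀ j, (Sum.inr j : S ⊕ Fin d) ∈ u
  · have hO2 : ∀ C ∈ O, C = Sum.inl '' (Sum.inl ⁻¹' C : Set S) := by
      intro C hC
      ext z
      rcases z with z | z
      · simp
      · simp only [Set.mem_image, reduceCtorEq, and_false, exists_false, iff_false]
        exact fun hz => Set.disjoint_left.mp (hdu C hC) hz (hall z)
    let F : Set (S ⊕ Fin d) → Set K := fun C => Subtype.val '' (Sum.inl ⁻¹' C : Set S)
    have hF : Set.InjOn F O := by
      intro C hC D hD h
      have := Subtype.val_injective.image_injective h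
      rw [hO2 C hC, hO2 D hD, this]
    refine ⟨F u, F '' O, ?_, ?_, ?_, ?_, ?_, ?_⟩
    · rintro _ ⟨x, -, rfl⟩; exact x.2
    · rintro _ ⟨C, hC, rfl⟩ _ ⟨D, hD, rfl⟩ hne
      have := hO C hC D hD (fun h => hne (by rw [h]))
      rw [Set.disjoint_left] at this ⊢
      rintro _ ⟨x, hx, rfl⟩ ⟨y, hy, hxy⟩
      have hyx : y = x := Subtype.ext hxy
      subst hyx
      exact this hx hy
    · rintro _ ⟨C, hC, rfl⟩
      have h1 := hodd C hC
      rw [hO2 C hC, Set.ncard_image_of_injective _ Sum.inl_injective] at h1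
      simp only [F]
      rwa [Set.ncard_image_of_injective _ Subtype.val_injective]
    · rintro _ ⟨C, hC, rfl⟩ _ ⟨x, hx, rfl⟩
      refine ⟨x.2, ?_⟩
      rintro ⟨y, hy, hxy⟩
      have hyx : y = x := Subtype.ext hxy
      subst hyx
      exact Set.disjoint_left.mp (hdu C hC) hx hy
    · rintro _ ⟨C, hC, rfl⟩ _ ⟨x, hx, rfl⟩ y ⟨hyS, hyX⟩ hxy
      refine ⟨⟨y, hyS⟩, ?_, rfl⟩
      exact hcl C hC (Sum.inl x) hx (Sum.inl ⟨y, hyS⟩) (fun h => hyX ⟨⟨y, hyS⟩, h, rfl⟩) hxy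
    · rw [Set.InjOn.ncard_image hF]
      have hu : u = Sum.inl '' (Sum.inl ⁻¹' u : Set S) ∪ Sum.inr '' (Set.univ : Set (Fin d)) := by
        ext z
        rcases z with z | z
        · simp
        · simp [hall]
      have hucard : u.ncard = (F u).ncard + d := by
        rw [hu, Set.ncard_union_eq, Set.ncard_image_of_injective _ Sum.inl_injective,
          Set.ncard_image_of_injective _ Sum.inr_injective]
        · have : (F u).ncard = (Sum.inl ⁻¹' u : Set S).ncard :=
            Set.ncard_image_of_injective _ Subtype.val_injective
          rw [← hu, this]
          simp
        · rw [Set.disjoint_left]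
          rintro _ ⟨x, -, rfl⟩ ⟨y, -, h⟩
          exact absurd h (by simp)
      omega
  · exfalso
    push Not at hall
    obtain ⟨j, hj⟩ := hall
    have hadj : ∀ z : S ⊕ Fin d, z ≠ Sum.inr j → (univExt H S d).Adj z (Sum.inr j) := by
      rintro (z | z) hz
      · trivial
      · exact fun h => hz (by rw [h])
    have hjO : ∀ C ∈ O, Sum.inr j ∈ C := by
      intro C hC
      obtain ⟨x, hx⟩ : C.Nonempty := by
        rw [← Set.ncard_pos]; exact (hodd C hC).pos
      by_cases hxj : x = Sum.inr j
      · exact hxj ▸ hx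
      · exact hcl C hC x hx _ hj (hadj x hxj)
    have hO1 : O.ncard ≤ 1 := by
      rw [Set.ncard_le_one]
      intro C hC D hD
      by_contra hne
      exact Set.disjoint_left.mp (hO C hC D hD hne) (hjO C hC) (hjO D hD)
    have hu0 : u = ∅ := by
      rw [← Set.ncard_eq_zero]; omega
    obtain ⟨C, hC⟩ : O.Nonempty := by
      rw [← Set.ncard_pos]; omega
    have hCu : C = Set.univ := by
      ext z
      simp only [Set.mem_univ, iff_true]
      by_cases hz : z = Sum.inr j
      · exact hz ▸ hjO C hC
      · exact hcl C hC _ (hjO C hC) z (by simp [hu0]) (hadj z hz).symm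
    have h1 := hodd C hC
    rw [hCu, Set.ncard_univ, hcardK] at h1
    exact (Nat.not_even_iff_odd.mpr h1) hev

/-- a fixed-point-free involution `f` and an involution `N` pair up the fixed points of `N`. -/
theorem involution_pairing {K : Type} [Finite K] (f N : K → K) (hf : ∀ x, f (f x) = x)
    (hf' : ∀ x, f x ≠ x) (hN : ∀ x, N (N x) = x) :
    ∃ (S : ℕ → K → K) (n : K → ℕ), (∀ x, S 0 x = x) ∧ (∀ m x, S (m + 1) x = N (f (S m x))) ∧
    ∀ x, N x = x →
      (∀ m, 0 < m → m ≤ n x → N (S m x) ≠ S m x) ∧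
      S (n x + 1) x = f (S (n x) x) ∧ N (S (n x + 1) x) = S (n x + 1) x ∧
      S (n x + 1) x ≠ x ∧
      (∀ i j, i < j → j ≤ n x + 1 → S i x ≠ S j x ∧ S i x ≠ N (S j x)) ∧
      ∀ y, N y = y → ∀ i j, i ≤ n x + 1 → j ≤ n y + 1 → (S i x = S j y ∨ S i x = N (S j y)) →
        y = x ∨ y = S (n x + 1) x := by
  classical
  let σ : K → K := fun x => N (f x)
  let S : ℕ → K → K := fun m x => σ^[m] x
  have hS0 : ∀ x, S 0 x = x := fun x => rfl
  have hS1 : ∀ m x, S (m + 1) x = N (f (S m x)) := fun m x => Function.iterate_succ_apply' σ m x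
  have hσ : Function.Injective σ := by
    intro x y h
    have h1 : f x = f y := by
      have := congrArg N h
      simpa only [σ, hN] using this
    have := congrArg f h1
    simpa only [hf] using this
  have hSinj : ∀ m, Function.Injective (S m) := fun m => hσ.iterate m
  have hSadd : ∀ i j x, S (i + j) x = S i (S j x) := fun i j x => Function.iterate_add_apply σ i j x
  have hex : ∀ x, N x = x → ∃ m, N (f (S m x)) = f (S m x) := by
    intro x hx
    obtain ⟨i, j, hij, h⟩ := Finite.exists_ne_map_eq_of_infinite (fun m => S m x)
    wlog hlt : i < j generalizing i j
    · exact this j i hij.symm h.symm (by omega)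
    have h2 : S (j - i) x = x := by
      have h3 : S i (S (j - i) x) = S i x := by
        rw [← hSadd]
        have : i + (j - i) = j := by omega
        rw [this]; exact h.symm
      exact hSinj i h3
    refine ⟨j - i - 1, ?_⟩
    have h3 : j - i = (j - i - 1) + 1 := by omega
    rw [h3, hS1] at h2
    have h4 : f (S (j - i - 1) x) = x := by
      have := congrArg N h2
      rwa [hN, hx] at this
    rw [h4, hx]
  let n : K → ℕ := fun x => if h : N x = x then Nat.find (hex x h) else 0
  have hn1 : ∀ x, N x = x → N (f (S (n x) x)) = f (S (n x) x) := by
    intro x hx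
    simp only [n, dif_pos hx]
    exact Nat.find_spec (hex x hx)
  have hn2 : ∀ x, N x = x → ∀ m, m < n x → N (f (S m x)) ≠ f (S m x) := by
    intro x hx m hm
    simp only [n, dif_pos hx] at hm
    exact Nat.find_min (hex x hx) hm
  have hF : ∀ x, N x = x → ∀ m, 0 < m → m ≤ n x → N (S m x) ≠ S m x := by
    intro x hx m hm hmn h
    obtain ⟨m, rfl⟩ : ∃ m', m = m' + 1 := ⟨m - 1, by omega⟩
    rw [hS1, hN] at h
    exact hn2 x hx m (by omega) h.symm
  have hlast : ∀ x, N x = x → S (n x + 1) x = f (S (n x) x) := fun x hx => by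
    rw [hS1, hn1 x hx]
  have hlastN : ∀ x, N x = x → N (S (n x + 1) x) = S (n x + 1) x := fun x hx => by
    rw [hlast x hx, hn1 x hx]
  have hfix : ∀ x, N x = x → ∀ m, 0 < m → m ≤ n x + 1 → N (S m x) = S m x → m = n x + 1 := by
    intro x hx m hm hmn h
    by_contra hne
    exact hF x hx m hm (by omega) h
  -- the reversed sequence
  have hrev : ∀ x, N x = x → ∀ j, j ≤ n x + 1 →
      S j (S (n x + 1) x) = N (S (n x + 1 - j) x) := by
    intro x hx j
    induction j with
    | zero => intro _; rw [hS0, Nat.sub_zero, hlastN x hx]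
    | succ j ih =>
      intro hj
      rw [hS1, ih (by omega)]
      have : n x + 1 - j = (n x + 1 - (j + 1)) + 1 := by omega
      rw [this, hS1, hN, hf]
  have hne : ∀ x, N x = x → S (n x + 1) x ≠ x := by
    intro x hx h
    have hr : ∀ j, j ≤ n x + 1 → S j x = N (S (n x + 1 - j) x) := by
      intro j hj
      have := hrev x hx j hj
      rwa [h] at this
    rcases Nat.even_or_odd (n x) with ⟨t, ht⟩ | ⟨t, ht⟩
    · have h1 := hr t (by omega)
      have h2 : n x + 1 - t = t + 1 := by omega
      rw [h2, hS1, hN] at h1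
      exact hf' _ h1.symm
    · have h1 := hr (t + 1) (by omega)
      have h2 : n x + 1 - (t + 1) = t + 1 := by omega
      rw [h2] at h1
      exact hF x hx (t + 1) (by omega) (by omega) h1.symm
  have hnrev : ∀ x, N x = x → n (S (n x + 1) x) = n x := by
    intro x hx
    have hy := hlastN x hx
    set y := S (n x + 1) x with hydef
    have h1 : S (n x + 1) y = x := by
      rw [hrev x hx _ le_rfl, Nat.sub_self, hS0, hx]
    by_contra hne'
    rcases lt_or_gt_of_ne hne' with hlt | hlt
    · have h2 := hrev x hx (n y + 1) (by omega)
      have h3 := hlastN y hy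
      rw [← hydef] at h2
      rw [h2, hN] at h3
      exact hF x hx (n x + 1 - (n y + 1)) (by omega) (by omega) h3.symm
    · have := hfix y hy (n x + 1) (by omega) (by omega) (by rw [h1, hx])
      omega
  have hcross : ∀ x y, N x = x → N y = y → ∀ i j, i ≤ n x + 1 → j ≤ n y + 1 → S i x = S j y →
      y = x ∨ y = S (n x + 1) x := by
    intro x y hx hy i j hi hj h
    rcases lt_trichotomy i j with hij | hij | hij
    · have h1 : S i x = S i (S (j - i) y) := by
        rw [← hSadd, h]; congr 1; omega
      have h2 := hSinj i h1
      have h3 := hfix y hy (j - i) (by omega) (by omega) (by rw [← h2, hx])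
      right
      have h4 := hrev y hy (n y + 1) le_rfl
      rw [h3] at h2
      rw [← h2] at h4
      have h5 := hnrev y hy
      rw [← h2] at h5
      rw [h5, h4, Nat.sub_self, hS0, hy]
    · subst hij
      exact Or.inl (hSinj i h).symm
    · have h1 : S j y = S j (S (i - j) x) := by
        rw [← hSadd, ← h]; congr 1; omega
      have h2 := hSinj j h1
      have h3 := hfix x hx (i - j) (by omega) (by omega) (by rw [← h2, hy])
      right
      rw [h2, h3]
  refine ⟨S, n, hS0, hS1, fun x hx => ⟨hF x hx, hlast x hx, hlastN x hx, hne x hx, ?_, ?_⟩⟩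
  · intro i j hij hj
    constructor
    · intro h
      have h1 : S i x = S i (S (j - i) x) := by
        rw [← hSadd, h]; congr 1; omega
      have h2 := hSinj i h1
      have h3 := hfix x hx (j - i) (by omega) (by omega) (by rw [← h2, hx])
      rw [h3] at h2
      exact hne x hx h2.symm
    · intro h
      have h0 := hrev x hx (n x + 1 - j) (by omega)
      have h00 : n x + 1 - (n x + 1 - j) = j := by omega
      rw [h00, ← h] at h0
      set y := S (n x + 1) x with hydef
      rcases le_or_gt i (n x + 1 - j) with hle | hlt
      · have h1 : S i x = S i (S (n x + 1 - j - i) y) := by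
          rw [← hSadd, ← h0]; congr 1; omega
        have h2 := hSinj i h1
        rcases Nat.eq_zero_or_pos (n x + 1 - j - i) with hz | hz
        · rw [hz, hS0] at h2
          exact hne x hx h2.symm
        · have h3 := hnrev x hx
          rw [← hydef] at h3
          have := hfix y (hlastN x hx) _ hz (by omega) (by rw [← h2, hx])
          omega
      · have h1 : S (n x + 1 - j) y = S (n x + 1 - j) (S (i - (n x + 1 - j)) x) := by
          rw [h0, ← hSadd]; congr 1; omega
        have h2 := hSinj _ h1
        have := hfix x hx (i - (n x + 1 - j)) (by omega) (by omega) (by rw [← h2, hlastN x hx])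
        omega
  · intro y hy i j hi hj h
    rcases h with h | h
    · exact hcross x y hx hy i j hi hj h
    · have h0 := hrev y hy (n y + 1 - j) (by omega)
      have h00 : n y + 1 - (n y + 1 - j) = j := by omega
      rw [h00, ← h] at h0
      have h5 := hnrev y hy
      rcases hcross x _ hx (hlastN y hy) i _ hi (by rw [h5]; omega) h0.symm with h1 | h1
      · right
        have h4 := hrev y hy (n y + 1) le_rfl
        rw [Nat.sub_self, hS0, hy] at h4
        rw [h1] at h5 h4
        rw [h5]; exact h4.symm
      · left
        have h4 := hrev y hy (n y + 1) le_rfl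
        have h6 := hrev x hx (n x + 1) le_rfl
        rw [Nat.sub_self, hS0, hx] at h6
        rw [h1, hnrev x hx] at h5
        rw [Nat.sub_self, hS0, hy, h1, ← h5, h6] at h4
        exact h4.symm

end tutteberge





section erdosposa
variable {V : Type}

/-- breaking `A`-path -/
structure BPath (G : SimpleGraph V) (A : Set V) (c : V → Bool) where
  u : V
  v : V
  p : G.Walk u v
  path : p.IsPath
  hu : u ∈ A
  hv : v ∈ A
  ne : u ≠ v
  int : ∀ w ∈ p.support, w ∈ A → w = u ∨ w = v
  brk : c v ≠ (c u ^^ p.length.bodd)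

theorem walk_of_fun {G : SimpleGraph V} (v : ℕ → V) (L : ℕ)
    (h : ∀ m < L, G.Adj (v m) (v (m + 1))) :
    ∃ p : G.Walk (v 0) (v L), p.length = L ∧ p.support = (List.range (L + 1)).map v := by
  induction L with
  | zero => exact ⟨Walk.nil, rfl, by simp⟩
  | succ L ih =>
    obtain ⟨p, hp, hs⟩ := ih (fun m hm => h m (by omega))
    refine ⟨p.concat (h L (by omega)), by simp [hp], ?_⟩
    rw [Walk.support_concat, hs, List.range_succ (n := L + 1), List.map_append]
    simp

/-- the doubled graph -/
def dblG (G : SimpleGraph V) : SimpleGraph (V × Bool) where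
  Adj x y := (x.2 = y.2 ∧ G.Adj x.1 y.1) ∨ (x.1 = y.1 ∧ x.2 ≠ y.2)
  symm := ⟨fun _ _ h => h.imp (fun h => ⟨h.1.symm, h.2.symm⟩) (fun h => ⟨h.1.symm, h.2.symm⟩)⟩
  loopless := ⟨fun _ h => h.elim (fun h => G.loopless.irrefl _ h.2) (fun h => h.2 rfl)⟩

/-- vertices of the gadget -/
def dblS (A : Set V) (c : V → Bool) : Set (V × Bool) := {x | x.1 ∉ A ∨ x.2 = c x.1}

theorem matching_paths [Finite V] (G : SimpleGraph V) (A : Set V) (c : V → Bool) (k d : ℕ)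
    (hd : A.ncard = 2 * k + d)
    (f : dblS A c ⊕ Fin d → dblS A c ⊕ Fin d) (hf : ∀ x, f (f x) = x)
    (hadj : ∀ x, (univExt (dblG G) (dblS A c) d).Adj x (f x)) :
    ∃ P : Fin k → BPath G A c, ∀ i j, i ≠ j →
      Disjoint {w | w ∈ (P i).p.support} {w | w ∈ (P j).p.support} := by
  classical
  have hmk : ∀ z : dblS A c, z.1.1 ∉ A → (z.1.1, !z.1.2) ∈ dblS A c := fun z h => Or.inl h
  let N : dblS A c ⊕ Fin d → dblS A c ⊕ Fin d := fun x => match x with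
    | Sum.inl z => if h : z.1.1 ∈ A then Sum.inl z else Sum.inl ⟨(z.1.1, !z.1.2), hmk z h⟩
    | Sum.inr j => Sum.inr j
  have hNA : ∀ z : dblS A c, z.1.1 ∈ A → N (Sum.inl z) = Sum.inl z := by
    intro z hz; simp only [N, dif_pos hz]
  have hNnA : ∀ z : dblS A c, ∀ h : z.1.1 ∉ A,
      N (Sum.inl z) = Sum.inl ⟨(z.1.1, !z.1.2), hmk z h⟩ := by
    intro z hz; simp only [N, dif_neg hz]
  have hN : ∀ x, N (N x) = x := by
    rintro (z | j)
    · by_cases hz : z.1.1 ∈ A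
      · rw [hNA z hz, hNA z hz]
      · rw [hNnA z hz, hNnA ⟨_, hmk z hz⟩ hz]
        simp
    · rfl
  have hNfix : ∀ z : dblS A c, N (Sum.inl z) = Sum.inl z ↔ z.1.1 ∈ A := by
    intro z
    refine ⟨fun h => ?_, hNA z⟩
    by_contra hz
    rw [hNnA z hz] at h
    have := congrArg (fun z => z.1.2) (Sum.inl_injective h)
    simp at this
  obtain ⟨S, n, hS0, hS1, hS⟩ := involution_pairing f N hf (fun x => (hadj x).ne') hN
  let x : V → dblS A c ⊕ Fin d := fun a => Sum.inl ⟨(a, c a), Or.inr rfl⟩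
  have hx : ∀ a ∈ A, N (x a) = x a := fun a ha => hNA _ ha
  have hlab : ∀ z : dblS A c, z.1.1 ∈ A → z.1.2 = c z.1.1 := fun z hz =>
    z.2.resolve_left (fun h => h hz)
  have hsame : ∀ z z' : dblS A c, z.1.1 = z'.1.1 →
      (Sum.inl z : dblS A c ⊕ Fin d) = Sum.inl z' ∨ (Sum.inl z : dblS A c ⊕ Fin d) = N (Sum.inl z') := by
    intro z z' h
    by_cases hl : z.1.2 = z'.1.2
    · left; congr 1; exact Subtype.ext (Prod.ext h hl)
    · right
      have hz : z'.1.1 ∉ A := by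
        intro hz
        apply hl
        rw [hlab z' hz, hlab z (h ▸ hz), h]
      rw [hNnA z' hz]
      congr 1
      refine Subtype.ext (Prod.ext h ?_)
      simp only
      revert hl
      cases z.1.2 <;> cases z'.1.2 <;> simp
  -- the path from `a`
  have hpath : ∀ a ∈ A, (∃ z, S (n (x a) + 1) (x a) = Sum.inl z) →
      ∃ P : BPath G A c, P.u = a ∧ ∀ w ∈ P.p.support, ∃ i ≤ n (x a) + 1, ∃ z,
        S i (x a) = Sum.inl z ∧ z.1.1 = w := by
    intro a ha hlast
    obtain ⟨h1, h2, h3, h4, h5, -⟩ := hS (x a) (hx a ha)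
    set L := n (x a) with hL
    have hinl : ∀ m, m ≤ L + 1 → ∃ z, S m (x a) = Sum.inl z := by
      intro m hm
      rcases Nat.eq_zero_or_pos m with rfl | hm0
      · exact ⟨_, hS0 _⟩
      rcases Nat.lt_or_ge L m with hlt | hle
      · have : m = L + 1 := by omega
        subst this; exact hlast
      · rcases hz : S m (x a) with z | j
        · exact ⟨z, rfl⟩
        · exfalso
          apply h1 m hm0 hle
          rw [hz]
    let zf : ℕ → dblS A c := fun m => if h : m ≤ L + 1 then (hinl m h).choose else ⟨(a, c a), Or.inr rfl⟩
    have hzf : ∀ m, m ≤ L + 1 → S m (x a) = Sum.inl (zf m) := by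
      intro m hm
      simp only [zf, dif_pos hm]
      exact (hinl m hm).choose_spec
    have hz0 : (zf 0).1 = (a, c a) := by
      have := hzf 0 (by omega)
      rw [hS0] at this
      rw [← Sum.inl_injective this]
    have hnA : ∀ m, 0 < m → m ≤ L → (zf m).1.1 ∉ A := by
      intro m hm hmL h
      apply h1 m hm hmL
      rw [hzf m (by omega)]
      exact hNA _ h
    have hstep : ∀ m, m ≤ L → G.Adj (zf m).1.1 (zf (m + 1)).1.1 ∧
        (zf (m + 1)).1.2 = if (zf (m + 1)).1.1 ∈ A then (zf m).1.2 else !(zf m).1.2 := by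
      intro m hm
      have e1 : f (S m (x a)) = N (S (m + 1) (x a)) := by rw [hS1, hN]
      have e2 := hadj (S m (x a))
      rw [e1, hzf m (by omega), hzf (m + 1) (by omega)] at e2
      by_cases hA : (zf (m + 1)).1.1 ∈ A
      · rw [hNA _ hA] at e2
        rw [if_pos hA]
        rcases e2 with e2 | e2
        · exact ⟨e2.2, e2.1.symm⟩
        · exfalso
          apply e2.2
          rw [hlab _ hA, hlab _ (e2.1 ▸ hA), e2.1]
      · rw [hNnA _ hA] at e2
        rw [if_neg hA]
        rcases e2 with e2 | e2
        · refine ⟨e2.2, ?_⟩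
          have := e2.1
          simp only at this
          rw [this]; simp
        · exfalso
          apply (h5 m (m + 1) (by omega) (by omega)).1
          rw [hzf m (by omega), hzf (m + 1) (by omega)]
          congr 1
          refine Subtype.ext (Prod.ext e2.1 ?_)
          have := e2.2
          simp only at this
          revert this
          cases (zf m).1.2 <;> cases (zf (m + 1)).1.2 <;> simp
    have hlabel : ∀ m, m ≤ L → (zf m).1.2 = (c a ^^ m.bodd) := by
      intro m
      induction m with
      | zero => intro _; rw [hz0]; simp
      | succ m ih =>
        intro hm
        rw [(hstep m (by omega)).2, if_neg (hnA (m + 1) (by omega) hm), ih (by omega)]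
        simp only [Nat.bodd_succ]
        cases c a <;> cases m.bodd <;> rfl
    have hbA : (zf (L + 1)).1.1 ∈ A := by
      rw [hzf (L + 1) le_rfl] at h3
      exact (hNfix _).1 h3
    have hinj : ∀ i j, i < j → j ≤ L + 1 → (zf i).1.1 ≠ (zf j).1.1 := by
      intro i j hij hj h
      have h6 := h5 i j hij hj
      rw [hzf i (by omega), hzf j hj] at h6
      rcases hsame _ _ h with h7 | h7
      · exact h6.1 h7
      · exact h6.2 h7
    obtain ⟨p, hp1, hp2⟩ := walk_of_fun (G := G) (fun m => (zf m).1.1) (L + 1)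
      (fun m hm => (hstep m (by omega)).1)
    have hz0' : (zf 0).1.1 = a := by rw [hz0]
    refine ⟨⟨_, _, p, ?_, ?_, hbA, ?_, ?_, ?_⟩, hz0', ?_⟩
    · rw [Walk.isPath_def, hp2]
      refine (List.nodup_map_iff_inj_on List.nodup_range).mpr ?_
      intro i hi j hj hij
      rw [List.mem_range] at hi hj
      rcases lt_trichotomy i j with h | h | h
      · exact absurd hij (hinj i j h (by omega))
      · exact h
      · exact absurd hij.symm (hinj j i h (by omega))
    · rw [hz0']; exact ha
    · exact hinj 0 (L + 1) (by omega) le_rfl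
    · intro w hw hwA
      rw [hp2, List.mem_map] at hw
      obtain ⟨m, hm, rfl⟩ := hw
      rw [List.mem_range] at hm
      rcases Nat.eq_zero_or_pos m with rfl | hm0
      · exact Or.inl rfl
      · right
        by_cases hmL : m ≤ L
        · exact absurd hwA (hnA m hm0 hmL)
        · have : m = L + 1 := by omega
          rw [this]
    · rw [hp1, hz0']
      have e := (hstep L le_rfl).2
      rw [if_pos hbA, hlab _ hbA, hlabel L le_rfl] at e
      rw [e, Nat.bodd_succ]
      cases c a <;> cases L.bodd <;> simp
    · intro w hw
      rw [hp2, List.mem_map] at hw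
      obtain ⟨m, hm, rfl⟩ := hw
      rw [List.mem_range] at hm
      exact ⟨m, by omega, _, hzf m (by omega), rfl⟩
  let A' : Set V := {a | a ∈ A ∧ ∃ z, S (n (x a) + 1) (x a) = Sum.inl z}
  have hxinj : Function.Injective x := fun a b h => by
    have := Sum.inl_injective h
    simpa using congrArg (fun z => z.1.1) this
  have hA' : 2 * k ≤ A'.ncard := by
    have h1 : (A \ A').ncard ≤ (Set.univ : Set (Fin d)).ncard := by
      have : ∀ a ∈ A \ A', ∃ j : Fin d, S (n (x a) + 1) (x a) = Sum.inr j := by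
        rintro a ⟨ha, ha'⟩
        rcases hz : S (n (x a) + 1) (x a) with z | j
        · exact absurd ⟨ha, z, hz⟩ ha'
        · exact ⟨j, rfl⟩
      by_cases hd0 : d = 0
      · have : A \ A' = ∅ := by
          ext a
          simp only [Set.mem_empty_iff_false, iff_false]
          intro ha
          obtain ⟨j, -⟩ := this a ha
          subst hd0
          exact j.elim0
        rw [this]; simp
      · have : ∃ g : V → Fin d, ∀ a ∈ A \ A', S (n (x a) + 1) (x a) = Sum.inr (g a) := by
          refine ⟨fun a => if h : a ∈ A \ A' then (this a h).choose else ⟨0, by omega⟩, ?_⟩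
          intro a ha
          simp only [dif_pos ha]
          exact (this a ha).choose_spec
        obtain ⟨g, hg⟩ := this
        refine Set.ncard_le_ncard_of_injOn g (fun _ _ => Set.mem_univ _) ?_
        intro a ha b hb hab
        have e1 := hg a ha
        have e2 := hg b hb
        obtain ⟨-, -, -, -, -, h6⟩ := hS (x a) (hx a ha.1)
        rcases h6 (x b) (hx b hb.1) _ _ le_rfl le_rfl (Or.inl (by rw [e1, e2, hab])) with h | h
        · exact (hxinj h).symm
        · rw [e1] at h
          exact absurd h (by simp [x])
    have h2 : A'.ncard + (A \ A').ncard = A.ncard := by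
      rw [add_comm]
      exact Set.ncard_sdiff_add_ncard_of_subset (fun a ha => ha.1)
    rw [Set.ncard_univ, Nat.card_fin] at h1
    omega
  have hPex : ∀ a, ∃ P : Option (BPath G A c), a ∈ A' → ∃ Q, P = some Q ∧ 
      ∀ w ∈ Q.p.support, ∃ i ≤ n (x a) + 1, ∃ z, S i (x a) = Sum.inl z ∧ z.1.1 = w := by
    intro a
    by_cases ha : a ∈ A'
    · obtain ⟨P, -, hP⟩ := hpath a ha.1 ha.2
      exact ⟨some P, fun _ => ⟨P, rfl, hP⟩⟩
    · exact ⟨none, fun h => absurd h ha⟩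
  choose P hP using hPex
  let Dj : V → V → Prop := fun a b => ∀ Q Q', P a = some Q → P b = some Q' →
    Disjoint {w | w ∈ Q.p.support} {w | w ∈ Q'.p.support}
  have hconf : ∀ a ∈ A', ∀ b ∈ A', a ≠ b → ¬ Dj a b → x b = S (n (x a) + 1) (x a) := by
    intro a ha b hb hab hD
    obtain ⟨Q, hQ, hQ'⟩ := hP a ha
    obtain ⟨R, hR, hR'⟩ := hP b hb
    have : ¬ Disjoint {w | w ∈ Q.p.support} {w | w ∈ R.p.support} := by
      intro h
      apply hD
      intro Q1 Q2 h1 h2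
      rw [hQ] at h1; rw [hR] at h2
      cases h1; cases h2
      exact h
    rw [Set.not_disjoint_iff] at this
    obtain ⟨w, hw1, hw2⟩ := this
    obtain ⟨i, hi, z, hz, hzw⟩ := hQ' w hw1
    obtain ⟨j, hj, z', hz', hzw'⟩ := hR' w hw2
    obtain ⟨-, -, -, -, -, h6⟩ := hS (x a) (hx a ha.1)
    rcases h6 (x b) (hx b hb.1) i j hi hj (by
      rw [hz, hz']
      exact hsame z z' (hzw.trans hzw'.symm)) with h | h
    · exact absurd (hxinj h).symm hab
    · exact h
  let 𝒯 : Set (Set V) := {T | T ⊆ A' ∧ ∀ a ∈ T, ∀ b ∈ T, a ≠ b → Dj a b}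
  obtain ⟨T, hT⟩ := (Set.toFinite 𝒯).exists_maximal ⟨∅, by simp, by simp⟩
  have hTk : k ≤ T.ncard := by
    have hgex : ∀ t, ∃ g : V, ∀ b, x b = S (n (x t) + 1) (x t) → b = g := by
      intro t
      by_cases h : ∃ b, x b = S (n (x t) + 1) (x t)
      · obtain ⟨b, hb⟩ := h
        exact ⟨b, fun b' hb' => hxinj (hb'.trans hb.symm)⟩
      · exact ⟨t, fun b hb => absurd ⟨b, hb⟩ h⟩
    choose g hg using hgex
    have hsub : A' ⊆ T ∪ g '' T := by
      intro b hb
      by_contra hbn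
      rw [Set.mem_union, not_or] at hbn
      have hall : ∀ t ∈ T, Dj t b := by
        intro t ht
        by_contra hD
        apply hbn.2
        refine ⟨t, ht, ?_⟩
        exact (hg t b (hconf t (hT.1.1 ht) b hb (fun h => hbn.1 (h ▸ ht)) hD)).symm
      have hmem : insert b T ∈ 𝒯 := by
        refine ⟨Set.insert_subset hb hT.1.1, ?_⟩
        rintro a (rfl | ha) a' (rfl | ha') hne
        · exact absurd rfl hne
        · intro Q Q' h h'
          exact (hall a' ha' Q' Q h' h).symm
        · exact hall a ha
        · exact hT.1.2 a ha a' ha' hne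
      exact hbn.1 (hT.2 hmem (Set.subset_insert b T) (Set.mem_insert b T))
    have h1 := Set.ncard_le_ncard hsub
    have h2 := Set.ncard_union_le T (g '' T)
    have h3 := Set.ncard_image_le (f := g) (Set.toFinite T)
    omega
  obtain ⟨T', hT', hT'k⟩ := Set.exists_subset_card_eq hTk
  have : Nat.card T' = k := hT'k
  let e : Fin k ≃ T' := (Finite.equivFinOfCardEq this).symm
  have hsome : ∀ i, ∃ Q, P (e i) = some Q := fun i => by
    obtain ⟨Q, hQ, -⟩ := hP (e i) (hT.1.1 (hT' (e i).2))
    exact ⟨Q, hQ⟩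
  choose Q hQ using hsome
  refine ⟨Q, fun i j hij => ?_⟩
  exact hT.1.2 _ (hT' (e i).2) _ (hT' (e j).2) (fun h => hij (e.injective (Subtype.ext h))) _ _
    (hQ i) (hQ j)

end erdosposa





section erdosposa2
variable {V : Type}

/-- flip the second coordinate -/
def flp (z : V × Bool) : V × Bool := (z.1, !z.2)

theorem flp_flp (z : V × Bool) : flp (flp z) = z := by simp [flp]

theorem flp_inj : Function.Injective (flp : V × Bool → V × Bool) := fun x y h => by
  rw [← flp_flp x, h, flp_flp]

theorem even_of_flp [Finite V] (C : Set (V × Bool)) (h : ∀ z ∈ C, flp z ∈ C) : Even C.ncard := by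
  have h1 : C = {z ∈ C | z.2 = true} ∪ {z ∈ C | z.2 = false} := by
    ext z
    simp only [Set.mem_union, Set.mem_ofPred_eq]
    cases z.2 <;> simp
  have h2 : flp '' {z ∈ C | z.2 = true} = {z ∈ C | z.2 = false} := by
    ext z
    constructor
    · rintro ⟨y, ⟨hy, hy'⟩, rfl⟩
      exact ⟨h y hy, by simp [flp, hy']⟩
    · rintro ⟨hz, hz'⟩
      exact ⟨flp z, ⟨h z hz, by simp [flp, hz']⟩, flp_flp z⟩
  have h3 : C.ncard = {z ∈ C | z.2 = true}.ncard + {z ∈ C | z.2 = false}.ncard := by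
    conv_lhs => rw [h1]
    refine Set.ncard_union_eq ?_
    rw [Set.disjoint_left]
    rintro z ⟨-, hz⟩ ⟨-, hz'⟩
    rw [hz] at hz'; cases hz'
  rw [← h2, Set.ncard_image_of_injective _ flp_inj] at h3
  exact ⟨_, h3⟩

theorem violator_hit [Finite V] (G : SimpleGraph V) (A : Set V) (c : V → Bool) (k d : ℕ)
    (hd : A.ncard = 2 * k + d) (X : Set (V × Bool)) (O : Set (Set (V × Bool)))
    (hXS : X ⊆ dblS A c) (hdisj : ∀ C ∈ O, ∀ D ∈ O, C ≠ D → Disjoint C D)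
    (hodd : ∀ C ∈ O, Odd C.ncard) (hsub : ∀ C ∈ O, C ⊆ dblS A c \ X)
    (hcl : ∀ C ∈ O, ∀ x ∈ C, ∀ y ∈ dblS A c \ X, (dblG G).Adj x y → y ∈ C)
    (hlt : X.ncard + d < O.ncard) :
    ∃ Y : Set V, Y.ncard ≤ 4 * k ∧ ∀ P : BPath G A c, ∃ w ∈ P.p.support, w ∈ Y := by
  classical
  set S := dblS A c with hSdef
  let Bd : Set (V × Bool) := {z | z ∈ S \ X ∧ (z.1 ∈ A ∨ flp z ∈ X)}
  let Bad : Set (V × Bool) := {z | z ∈ Bd ∧ ∃ z' ∈ Bd, z' ≠ z ∧ Reach (dblG G) (S \ X) z z'}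
  let XA : Set V := {a | a ∈ A ∧ (a, c a) ∈ X}
  let X2 : Set V := {v | v ∉ A ∧ (v, true) ∈ X ∧ (v, false) ∈ X}
  have hBB : Bad ⊆ Bd := fun z hz => hz.1
  have hlab : ∀ z ∈ S, z.1 ∈ A → z.2 = c z.1 := fun z hz h => hz.resolve_left (fun h' => h' h)
  -- counting
  have hC1 : ∀ C ∈ O, (C ∩ Bd).Nonempty := by
    intro C hC
    by_contra hemp
    rw [Set.not_nonempty_iff_eq_empty] at hemp
    have hno : ∀ z ∈ C, z ∉ Bd := fun z hz hz' => by
      have : z ∈ C ∩ Bd := ⟨hz, hz'⟩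
      rw [hemp] at this; exact this
    have := even_of_flp C (fun z hz => by
      have hz1 := hno z hz
      have hzS := hsub C hC hz
      have hzA : z.1 ∉ A := fun h => hz1 ⟨hzS, Or.inl h⟩
      have hzX : flp z ∉ X := fun h => hz1 ⟨hzS, Or.inr h⟩
      refine hcl C hC z hz (flp z) ⟨Or.inl hzA, hzX⟩ (Or.inr ⟨rfl, ?_⟩)
      simp [flp])
    exact (Nat.not_even_iff_odd.mpr (hodd C hC)) this
  have hclR : ∀ C ∈ O, ∀ x ∈ C, ∀ y, Reach (dblG G) (S \ X) x y → y ∈ C := by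
    intro C hC x hx y hxy
    exact hxy.invariant hx (fun a b hab _ hb ha => hcl C hC a ha b hb hab)
  have hC2 : ∀ C ∈ O, (Bad ∩ C).ncard + 2 ≤ 2 * (Bd ∩ C).ncard := by
    intro C hC
    have h1 : 0 < (Bd ∩ C).ncard := by
      rw [Set.ncard_pos, Set.inter_comm]; exact hC1 C hC
    have h2 : (Bad ∩ C).ncard ≤ (Bd ∩ C).ncard :=
      Set.ncard_le_ncard (Set.inter_subset_inter_left _ hBB)
    by_cases h3 : (Bd ∩ C).ncard = 1
    · rw [Set.ncard_eq_one] at h3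
      obtain ⟨b, hb⟩ := h3
      have : Bad ∩ C = ∅ := by
        ext z
        simp only [Set.mem_empty_iff_false, iff_false]
        rintro ⟨⟨hz, z', hz', hne, hr⟩, hzC⟩
        have e1 : z ∈ Bd ∩ C := ⟨hz, hzC⟩
        have e2 : z' ∈ Bd ∩ C := ⟨hz', hclR C hC z hzC z' hr⟩
        rw [hb] at e1 e2
        exact hne (e2.trans e1.symm)
      rw [this, hb]; simp
    · omega
  have hsum : ∀ F : Finset (Set (V × Bool)), (∀ C ∈ F, C ∈ O) →
      (Bad ∩ ⋃₀ F).ncard + 2 * F.card ≤ 2 * (Bd ∩ ⋃₀ F).ncard := by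
    intro F
    induction F using Finset.induction_on with
    | empty => intro _; simp
    | insert C F hCF ih =>
      intro hF
      have ih' := ih (fun D hD => hF D (Finset.mem_insert_of_mem hD))
      have hCO := hF C (Finset.mem_insert_self C F)
      have hdis : Disjoint C (⋃₀ (F : Set (Set (V × Bool)))) := by
        rw [Set.disjoint_sUnion_right]
        intro D hD
        exact hdisj C hCO D (hF D (Finset.mem_insert_of_mem hD)) (fun h => hCF (h ▸ hD))
      have key : ∀ B : Set (V × Bool), (B ∩ ⋃₀ ((insert C F : Finset _) : Set (Set (V × Bool)))).ncard
          = (B ∩ C).ncard + (B ∩ ⋃₀ (F : Set (Set (V × Bool)))).ncard := by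
        intro B
        rw [Finset.coe_insert, Set.sUnion_insert, Set.inter_union_distrib_left]
        exact Set.ncard_union_eq (hdis.mono Set.inter_subset_right Set.inter_subset_right)
      rw [key, key, Finset.card_insert_of_notMem hCF]
      have := hC2 C hCO
      omega
  have hbig : Bad.ncard + 2 * O.ncard ≤ 2 * Bd.ncard := by
    have h1 := hsum (Set.toFinite O).toFinset (by simp)
    rw [Set.Finite.coe_toFinset, ← Set.ncard_eq_toFinset_card] at h1
    have h2 := Set.ncard_inter_add_ncard_sdiff_eq_ncard Bad (⋃₀ O)
    have h3 := Set.ncard_inter_add_ncard_sdiff_eq_ncard Bd (⋃₀ O)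
    have h4 : (Bad \ ⋃₀ O).ncard ≤ (Bd \ ⋃₀ O).ncard :=
      Set.ncard_le_ncard (Set.sdiff_subset_sdiff_left hBB)
    omega
  have hBdc : Bd.ncard + 2 * X2.ncard + 2 * XA.ncard ≤ A.ncard + X.ncard := by
    let BdA : Set (V × Bool) := {z | z ∈ Bd ∧ z.1 ∈ A}
    let Bd1 : Set (V × Bool) := {z | z ∈ Bd ∧ z.1 ∉ A}
    have e0 : Bd.ncard ≤ BdA.ncard + Bd1.ncard := by
      refine le_trans (Set.ncard_le_ncard ?_) (Set.ncard_union_le _ _)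
      intro z hz
      by_cases h : z.1 ∈ A
      · exact Or.inl ⟨hz, h⟩
      · exact Or.inr ⟨hz, h⟩
    have e1 : BdA.ncard + XA.ncard ≤ A.ncard := by
      have hi : Set.InjOn Prod.fst BdA := by
        intro z hz z' hz' h
        refine Prod.ext h ?_
        rw [hlab z hz.1.1.1 hz.2, hlab z' hz'.1.1.1 hz'.2, h]
      rw [← hi.ncard_image, ← Set.ncard_union_eq]
      · refine Set.ncard_le_ncard ?_
        rintro v (⟨z, hz, rfl⟩ | hv)
        · exact hz.2
        · exact hv.1
      · rw [Set.disjoint_left]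
        rintro _ ⟨z, hz, rfl⟩ hv
        apply hz.1.1.2
        have := hv.2
        rw [← hlab z hz.1.1.1 hz.2] at this
        exact this
    have e2 : Bd1.ncard + X2.ncard + X2.ncard + XA.ncard ≤ X.ncard := by
      have i1 : (flp '' Bd1).ncard = Bd1.ncard := Set.ncard_image_of_injective _ flp_inj
      have i2 : ((fun v => (v, true)) '' X2).ncard = X2.ncard :=
        Set.ncard_image_of_injective _ (fun a b h => by simpa using h)
      have i3 : ((fun v => (v, false)) '' X2).ncard = X2.ncard :=
        Set.ncard_image_of_injective _ (fun a b h => by simpa using h)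
      have i4 : ((fun v => (v, c v)) '' XA).ncard = XA.ncard :=
        Set.ncard_image_of_injective _ (fun a b h => by simp at h; exact h.1)
      rw [← i1]
      nth_rewrite 1 [← i2]
      nth_rewrite 1 [← i3]
      rw [← i4, ← Set.ncard_union_eq, ← Set.ncard_union_eq, ← Set.ncard_union_eq]
      · refine Set.ncard_le_ncard ?_
        rintro z (((⟨y, hy, rfl⟩ | ⟨y, hy, rfl⟩) | ⟨y, hy, rfl⟩) | ⟨y, hy, rfl⟩)
        · exact hy.1.2.resolve_left hy.2
        · exact hy.2.1
        · exact hy.2.2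
        · exact hy.2
      · rw [Set.disjoint_left]
        rintro z ((⟨y, hy, rfl⟩ | ⟨y, hy, rfl⟩) | ⟨y, hy, rfl⟩) ⟨w, hw, hwz⟩
        · exact hy.2 (by have := congrArg Prod.fst hwz; simp only [flp] at this; exact this ▸ hw.1)
        · exact hy.1 (by have := congrArg Prod.fst hwz; simp only at this; exact this ▸ hw.1)
        · exact hy.1 (by have := congrArg Prod.fst hwz; simp only at this; exact this ▸ hw.1)
      · rw [Set.disjoint_left]
        rintro z (⟨y, hy, rfl⟩ | ⟨y, hy, rfl⟩) ⟨w, hw, hwz⟩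
        · apply hy.1.1.2
          have : y = (w, true) := by
            rw [← flp_flp y, ← hwz]; rfl
          rw [this]; exact hw.2.1
        · simp at hwz
      · rw [Set.disjoint_left]
        rintro z ⟨y, hy, rfl⟩ ⟨w, hw, hwz⟩
        apply hy.1.1.2
        have : y = (w, false) := by
          rw [← flp_flp y, ← hwz]; rfl
        rw [this]; exact hw.2.2
    omega
  refine ⟨Prod.fst '' Bad ∪ X2 ∪ XA, ?_, ?_⟩
  · have h1 := Set.ncard_union_le (Prod.fst '' Bad ∪ X2) XA
    have h2 := Set.ncard_union_le (Prod.fst '' Bad) X2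
    have h3 := Set.ncard_image_le (f := Prod.fst) (Set.toFinite Bad)
    omega
  · -- hitting
    set Y := Prod.fst '' Bad ∪ X2 ∪ XA with hY
    have hbad : ∀ z ∈ Bd, ∀ z' ∈ Bd, z' ≠ z → Reach (dblG G) (S \ X) z z' → z.1 ∈ Y :=
      fun z hz z' hz' hne hr => Or.inl (Or.inl ⟨z, ⟨hz, z', hz', hne, hr⟩, rfl⟩)
    have hABd : ∀ b ∈ A, b ∉ Y → (b, c b) ∈ Bd := by
      intro b hb hbY
      exact ⟨⟨Or.inr rfl, fun h => hbY (Or.inr ⟨hb, h⟩)⟩, Or.inl hb⟩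
    -- type zero vertices
    have T0 : ∀ (v b : V) (p : G.Walk v b), b ∈ A → (∀ w ∈ p.support, w ∉ Y) → v ∉ A →
        (∀ w ∈ p.support, w ∈ A → w = b) →
        (∀ i, (v, i) ∉ X) → ∀ z ∈ Bd, z.1 ∉ p.support → z.1 ∉ Y →
        (∀ i, Reach (dblG G) (S \ X) z (v, i)) → False := by
      intro v b p
      induction p with
      | nil => intro hb _ hv _ _ _ _ _ _; exact fun _ => hv hb
      | @cons v w b h p ih =>
        intro hb hpY hv hpA hvX z hz hzp hzY hr
        simp only [Walk.support_cons, List.mem_cons, forall_eq_or_imp, not_or] at hpY hpA hzp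
        have hwz : w ≠ z.1 := fun h => hzp.2 (h ▸ p.start_mem_support)
        have hwY := hpY.2 w p.start_mem_support
        have hvS : ∀ i, (v, i) ∈ S \ X := fun i => ⟨Or.inl hv, hvX i⟩
        have hrw : ∀ i, (w, i) ∈ S \ X → Reach (dblG G) (S \ X) z (w, i) := fun i hi =>
          (hr i).trans (Reach.single (Or.inl ⟨rfl, h⟩) (hvS i) hi)
        have hnoBd : ∀ i, (w, i) ∉ Bd := by
          intro i hi
          exact hzY (hbad z hz (w, i) hi (fun h => hwz (by rw [← h])) (hrw i hi.1))
        by_cases hwA : w ∈ A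
        · exact hnoBd _ (hABd w hwA hwY)
        · have hX2 : ¬ ((w, true) ∈ X ∧ (w, false) ∈ X) := fun h => hwY (Or.inl (Or.inr ⟨hwA, h⟩))
          have hwX : ∀ i, (w, i) ∉ X := by
            intro i hi
            apply hnoBd (!i)
            refine ⟨⟨Or.inl hwA, ?_⟩, Or.inr (by simpa [flp] using hi)⟩
            intro hi'
            apply hX2
            cases i
            · exact ⟨hi', hi⟩
            · exact ⟨hi, hi'⟩
          exact ih hb hpY.2 hwA hpA.2 hwX z hz hzp.2 hzY
            (fun i => hrw i ⟨Or.inl hwA, hwX i⟩)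
    have T1 : ∀ (v b : V) (p : G.Walk v b), b ∈ A → p.IsPath → (∀ w ∈ p.support, w ∉ Y) →
        (∀ w ∈ p.support.tail, w ∈ A → w = b) → ∀ i, (v, i) ∈ Bd → 
        c b = (i ^^ p.length.bodd) := by
      intro v b p
      induction p with
      | nil =>
        intro hb _ _ _ i hi
        have := hlab _ hi.1.1 hb
        simp only at this
        simp [this]
      | @cons v w b h p ih =>
        intro hb hp hpY hpA i hi
        rw [Walk.cons_isPath_iff] at hp
        simp only [Walk.support_cons, List.mem_cons, forall_eq_or_imp, List.tail_cons] at hpY hpA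
        have hwY := hpY.2 w p.start_mem_support
        have hwv : w ≠ v := fun h => hp.2 (h ▸ p.start_mem_support)
        have hpA' : ∀ w ∈ p.support.tail, w ∈ A → w = b := fun w hw =>
          hpA w (List.mem_of_mem_tail hw)
        have hfin : (w, !i) ∈ Bd → c b = (i ^^ (Walk.cons h p).length.bodd) := by
          intro hw
          rw [ih hb hp.1 hpY.2 hpA' (!i) hw, Walk.length_cons, Nat.bodd_succ]
          cases i <;> cases p.length.bodd <;> rfl
        have hnoBd : (w, i) ∉ Bd := by
          intro hw
          refine hpY.1 (hbad (v, i) hi (w, i) hw (fun h => hwv (congrArg Prod.fst h)) ?_)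
          exact Reach.single (Or.inl ⟨rfl, h⟩) hi.1 hw.1
        by_cases hwA : w ∈ A
        · have h1 := hABd w hwA hwY
          by_cases hci : c w = i
          · rw [hci] at h1; exact absurd h1 hnoBd
          · have : c w = !i := by
              revert hci; cases c w <;> cases i <;> simp
            rw [this] at h1
            exact hfin h1
        · have hX2 : ¬ ((w, true) ∈ X ∧ (w, false) ∈ X) := fun h => hwY (Or.inl (Or.inr ⟨hwA, h⟩))
          by_cases hwi : (w, i) ∈ X
          · apply hfin
            refine ⟨⟨Or.inl hwA, ?_⟩, Or.inr (by simpa [flp] using hwi)⟩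
            intro hi'
            apply hX2
            cases i
            · exact ⟨hi', hwi⟩
            · exact ⟨hwi, hi'⟩
          · exfalso
            have hwi' : (w, !i) ∉ X := fun h => hnoBd ⟨⟨Or.inl hwA, hwi⟩, Or.inr h⟩
            have hwX : ∀ j, (w, j) ∉ X := by
              intro j
              by_cases hj : j = i
              · rw [hj]; exact hwi
              · have : j = !i := by
                  revert hj; cases j <;> cases i <;> simp
                rw [this]; exact hwi'
            have hr : Reach (dblG G) (S \ X) (v, i) (w, i) :=
              Reach.single (Or.inl ⟨rfl, h⟩) hi.1 ⟨Or.inl hwA, hwi⟩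
            refine T0 w b p hb hpY.2 hwA hpA hwX (v, i) hi hp.2 hpY.1 ?_
            intro j
            by_cases hj : j = i
            · rw [hj]; exact hr
            · refine hr.trans (Reach.single (Or.inr ⟨rfl, fun h => hj h.symm⟩) ⟨Or.inl hwA, hwX i⟩
                ⟨Or.inl hwA, hwX j⟩)
    intro P
    by_contra hno
    push Not at hno
    apply P.brk
    refine T1 P.u P.v P.p P.hv P.path hno ?_ (c P.u) (hABd _ P.hu (hno _ P.p.start_mem_support))
    intro w hw hwA
    rcases P.int w (List.mem_of_mem_tail hw) hwA with h | h
    · exfalso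
      have := P.path.support_nodup
      rw [← Walk.cons_tail_support, List.nodup_cons] at this
      exact this.1 (h ▸ hw)
    · exact h

theorem erdosPosa [Finite V] (G : SimpleGraph V) (A : Set V) (c : V → Bool) (k : ℕ) :
    (∃ P : Fin k → BPath G A c, ∀ i j, i ≠ j →
      Disjoint {w | w ∈ (P i).p.support} {w | w ∈ (P j).p.support}) ∨
    ∃ X : Set V, X.ncard ≤ 4 * k ∧ ∀ P : BPath G A c, ∃ w ∈ P.p.support, w ∈ X := by
  classical
  by_cases hA : A.ncard < 2 * k
  · right
    exact ⟨A, by omega, fun P => ⟨P.u, P.p.start_mem_support, P.hu⟩⟩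
  obtain ⟨d, hd⟩ : ∃ d, A.ncard = 2 * k + d := ⟨A.ncard - 2 * k, by omega⟩
  have hS : Even ((dblS A c).ncard + d) := by
    have e1 : dblS A c = {z | z.1 ∉ A} ∪ (fun v => (v, c v)) '' A := by
      ext ⟨v, i⟩
      simp only [dblS, Set.mem_union, Set.mem_ofPred_eq, Set.mem_image, Prod.mk.injEq]
      constructor
      · rintro (h | h)
        · exact Or.inl h
        · by_cases hv : v ∈ A
          · exact Or.inr ⟨v, hv, rfl, h.symm⟩
          · exact Or.inl hv
      · rintro (h | ⟨w, hw, rfl, rfl⟩)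
        · exact Or.inl h
        · exact Or.inr rfl
    have e2 : (dblS A c).ncard = ({z | z.1 ∉ A} : Set (V × Bool)).ncard + A.ncard := by
      rw [e1, Set.ncard_union_eq, Set.ncard_image_of_injective]
      · intro a b h; simp at h; exact h.1
      · rw [Set.disjoint_left]
        rintro _ h ⟨w, hw, rfl⟩
        exact h hw
    have e3 := even_of_flp ({z | z.1 ∉ A} : Set (V × Bool)) (fun z hz => hz)
    rw [e2, hd]
    obtain ⟨t, ht⟩ := e3
    exact ⟨t + k + d, by omega⟩
  rcases tutte_berge (dblG G) (dblS A c) d hS with ⟨f, hf, hf'⟩ | ⟨X, O, h1, h2, h3, h4, h5, h6⟩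
  · exact Or.inl (matching_paths G A c k d hd f hf hf')
  · exact Or.inr (violator_hit G A c k d hd X O h1 h2 h3 h4 h5 h6)

end erdosposa2





section P5
variable {V : Type}

open Classical in
/-- number of edges outside `F` -/
noncomputable def nf (F : Set (Sym2 V)) (L : List (Sym2 V)) : ℕ :=
  L.countP (fun e => decide (e ∉ F))

theorem nf_append (F : Set (Sym2 V)) (L L' : List (Sym2 V)) :
    nf F (L ++ L') = nf F L + nf F L' := by
  unfold nf; exact List.countP_append

theorem nf_reverse (F : Set (Sym2 V)) (L : List (Sym2 V)) : nf F L.reverse = nf F L := by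
  unfold nf; exact List.countP_reverse

theorem nf_zero {F : Set (Sym2 V)} {L : List (Sym2 V)} (h : nf F L = 0) : ∀ e ∈ L, e ∈ F := by
  unfold nf at h
  rw [List.countP_eq_zero] at h
  intro e he
  simpa using h e he

theorem nf_eq_zero {F : Set (Sym2 V)} {L : List (Sym2 V)} (h : ∀ e ∈ L, e ∈ F) : nf F L = 0 := by
  unfold nf
  rw [List.countP_eq_zero]
  intro e he
  simpa using h e he

theorem nf_bypass [DecidableEq V] (F : Set (Sym2 V)) {G : SimpleGraph V} {x y : V}
    (p : G.Walk x y) : nf F p.bypass.edges ≤ nf F p.edges := by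
  have h1 : p.bypass.edges.Nodup := p.bypass_isPath.isTrail.edges_nodup
  have h2 : List.Subperm p.bypass.edges p.edges := List.subperm_of_subset h1 p.edges_bypass_subset_edges
  unfold nf
  exact h2.countP_le _

theorem append_isPath {G : SimpleGraph V} {x a y : V} {q : G.Walk x a} {r : G.Walk a y}
    (hq : q.IsPath) (hr : r.IsPath) (h : ∀ v ∈ q.support, v ∈ r.support → v = a) :
    (q.append r).IsPath := by
  rw [Walk.isPath_def, Walk.support_append, List.nodup_append]
  have hr' := hr.support_nodup
  rw [← Walk.cons_tail_support, List.nodup_cons] at hr'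
  refine ⟨hq.support_nodup, hr'.2, ?_⟩
  rintro v hv w hw rfl
  have := h v hv (by rw [← Walk.cons_tail_support]; exact List.mem_cons_of_mem _ hw)
  subst this
  exact hr'.1 hw

theorem parity_of_bi {G : SimpleGraph V} {c : V → Bool} {x y : V} (p : (biG G c).Walk x y) :
    c y = (c x ^^ p.length.bodd) := by
  induction p with
  | nil => simp
  | cons h p ih =>
    rw [ih, Walk.length_cons, Nat.bodd_succ]
    have := h.2
    revert this
    cases c _ <;> cases c _ <;> cases p.length.bodd <;> simp

/-- reversal -/
@[reducible] def BPath.rev {G : SimpleGraph V} {A : Set V} {c : V → Bool} (P : BPath G A c) :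
    BPath G A c :=
  ⟨P.v, P.u, P.p.reverse, P.path.reverse, P.hv, P.hu, P.ne.symm,
      fun w hw hA => (P.int w (by simpa using hw) hA).symm, by
        have := P.brk
        rw [Walk.length_reverse]
        revert this
        cases c P.u <;> cases c P.v <;> cases P.p.length.bodd <;> simp⟩

/-- reorientation -/
def BPath.ori {G : SimpleGraph V} {A : Set V} {c : V → Bool} (P : BPath G A c) :
    Bool → BPath G A c
  | false => P
  | true => P.rev

theorem BPath.ori_support {G : SimpleGraph V} {A : Set V} {c : V → Bool} (P : BPath G A c)
    (s : Bool) (w : V) : w ∈ (P.ori s).p.support ↔ w ∈ P.p.support := by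
  cases s <;> simp [BPath.ori, BPath.rev]

theorem BPath.ori_u_ne {G : SimpleGraph V} {A : Set V} {c : V → Bool} (P : BPath G A c)
    {s t : Bool} (h : (P.ori s).u = (P.ori t).u) : s = t := by
  have := P.ne
  cases s <;> cases t <;> simp_all [BPath.ori, BPath.rev]

theorem reroute_aux {G : SimpleGraph V} {A : Set V} {c : V → Bool} {F : Set (Sym2 V)} {k : ℕ}
    (P : Fin k → BPath G A c)
    (hd : ∀ i j, i ≠ j → Disjoint {w | w ∈ (P i).p.support} {w | w ∈ (P j).p.support})
    (hmin : ∀ P' : Fin k → BPath G A c,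
      (∀ i j, i ≠ j → Disjoint {w | w ∈ (P' i).p.support} {w | w ∈ (P' j).p.support}) →
      ∑ i, nf F (P i).p.edges ≤ ∑ i, nf F (P' i).p.edges)
    (γ : Fin k) (Q : BPath G A c) (hQ : ∀ w ∈ Q.p.support, (∃ i, w ∈ (P i).p.support ∧ i = γ) ∨
      ∀ i, w ∉ (P i).p.support) : nf F (P γ).p.edges ≤ nf F Q.p.edges := by
  have h := hmin (Function.update P γ Q) ?_
  · rw [← Finset.add_sum_erase _ _ (Finset.mem_univ γ),
      ← Finset.add_sum_erase (a := γ) _ (fun i => nf F (Function.update P γ Q i).p.edges)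
        (Finset.mem_univ γ)] at h
    have : ∑ i ∈ Finset.univ.erase γ, nf F (Function.update P γ Q i).p.edges
        = ∑ i ∈ Finset.univ.erase γ, nf F (P i).p.edges := by
      refine Finset.sum_congr rfl fun i hi => ?_
      rw [Function.update_of_ne (Finset.ne_of_mem_erase hi)]
    rw [this, Function.update_self] at h
    omega
  · have key : ∀ j, j ≠ γ → Disjoint {w | w ∈ Q.p.support} {w | w ∈ (P j).p.support} := by
      intro j hj
      rw [Set.disjoint_left]
      intro w hw hw'
      rcases hQ w hw with ⟨i, hi, rfl⟩ | h
      · exact Set.disjoint_left.1 (hd j i hj) hw' hi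
      · exact h j hw'
    intro i j hij
    by_cases hi : i = γ
    · subst hi
      rw [Function.update_self, Function.update_of_ne (Ne.symm hij)]
      exact key j (Ne.symm hij)
    · by_cases hj : j = γ
      · subst hj
        rw [Function.update_self, Function.update_of_ne hi]
        exact (key i hi).symm
      · rw [Function.update_of_ne hi, Function.update_of_ne hj]
        exact hd i j hij

theorem reroute {G : SimpleGraph V} {A : Set V} {c : V → Bool} {F : Set (Sym2 V)} {k : ℕ}
    (P : Fin k → BPath G A c)
    (hd : ∀ i j, i ≠ j → Disjoint {w | w ∈ (P i).p.support} {w | w ∈ (P j).p.support})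
    (hmin : ∀ P' : Fin k → BPath G A c,
      (∀ i j, i ≠ j → Disjoint {w | w ∈ (P' i).p.support} {w | w ∈ (P' j).p.support}) →
      ∑ i, nf F (P i).p.edges ≤ ∑ i, nf F (P' i).p.edges)
    (γ : Fin k) (x : V) (hx : x ∈ (P γ).p.support) (hxA : x ∉ A) (a' : V) (ha' : a' ∈ A)
    (haP : ∀ i, a' ∉ (P i).p.support) (leg0 : (biG G c).Walk x a')
    (h1 : ∀ v ∈ leg0.support, ∀ i, v ∈ (P i).p.support → v = x)
    (h2 : ∀ v ∈ leg0.support, v ∈ A → v = a') :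
    ∃ (s : Bool) (q : G.Walk ((P γ).ori s).u x) (r : G.Walk x ((P γ).ori s).v),
      ((P γ).ori s).p = q.append r ∧ c x = (c ((P γ).ori s).u ^^ q.length.bodd) ∧
      nf F q.edges ≤ nf F leg0.edges := by
  classical
  have hpar := parity_of_bi leg0.bypass
  obtain ⟨leg, hlp, hls, hlc, hln⟩ : ∃ leg : G.Walk x a', leg.IsPath ∧
      (∀ v ∈ leg.support, v ∈ leg0.support) ∧ c a' = (c x ^^ leg.length.bodd) ∧
      nf F leg.edges ≤ nf F leg0.edges := by
    refine ⟨leg0.bypass.mapLe (biG_le G c), ?_, ?_, ?_, ?_⟩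
    · exact (leg0.bypass_isPath).mapLe _
    · intro v hv
      rw [Walk.support_mapLe_eq_support] at hv
      exact leg0.support_bypass_subset_support hv
    · rw [Walk.length_mapLe]; exact hpar
    · rw [Walk.edges_mapLe_eq_edges]; exact nf_bypass F _
  -- one of the orientations is consistent
  obtain ⟨q, r, hqr⟩ := Walk.mem_support_iff_exists_append.1 hx
  have main : ∀ (Q0 : BPath G A c) (_ : ∀ w, w ∈ Q0.p.support ↔ w ∈ (P γ).p.support)
      (_ : nf F (P γ).p.edges = nf F Q0.p.edges) (q : G.Walk Q0.u x) (r : G.Walk x Q0.v),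
      Q0.p = q.append r → c x ≠ (c Q0.u ^^ q.length.bodd) →
      nf F r.edges ≤ nf F leg.edges := by
    intro Q0 hQ0 e1 q r hqr hc
    have hpath := Q0.path
    rw [hqr] at hpath
    have hsub : ∀ w ∈ q.support, w ∈ (P γ).p.support := by
      intro w hw
      rw [← hQ0, hqr, Walk.mem_support_append_iff]
      exact Or.inl hw
    let Q : BPath G A c :=
      { u := Q0.u
        v := a'
        p := q.append leg
        path := append_isPath hpath.of_append_left hlp fun v hv hv' =>
          h1 v (hls v hv') γ (hsub v hv)
        hu := Q0.hu
        hv := ha'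
        ne := by
          intro h
          exact haP γ (h ▸ hsub _ q.start_mem_support)
        int := by
          intro w hw hA
          rw [Walk.mem_support_append_iff] at hw
          rcases hw with hw | hw
          · have h3 := Q0.int w (by
              rw [hqr, Walk.mem_support_append_iff]; exact Or.inl hw) hA
            rcases h3 with h3 | h3
            · exact Or.inl h3
            · exfalso
              apply hxA
              have : w = x := append_path_inter hpath hw (by rw [h3]; exact r.end_mem_support)
              rw [← this]; exact hA
          · exact Or.inr (h2 w (hls w hw) hA)
        brk := by
          rw [hlc, Walk.length_append, Nat.bodd_add]
          revert hc
          cases c x <;> cases c Q0.u <;> cases q.length.bodd <;>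
            cases leg.length.bodd <;> simp }
    have := reroute_aux (F := F) P hd hmin γ Q (by
      intro w hw
      rw [show Q.p = q.append leg from rfl, Walk.mem_support_append_iff] at hw
      rcases hw with hw | hw
      · exact Or.inl ⟨γ, hsub w hw, rfl⟩
      · by_cases h : ∃ i, w ∈ (P i).p.support
        · obtain ⟨i, hi⟩ := h
          have := h1 w (hls w hw) i hi
          exact Or.inl ⟨γ, this ▸ hx, rfl⟩
        · push Not at h
          exact Or.inr h)
    rw [e1, hqr, show Q.p = q.append leg from rfl, Walk.edges_append, Walk.edges_append,
      nf_append, nf_append] at this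
    omega
  have hb := (P γ).brk
  rw [hqr, Walk.length_append, Nat.bodd_add] at hb
  by_cases hc : c x = (c (P γ).u ^^ q.length.bodd)
  · refine ⟨false, q, r, hqr, hc, le_trans ?_ hln⟩
    have := main (P γ).rev (fun w => by simp) (by simp [nf_reverse]) r.reverse q.reverse (by
      change (P γ).p.reverse = _
      rw [hqr, Walk.reverse_append]) (by
      rw [Walk.length_reverse]
      revert hb hc
      cases c x <;> cases c (P γ).u <;> cases c (P γ).v <;> cases q.length.bodd <;>
            cases r.length.bodd <;> simp)
    rwa [Walk.edges_reverse, nf_reverse] at this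
  · have : ∃ (q : G.Walk (P γ).rev.u x) (r : G.Walk x (P γ).rev.v),
      (P γ).rev.p = q.append r ∧ c x = (c (P γ).rev.u ^^ q.length.bodd) ∧
      nf F q.edges ≤ nf F leg0.edges := by
      refine ⟨r.reverse, q.reverse, ?_, ?_, le_trans ?_ hln⟩
      · change (P γ).p.reverse = _
        rw [hqr, Walk.reverse_append]
      · rw [Walk.length_reverse]
        revert hb hc
        cases c x <;> cases c (P γ).u <;> cases c (P γ).v <;> cases q.length.bodd <;>
            cases r.length.bodd <;> simp
      · have := main (P γ) (fun w => Iff.rfl) rfl q r hqr hc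
        rwa [Walk.edges_reverse, nf_reverse]
    exact ⟨true, this⟩

end P5





section P5b
variable {V : Type}

theorem path_idx [DecidableEq V] {G : SimpleGraph V} {u x v : V} {p : G.Walk u v} (hp : p.IsPath)
    {q : G.Walk u x} {r : G.Walk x v} (h : p = q.append r) : p.support.idxOf x = q.length := by
  subst h
  have hlt : q.length < (q.append r).support.length := by
    rw [Walk.length_support, Walk.length_append]; omega
  have h1 : (q.append r).support[q.length] = x := by
    rw [Walk.support_getElem_eq_getVert, Walk.getVert_append]
    simp
  have h2 := hp.support_nodup.idxOf_getElem q.length hlt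
  rw [h1] at h2
  exact h2

theorem path_idx_getVert [DecidableEq V] {G : SimpleGraph V} {u v : V} {p : G.Walk u v}
    (hp : p.IsPath) {i : ℕ} (hi : i ≤ p.length) : p.support.idxOf (p.getVert i) = i := by
  have hlt : i < p.support.length := by
    rw [Walk.length_support]; omega
  have h2 := hp.support_nodup.idxOf_getElem i hlt
  rw [Walk.support_getElem_eq_getVert] at h2
  exact h2

/-- edges inside the arms -/
def FE {n : ℕ} (B : SimpleGraph V) (a : Fin n → V) (R : Fin n → Fin 3 → Set V) : Set (Sym2 V) :=
  {e | e ∈ B.edgeSet ∧ ∃ i d, ∀ v ∈ e, v ∈ insert (a i) (R i d)}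

theorem fw_stay {G B : SimpleGraph V} {n : ℕ} {a : Fin n → V} {R : Fin n → Fin 3 → Set V}
    {x y : V} (w : G.Walk x y) (h0 : nf (FE B a R) w.edges = 0) (P : Set V)
    (hP : ∀ u v i d, u ∈ insert (a i) (R i d) → v ∈ insert (a i) (R i d) → u ∈ w.support →
      v ∈ w.support → u ∈ P → v ∈ P) (hx : x ∈ P) : y ∈ P := by
  have h := nf_zero h0
  clear h0
  induction w with
  | nil => exact hx
  | @cons u v w hadj p ih =>
    simp only [Walk.edges_cons, List.mem_cons, forall_eq_or_imp] at h
    obtain ⟨⟨_, i, d, hid⟩, h⟩ := h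
    refine ih ?_ ?_ h
    · intro s t i d hs ht hsw htw
      exact hP s t i d hs ht (by simp [hsw]) (by simp [htw])
    · exact hP u v i d (hid u (by simp)) (hid v (by simp)) (by simp) (by simp) hx

theorem st_idx {B : SimpleGraph V} {n : ℕ} {a : Fin n → V} {R : Fin n → Fin 3 → Set V}
    (h : SuperTrees B n a R) {u : V} {i j : Fin n} (hu : u ∈ stSet a R i) (hu' : u ∈ stSet a R j) :
    i = j := by
  rcases hu with rfl | ⟨d, hd⟩ <;> rcases hu' with hu' | ⟨e, he⟩
  · exact h.a_inj hu'
  · exact absurd he (h.a_notin _ _ _)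
  · subst hu'; exact absurd hd (h.a_notin _ _ _)
  · by_contra hne
    exact Set.disjoint_left.1 (h.disjR i d j e (by simp [hne])) hd he

theorem insert_sub_st {n : ℕ} {a : Fin n → V} {R : Fin n → Fin 3 → Set V} {i : Fin n} {d : Fin 3} :
    insert (a i) (R i d) ⊆ stSet a R i := by
  rintro v (rfl | hv)
  · exact Or.inl rfl
  · exact Or.inr ⟨d, hv⟩

theorem stay_st {G B : SimpleGraph V} {n : ℕ} {a : Fin n → V} {R : Fin n → Fin 3 → Set V}
    (h : SuperTrees B n a R) {x y : V} (w : G.Walk x y) (h0 : nf (FE B a R) w.edges = 0) {i : Fin n}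
    (hx : x ∈ stSet a R i) : y ∈ stSet a R i := by
  refine fw_stay w h0 _ ?_ hx
  intro u v j d hu hv _ _ hui
  have := st_idx h hui (insert_sub_st hu)
  subst this
  exact insert_sub_st hv

theorem stay_R {G B : SimpleGraph V} {n : ℕ} {a : Fin n → V} {R : Fin n → Fin 3 → Set V}
    (h : SuperTrees B n a R) {x y : V} (w : G.Walk x y) (h0 : nf (FE B a R) w.edges = 0) {i : Fin n}
    {d : Fin 3} (hA : ∀ v ∈ w.support, v ∉ Set.range a)
    (hx : x ∈ R i d) : y ∈ R i d := by
  refine fw_stay w h0 _ ?_ hx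
  intro u v j e hu hv huw hvw hui
  have hu' : u ∈ R j e := hu.resolve_left fun hh => hA u huw ⟨j, hh.symm⟩
  have hv' : v ∈ R j e := hv.resolve_left fun hh => hA v hvw ⟨j, hh.symm⟩
  by_cases hne : (i, d) = (j, e)
  · cases hne; exact hv'
  · exact absurd hu' (Set.disjoint_left.1 (h.disjR _ _ _ _ hne) hui)

theorem foreign_aux {G B : SimpleGraph V} {c : V → Bool} {n : ℕ} {a : Fin n → V}
    {R : Fin n → Fin 3 → Set V}
    (h : SuperTrees B n a R) (Q : BPath G (Set.range a) c) {i i' : Fin n} {d d' : Fin 3} {x x' : V}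
    (q : G.Walk Q.u x) (r : G.Walk x Q.v) (hqr : Q.p = q.append r) (hx : x ∈ R i d)
    (hu : Q.u ≠ a i) (q' : G.Walk Q.u x') (r' : G.Walk x' Q.v) (hqr' : Q.p = q'.append r')
    (hx' : x' ∈ R i' d') (hn' : nf (FE B a R) q'.edges ≤ 1)
    (hle : q.length ≤ q'.length) : (i, d) = (i', d') := by
  classical
  have hxA : x ∉ Set.range a := by rintro ⟨j, rfl⟩; exact h.a_notin _ _ _ hx
  have hxA' : x' ∉ Set.range a := by rintro ⟨j, rfl⟩; exact h.a_notin _ _ _ hx'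
  have hmem : x ∈ q'.support := by
    have h1 : x ∈ Q.p.support := by rw [hqr, Walk.mem_support_append_iff]; simp
    rw [hqr', Walk.mem_support_append_iff] at h1
    rcases h1 with h1 | h1
    · exact h1
    · obtain ⟨s, t, hst⟩ := Walk.mem_support_iff_exists_append.1 h1
      have h2 := path_idx Q.path hqr
      have h3 := path_idx Q.path (q := q'.append s) (r := t) (by
        rw [hqr', hst, Walk.append_assoc])
      rw [Walk.length_append] at h3
      have : s.length = 0 := by omega
      have := Walk.eq_of_length_eq_zero this
      subst this
      simp
  obtain ⟨q1, s, hs⟩ := Walk.mem_support_iff_exists_append.1 hmem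
  have hp := Q.path
  rw [hqr'] at hp
  have hp' : (q1.append s).IsPath := by rw [← hs]; exact hp.of_append_left
  have h1 : nf (FE B a R) q1.edges ≠ 0 := by
    intro h0
    have h2 := stay_st (G := G) h q1.reverse (by rw [Walk.edges_reverse, nf_reverse, h0])
      (Or.inr ⟨d, hx⟩)
    obtain ⟨j, hj⟩ := Q.hu
    have := st_idx h h2 (Or.inl hj.symm)
    subst this
    exact hu hj.symm
  have h2 : nf (FE B a R) s.edges = 0 := by
    rw [hs, Walk.edges_append, nf_append] at hn'
    omega
  have h3 := stay_R h s h2 (i := i) (d := d) (by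
    intro v hv hvA
    have hv' : v ∈ q'.support := by rw [hs, Walk.mem_support_append_iff]; exact Or.inr hv
    rcases Q.int v (by rw [hqr', Walk.mem_support_append_iff]; exact Or.inl hv') hvA with h4 | h4
    · have : v = x := append_path_inter hp' (by rw [h4]; simp) hv
      exact hxA (this ▸ hvA)
    · have : v = x' := append_path_inter hp hv' (by rw [h4]; simp)
      exact hxA' (this ▸ hvA)) hx
  by_contra hne
  exact Set.disjoint_left.1 (h.disjR _ _ _ _ hne) h3 hx'

open Classical in
/-- colouring of a branch set -/
noncomputable def kap {G : SimpleGraph V} {A : Set V} {c : V → Bool} (Q : BPath G A c)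
    (L1 : Set V) (v : V) : Bool :=
  if v ∈ Q.p.support then (c Q.u ^^ (Q.p.support.idxOf v).bodd) else
    if v ∈ L1 then !(c v) else c v

theorem branch_conn {G : SimpleGraph V} {A : Set V} {c : V → Bool} (Q : BPath G A c)
    {L0 L1 : Set V} {x0 x1 : V} (hL0 : Conn (biG G c) L0) (hL1 : Conn (biG G c) L1)
    (hx0 : x0 ∈ L0) (hx1 : x1 ∈ L1) (h0 : ∀ v ∈ L0, v ∈ Q.p.support → v = x0)
    (h1 : ∀ v ∈ L1, v ∈ Q.p.support → v = x1) (hs0 : x0 ∈ Q.p.support) (hs1 : x1 ∈ Q.p.support)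
    (hd : Disjoint L0 L1) (k0 : kap Q L1 x0 = c x0) (k1 : kap Q L1 x1 = !(c x1)) :
    Conn (biG G (kap Q L1)) (L0 ∪ {v | v ∈ Q.p.support} ∪ L1) := by
  classical
  have e0 : ∀ v ∈ L0, kap Q L1 v = c v := by
    intro v hv
    by_cases hvs : v ∈ Q.p.support
    · rw [h0 v hv hvs, k0]
    · rw [kap, if_neg hvs, if_neg (Set.disjoint_left.1 hd hv)]
  have e1 : ∀ v ∈ L1, kap Q L1 v = !(c v) := by
    intro v hv
    by_cases hvs : v ∈ Q.p.support
    · rw [h1 v hv hvs, k1]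
    · rw [kap, if_neg hvs, if_pos hv]
  have c0 : Conn (biG G (kap Q L1)) L0 := by
    refine ⟨hL0.1, fun x hx y hy => (hL0.2 x hx y hy).mono' ?_⟩
    intro u hu v hv huv
    exact Reach.single ⟨huv.1, by rw [e0 u hu, e0 v hv]; exact huv.2⟩ hu hv
  have c1 : Conn (biG G (kap Q L1)) L1 := by
    refine ⟨hL1.1, fun x hx y hy => (hL1.2 x hx y hy).mono' ?_⟩
    intro u hu v hv huv
    refine Reach.single ⟨huv.1, ?_⟩ hu hv
    rw [e1 u hu, e1 v hv]
    have := huv.2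
    simpa using this
  have cp : Conn (biG G (kap Q L1)) {v | v ∈ Q.p.support} := by
    refine Conn.of_root (r := Q.u) (Walk.start_mem_support _) ?_
    have : ∀ i ≤ Q.p.length, Reach (biG G (kap Q L1)) {v | v ∈ Q.p.support} (Q.p.getVert i) Q.u := by
      intro i
      induction i with
      | zero => intro _; rw [Walk.getVert_zero]; exact Reach.refl _ _ _
      | succ i ih =>
        intro hi
        refine Reach.trans (Reach.single ⟨(Q.p.adj_getVert_succ (by omega)).symm, ?_⟩
          (Q.p.getVert_mem_support _) (Q.p.getVert_mem_support _)) (ih (by omega))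
        rw [kap, if_pos (Q.p.getVert_mem_support _), kap, if_pos (Q.p.getVert_mem_support _),
          path_idx_getVert Q.path hi, path_idx_getVert Q.path (by omega), Nat.bodd_succ]
        cases c Q.u <;> cases i.bodd <;> simp
    intro z hz
    obtain ⟨i, hi, hle⟩ := Walk.mem_support_iff_exists_getVert.1 hz
    rw [← hi]
    exact this i hle
  exact (c0.union_mem cp hx0 hs0).union_mem c1 (Or.inr hs1) hx1

end P5b





section P5c
variable {V : Type}

/-- every vertex of `s` can be joined to the root by a walk of arm edges -/
theorem arm_walk {G : SimpleGraph V} {c : V → Bool} {n : ℕ} {a : Fin n → V}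
    {R : Fin n → Fin 3 → Set V} (h : SuperTrees (biG G c) n a R) {i : Fin n} {d : Fin 3} {x y : V}
    (hx : x ∈ insert (a i) (R i d)) (hy : y ∈ insert (a i) (R i d)) :
    ∃ w : (biG G c).Walk x y, (∀ v ∈ w.support, v ∈ insert (a i) (R i d)) ∧
      nf (FE (biG G c) a R) w.edges = 0 := by
  obtain ⟨w, hw⟩ := ((h.conn i d).2 x hx y hy).exists_walk hx
  refine ⟨w, hw, nf_eq_zero ?_⟩
  intro e he
  refine ⟨w.edges_subset_edgeSet he, i, d, ?_⟩
  intro v hv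
  exact hw v (Walk.mem_support_of_mem_edges he hv)

theorem stSet_conn {B : SimpleGraph V} {n : ℕ} {a : Fin n → V}
    {R : Fin n → Fin 3 → Set V} (h : SuperTrees B n a R) (i : Fin n) : Conn B (stSet a R i) := by
  refine Conn.of_root (r := a i) (Or.inl rfl) ?_
  rintro x (rfl | ⟨d, hd⟩)
  · exact Reach.refl _ _ _
  · exact ((h.conn i d).2 x (Or.inr hd) _ (Or.inl rfl)).mono le_rfl insert_sub_st

theorem exists_min_family {G : SimpleGraph V} {A : Set V} {c : V → Bool} {F : Set (Sym2 V)} {k : ℕ}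
    (P0 : Fin k → BPath G A c)
    (hd0 : ∀ i j, i ≠ j → Disjoint {w | w ∈ (P0 i).p.support} {w | w ∈ (P0 j).p.support}) :
    ∃ P : Fin k → BPath G A c,
      (∀ i j, i ≠ j → Disjoint {w | w ∈ (P i).p.support} {w | w ∈ (P j).p.support}) ∧
      ∀ P' : Fin k → BPath G A c,
      (∀ i j, i ≠ j → Disjoint {w | w ∈ (P' i).p.support} {w | w ∈ (P' j).p.support}) →
      ∑ i, nf F (P i).p.edges ≤ ∑ i, nf F (P' i).p.edges := by
  classical
  have hex : ∃ m : ℕ, ∃ P : Fin k → BPath G A c,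
      (∀ i j, i ≠ j → Disjoint {w | w ∈ (P i).p.support} {w | w ∈ (P j).p.support}) ∧
      ∑ i, nf F (P i).p.edges = m := ⟨_, P0, hd0, rfl⟩
  obtain ⟨P, hP, hm⟩ := Nat.find_spec hex
  refine ⟨P, hP, fun P' hP' => ?_⟩
  rw [hm]
  exact Nat.find_min' hex ⟨P', hP', rfl⟩

/-- walk from `a q` to a point of `stSet q` using arm edges -/
theorem st_walk {G : SimpleGraph V} {c : V → Bool} {n : ℕ} {a : Fin n → V}
    {R : Fin n → Fin 3 → Set V} (h : SuperTrees (biG G c) n a R) {i : Fin n} {y : V}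
    (hy : y ∈ stSet a R i) :
    ∃ w : (biG G c).Walk y (a i), (∀ v ∈ w.support, v ∈ stSet a R i) ∧
      nf (FE (biG G c) a R) w.edges = 0 := by
  rcases hy with rfl | ⟨d, hd⟩
  · exact ⟨Walk.nil, by simp [stSet], by simp [nf]⟩
  · obtain ⟨w, h1, h2⟩ := arm_walk h (i := i) (d := d) (x := y) (y := a i) (Or.inr hd) (Or.inl rfl)
    exact ⟨w, fun v hv => insert_sub_st (h1 v hv), h2⟩

theorem p5 {G : SimpleGraph V} {c : V → Bool} {l n : ℕ} {a : Fin n → V}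
    {R : Fin n → Fin 3 → Set V} (hST : SuperTrees (biG G c) n a R) (hn : 24 * l ≤ n)
    (P0 : Fin (3 * l) → BPath G (Set.range a) c)
    (hd0 : ∀ i j, i ≠ j → Disjoint {w | w ∈ (P0 i).p.support} {w | w ∈ (P0 j).p.support}) :
    OddModel G l := by
  classical
  obtain ⟨P, hd, hmin⟩ := exists_min_family (F := FE (biG G c) a R) P0 hd0
  have hRA : ∀ {x i d}, x ∈ R i d → x ∉ Set.range a := by
    rintro x i d hx ⟨j, rfl⟩; exact hST.a_notin _ _ _ hx
  -- claim 1
  have claim1 : ∀ i, (∀ γ, a i ∉ (P γ).p.support) → ∀ v ∈ stSet a R i, ∀ γ, v ∉ (P γ).p.support := by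
    rintro i hi v (rfl | ⟨d, hv⟩) γ hγ
    · exact hi γ hγ
    · obtain ⟨w, hw1, hw2⟩ := arm_walk hST (i := i) (d := d) (x := a i) (y := v) (Or.inl rfl)
        (Or.inr hv)
      obtain ⟨x, q, r, rfl, ⟨γ', hγ'⟩, hq⟩ := walk_first_hit w {z | ∃ γ, z ∈ (P γ).p.support} ⟨γ, hγ⟩
      have hxi : x ∈ insert (a i) (R i d) := hw1 x (by simp)
      have hxR : x ∈ R i d := hxi.resolve_left fun hh => hi γ' (hh ▸ hγ')
      have hqs : ∀ z ∈ q.support, z ∈ insert (a i) (R i d) := fun z hz =>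
        hw1 z (by rw [Walk.mem_support_append_iff]; exact Or.inl hz)
      obtain ⟨s, q1, r1, e1, e2, e3⟩ := reroute P hd hmin γ' x hγ' (hRA hxR) (a i) ⟨i, rfl⟩ hi
        q.reverse (fun z hz j hj => hq z (by simpa using hz) ⟨j, hj⟩) (by
          intro z hz hzA
          exact (hqs z (by simpa using hz)).resolve_right fun hh => hRA hh hzA)
      rw [Walk.edges_append, nf_append] at hw2
      rw [Walk.edges_reverse, nf_reverse] at e3
      have h2 := stay_st hST q1.reverse (by rw [Walk.edges_reverse, nf_reverse]; omega)
        (Or.inr ⟨d, hxR⟩)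
      obtain ⟨j, hj⟩ := ((P γ').ori s).hu
      have := st_idx hST h2 (Or.inl hj.symm)
      subst this
      apply hi γ'
      rw [← BPath.ori_support _ s, hj]
      exact Walk.start_mem_support _
  -- indices of ends
  have hj : ∀ e : Fin (3 * l) × Bool, ∃ j, a j = ((P e.1).ori e.2).u := fun e =>
    ((P e.1).ori e.2).hu
  choose j hj using hj
  have husup : ∀ e : Fin (3 * l) × Bool, a (j e) ∈ (P e.1).p.support := by
    intro e
    rw [← BPath.ori_support _ e.2, hj]
    exact Walk.start_mem_support _
  have hjinj : Function.Injective j := by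
    intro e e' he
    have h1 : e.1 = e'.1 := by
      by_contra hne
      have := Set.disjoint_left.1 (hd _ _ hne) (husup e)
      rw [he] at this
      exact this (husup e')
    obtain ⟨γ, s⟩ := e
    obtain ⟨γ', s'⟩ := e'
    simp only at h1
    subst h1
    have := hj (γ, s)
    rw [he, hj] at this
    exact Prod.ext rfl (BPath.ori_u_ne _ this).symm
  have hused : ∀ i γ, a i ∈ (P γ).p.support → ∃ e, j e = i := by
    intro i γ hi
    rcases (P γ).int _ hi ⟨i, rfl⟩ with h | h
    · exact ⟨(γ, false), hST.a_inj (by rw [hj]; exact h.symm)⟩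
    · exact ⟨(γ, true), hST.a_inj (by rw [hj]; exact h.symm)⟩
  obtain ⟨q, hqinj, hqf⟩ : ∃ q : (Fin (3 * l) × Bool) × Fin 3 → Fin n, Function.Injective q ∧
      ∀ z γ, a (q z) ∉ (P γ).p.support := by
    have hc : Fintype.card ((Fin (3 * l) × Bool) × Fin 3) ≤
        Fintype.card {i // i ∉ Finset.univ.image j} := by
      rw [Fintype.card_subtype_compl, Fintype.card_coe, Finset.card_image_of_injective _ hjinj]
      simp
      omega
    obtain ⟨f⟩ := Function.Embedding.nonempty_of_card_le hc
    refine ⟨fun z => (f z).1, fun z z' h => f.injective (Subtype.ext h), fun z γ hz => ?_⟩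
    obtain ⟨e, he⟩ := hused _ _ hz
    exact (f z).2 (Finset.mem_image.2 ⟨e, Finset.mem_univ _, he⟩)
  have hqs : ∀ z, ∀ v ∈ stSet a R (q z), ∀ γ, v ∉ (P γ).p.support := fun z =>
    claim1 _ (hqf z)
  have hqj : ∀ z e, q z ≠ j e := by
    intro z e h
    exact hqf z e.1 (h ▸ husup e)
  -- legs
  have legs : ∀ z : (Fin (3 * l) × Bool) × Fin 3, ∃ (x : V) (L : Set V) (ε : Fin (3 * l) × Bool),
      x ∈ insert (a (j z.1)) (R (j z.1) z.2) ∧ x ∈ L ∧ (∀ v ∈ L, ∀ γ, v ∈ (P γ).p.support → v = x) ∧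
      Conn (biG G c) L ∧ stSet a R (q z) ⊆ L ∧
      L ⊆ stSet a R (q z) ∪ insert (a (j z.1)) (R (j z.1) z.2) ∧
      (ε ≠ z.1 → x ∈ R (j z.1) z.2) ∧
      ∃ (w : G.Walk ((P ε.1).ori ε.2).u x) (r : G.Walk x ((P ε.1).ori ε.2).v),
        ((P ε.1).ori ε.2).p = w.append r ∧ c x = (c ((P ε.1).ori ε.2).u ^^ w.length.bodd) ∧
        nf (FE (biG G c) a R) w.edges ≤ 1 := by
    rintro ⟨e, d⟩
    obtain ⟨x0, hx0, y0, hy0, hxy⟩ := hST.adj (j e) (q (e, d)) d (hqj _ _).symm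
    obtain ⟨w1, hw1, hw1'⟩ := st_walk hST hy0
    obtain ⟨w2, hw2, hw2'⟩ := arm_walk hST (i := j e) (d := d) (x := x0) (y := a (j e)) (Or.inr hx0)
      (Or.inl rfl)
    obtain ⟨x, s, r, rfl, ⟨γ', hγ'⟩, hs⟩ := walk_first_hit w2 {z | ∃ γ, z ∈ (P γ).p.support}
      ⟨e.1, husup e⟩
    have hss : ∀ z ∈ s.support, z ∈ insert (a (j e)) (R (j e) d) := fun z hz =>
        hw2 z (by rw [Walk.mem_support_append_iff]; exact Or.inl hz)
    have hxi := hss x (Walk.end_mem_support _)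
    have hsc : Conn (biG G c) {v | v ∈ s.support} := Conn.of_walk s
    let L : Set V := stSet a R (q (e, d)) ∪ {v | v ∈ s.support}
    have hLconn : Conn (biG G c) L :=
      (stSet_conn hST _).union_adj hsc hy0 s.start_mem_support hxy.symm
    have hLP : ∀ v ∈ L, ∀ γ, v ∈ (P γ).p.support → v = x := by
      rintro v (hv | hv) γ hγ
      · exact absurd hγ (hqs _ v hv γ)
      · exact hs v hv ⟨γ, hγ⟩
    have hLsub : L ⊆ stSet a R (q (e, d)) ∪ insert (a (j e)) (R (j e) d) :=
      Set.union_subset_union_right _ hss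
    by_cases hxa : x = a (j e)
    · refine ⟨x, L, e, hxi, Or.inr s.end_mem_support, hLP, hLconn, Set.subset_union_left, hLsub,
        fun h => absurd rfl h, ?_⟩
      have : x = ((P e.1).ori e.2).u := by rw [hxa, hj]
      rw [this]
      exact ⟨Walk.nil, _, rfl, by simp, by simp [nf]⟩
    · have hxR : x ∈ R (j e) d := hxi.resolve_left hxa
      obtain ⟨s', q1, r1, e1, e2, e3⟩ := reroute P hd hmin γ' x hγ' (hRA hxR) (a (q (e, d)))
        ⟨_, rfl⟩ (hqf _) (s.reverse.append (Walk.cons hxy w1)) (by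
          intro z hz γ hγ
          rw [Walk.mem_support_append_iff, Walk.support_cons, List.mem_cons] at hz
          rcases hz with hz | rfl | hz
          · exact hs z (by simpa using hz) ⟨γ, hγ⟩
          · exact hs z s.start_mem_support ⟨γ, hγ⟩
          · exact absurd hγ (hqs _ z (hw1 z hz) γ)) (by
          intro z hz hzA
          rw [Walk.mem_support_append_iff, Walk.support_cons, List.mem_cons] at hz
          have key : ∀ z ∈ s.support, z ∉ Set.range a := by
            intro z hz hzA
            rcases hss z hz with hza | hzR
            · apply hxa
              rw [← hza]
              exact (hs z hz ⟨e.1, hza ▸ husup e⟩).symm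
            · exact hRA hzR hzA
          rcases hz with hz | rfl | hz
          · exact absurd hzA (key z (by simpa using hz))
          · exact absurd hzA (key z s.start_mem_support)
          · rcases hw1 z hz with h | ⟨d', h⟩
            · exact h
            · exact absurd hzA (hRA h))
      refine ⟨x, L, (γ', s'), hxi, Or.inr s.end_mem_support, hLP, hLconn, Set.subset_union_left,
        hLsub, fun _ => hxR, q1, r1, e1, e2, le_trans e3 ?_⟩
      rw [Walk.edges_append, nf_append, Walk.edges_reverse, nf_reverse, Walk.edges_cons,
        ← List.singleton_append, nf_append, hw1']
      rw [Walk.edges_append, nf_append] at hw2'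
      have : nf (FE (biG G c) a R) [s(x0, y0)] ≤ 1 := by
        unfold nf; exact List.countP_le_length
      omega
  choose x L ε hxi hxL hLP hLconn hLq hLsub hxR hdec using legs
  -- foreign pairs
  have hfor : ∀ z z', ε z ≠ z.1 → ε z' ≠ z'.1 → ε z = ε z' → z = z' := by
    intro z z' hz hz' heq
    obtain ⟨w, r, h1, h2, h3⟩ := hdec z
    obtain ⟨w', r', h1', h2', h3'⟩ := heq ▸ hdec z'
    have hu : ((P (ε z).1).ori (ε z).2).u ≠ a (j z.1) := by
      rw [← hj]; intro h; exact hz (hjinj (hST.a_inj h))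
    have hu' : ((P (ε z).1).ori (ε z).2).u ≠ a (j z'.1) := by
      rw [← hj]; intro h; exact hz' (heq ▸ (hjinj (hST.a_inj h)))
    have : (j z.1, z.2) = (j z'.1, z'.2) := by
      rcases le_total w.length w'.length with hle | hle
      · exact foreign_aux hST _ w r h1 (hxR z hz) hu w' r' h1' (hxR z' hz') h3' hle
      · exact (foreign_aux hST _ w' r' h1' (hxR z' hz') hu' w r h1 (hxR z hz) h3 hle).symm
    rw [Prod.mk.injEq] at this
    exact Prod.ext (hjinj this.1) this.2
  -- counting
  obtain ⟨g, hginj, hg⟩ : ∃ g : Fin l → Fin (3 * l), Function.Injective g ∧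
      ∀ i s, ∃ d, ε ((g i, s), d) = (g i, s) := by
    let Bad : Finset (Fin (3 * l) × Bool) := Finset.univ.filter fun e => ∀ d, ε (e, d) ≠ e
    let Fo : Finset ((Fin (3 * l) × Bool) × Fin 3) := Finset.univ.filter fun z => ε z ≠ z.1
    have h1 : Fo.card ≤ 6 * l := by
      have : (Fo.image ε).card = Fo.card := Finset.card_image_of_injOn (by
        intro z hz z' hz' h
        simp only [Fo, Finset.coe_filter, Finset.mem_univ, true_and, Set.mem_ofPred_eq] at hz hz'
        exact hfor z z' hz hz' h)
      rw [← this]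
      refine le_trans (Finset.card_le_univ _) ?_
      simp; omega
    have h2 : Bad.card * 3 ≤ Fo.card := by
      have : (Bad ×ˢ (Finset.univ : Finset (Fin 3))).card = Bad.card * 3 := by simp
      rw [← this]
      refine Finset.card_le_card ?_
      rintro ⟨e, d⟩ hz
      simp only [Finset.mem_product, Bad, Finset.mem_filter, Finset.mem_univ, true_and, and_true,
        Fo] at hz ⊢
      exact hz d
    have h3 : (Bad.image Prod.fst).card ≤ Bad.card := Finset.card_image_le
    have hc : Fintype.card (Fin l) ≤ Fintype.card {i // i ∉ Bad.image Prod.fst} := by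
      rw [Fintype.card_subtype_compl, Fintype.card_coe]
      simp only [Fintype.card_fin]
      omega
    obtain ⟨f⟩ := Function.Embedding.nonempty_of_card_le hc
    refine ⟨fun z => (f z).1, fun z z' h => f.injective (Subtype.ext h), fun i s => ?_⟩
    by_contra hne
    push Not at hne
    apply (f i).2
    rw [Finset.mem_image]
    exact ⟨((f i).1, s), by simpa [Bad] using hne, rfl⟩
  choose dd hdd using hg
  let z : Fin l → Bool → (Fin (3 * l) × Bool) × Fin 3 := fun i s => ((g i, s), dd i s)
  have hLdisj : ∀ i s i' s', (i, s) ≠ (i', s') → Disjoint (L (z i s)) (L (z i' s')) := by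
    intro i s i' s' hne
    have hz : (z i s).1 ≠ (z i' s').1 := by
      intro h
      simp only [z, Prod.mk.injEq] at h
      exact hne (Prod.ext (hginj h.1) h.2)
    rw [Set.disjoint_left]
    intro v hv hv'
    rcases hLsub _ hv with h1 | h1 <;> rcases hLsub _ hv' with h2 | h2
    · have := hqinj (st_idx hST h1 h2)
      exact hz (congrArg Prod.fst this)
    · exact hqj _ _ (st_idx hST h1 (insert_sub_st h2))
    · exact hqj _ _ (st_idx hST h2 (insert_sub_st h1))
    · exact hz (hjinj (st_idx hST (insert_sub_st h1) (insert_sub_st h2)))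
  have hdec' : ∀ i s, ∃ (w : G.Walk ((P (g i)).ori s).u (x (z i s)))
      (r : G.Walk (x (z i s)) ((P (g i)).ori s).v),
        ((P (g i)).ori s).p = w.append r ∧
          c (x (z i s)) = (c ((P (g i)).ori s).u ^^ w.length.bodd) := by
    intro i s
    have := hdec (z i s)
    rw [show ε (z i s) = (g i, s) from hdd i s] at this
    obtain ⟨w, r, h1, h2, _⟩ := this
    exact ⟨w, r, h1, h2⟩
  have hxs : ∀ i s, x (z i s) ∈ (P (g i)).p.support := by
    intro i s
    obtain ⟨w, r, h1, _⟩ := hdec' i s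
    rw [← BPath.ori_support _ s, h1, Walk.mem_support_append_iff]
    simp
  refine oddModel_of_index
    (fun i => L (z i false) ∪ {v | v ∈ (P (g i)).p.support} ∪ L (z i true))
    (fun i => kap (P (g i)) (L (z i true))) ?_ ?_ ?_
  · intro i
    refine branch_conn (P (g i)) (hLconn _) (hLconn _) (hxL _) (hxL _)
      (fun v hv hvs => hLP _ v hv _ hvs) (fun v hv hvs => hLP _ v hv _ hvs) (hxs i _) (hxs i _)
      (hLdisj _ _ _ _ (by simp)) ?_ ?_
    · obtain ⟨w, r, h1, h2⟩ := hdec' i false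
      rw [kap, if_pos (hxs i _), h2]
      congr 2
      exact path_idx (P (g i)).path h1
    · have hT : ∃ (w : G.Walk (P (g i)).v (x (z i true))) (r : G.Walk (x (z i true)) (P (g i)).u),
        (P (g i)).p.reverse = w.append r ∧
          c (x (z i true)) = (c (P (g i)).v ^^ w.length.bodd) := hdec' i true
      obtain ⟨w, r, h1, h2⟩ := hT
      have h1' := congrArg Walk.reverse h1
      rw [Walk.reverse_reverse, Walk.reverse_append] at h1'
      have hb := (P (g i)).brk
      have hlen := congrArg Walk.length h1
      rw [Walk.length_reverse, Walk.length_append] at hlen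
      rw [hlen, Nat.bodd_add] at hb
      have hidx := path_idx (P (g i)).path h1'
      rw [Walk.length_reverse] at hidx
      rw [kap, if_pos (hxs i _), h2, hidx]
      revert hb
      cases c (P (g i)).u <;> cases c (P (g i)).v <;> cases w.length.bodd <;>
            cases r.length.bodd <;> simp
  · intro i i' hne
    have hgne : g i ≠ g i' := fun h => hne (hginj h)
    rw [Set.disjoint_left]
    have key : ∀ i i' s v, i ≠ i' → v ∈ L (z i s) → v ∉ (P (g i')).p.support := by
      intro i i' s v hne hv hvs
      have := hLP _ v hv _ hvs
      subst this
      exact Set.disjoint_left.1 (hd _ _ fun h => hne (hginj h)) (hxs i s) hvs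
    have key2 : ∀ s s' v, v ∈ L (z i s) → v ∉ L (z i' s') := fun s s' v hv =>
      Set.disjoint_left.1 (hLdisj i s i' s' (by simp [hne])) hv
    rintro v ((hv | hv) | hv) ((hv' | hv') | hv')
    · exact key2 _ _ v hv hv'
    · exact key _ _ _ v hne hv hv'
    · exact key2 _ _ v hv hv'
    · exact key _ _ _ v hne.symm hv' hv
    · exact Set.disjoint_left.1 (hd _ _ hgne) hv hv'
    · exact key _ _ _ v hne.symm hv' hv
    · exact key2 _ _ v hv hv'
    · exact key _ _ _ v hne hv hv'
    · exact key2 _ _ v hv hv'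
  · intro i i' hne
    obtain ⟨u, hu, v, hv, huv⟩ := hST.adj (q (z i false)) (q (z i' true)) 0 (by
      intro h
      have := hqinj h
      simp [z] at this)
    have hu' : u ∈ stSet a R (q (z i false)) := Or.inr ⟨0, hu⟩
    refine ⟨u, Or.inl (Or.inl (hLq _ hu')), v, Or.inr (hLq _ hv), huv.1, ?_⟩
    rw [kap, if_neg (hqs _ u hu' _), if_neg, kap, if_neg (hqs _ v hv _), if_pos (hLq _ hv)]
    · have := huv.2
      revert this
      cases c u <;> cases c v <;> simp
    · exact Set.disjoint_left.1 (hLdisj i false i true (by simp)) (hLq _ hu')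

end P5c





section P6
variable {V : Type}

/-- paths between `A`-vertices avoiding a hitting set are consistent -/
theorem path_consistent {G : SimpleGraph V} {A X : Set V} {c : V → Bool}
    (hX : ∀ P : BPath G A c, ∃ w ∈ P.p.support, w ∈ X) :
    ∀ (n : ℕ) (a b : V) (p : G.Walk a b), p.length ≤ n → p.IsPath → a ∈ A → b ∈ A →
      (∀ v ∈ p.support, v ∉ X) → c b = (c a ^^ p.length.bodd) := by
  intro n
  induction n with
  | zero =>
    intro a b p hn hp ha hb hpX
    have h0 : p.length = 0 := by omega
    have := Walk.eq_of_length_eq_zero h0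
    subst this
    simp [h0]
  | succ n ih =>
    intro a b p hn hp ha hb hpX
    by_cases hab : a = b
    · subst hab
      have : p = Walk.nil := by
        rw [Walk.isPath_iff_eq_nil] at hp
        exact hp
      subst this
      simp
    by_cases h_inner : ∀ w ∈ p.support, w ∈ A → w = a ∨ w = b
    · by_contra hc
      obtain ⟨w, hw, hwX⟩ := hX ⟨a, b, p, hp, ha, hb, hab, h_inner, hc⟩
      exact hpX w hw hwX
    · push Not at h_inner
      obtain ⟨w, hw, hwA, hwa, hwb⟩ := h_inner
      obtain ⟨q, r, rfl⟩ := Walk.mem_support_iff_exists_append.1 hw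
      have hq : q.length ≠ 0 := fun h => hwa (Walk.eq_of_length_eq_zero h).symm
      have hr : r.length ≠ 0 := fun h => hwb (Walk.eq_of_length_eq_zero h)
      rw [Walk.length_append] at hn
      have h1 := ih _ _ q (by omega) hp.of_append_left ha hwA
        (fun v hv => hpX v (by rw [Walk.mem_support_append_iff]; exact Or.inl hv))
      have h2 := ih _ _ r (by omega) hp.of_append_right hwA hb
        (fun v hv => hpX v (by rw [Walk.mem_support_append_iff]; exact Or.inr hv))
      rw [h2, h1, Walk.length_append, Nat.bodd_add]
      simp

/-- two linked vertices -/
def Lnk (G : SimpleGraph V) (A : Set V) (c : V → Bool) (U : Set V) (κ : V → Bool) (x y : V) : Prop :=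
  ∃ (a b : V) (p : G.Walk x a) (q : G.Walk y b), p.IsPath ∧ q.IsPath ∧ a ∈ A ∧ b ∈ A ∧
    (∀ v ∈ p.support, v ∈ U) ∧ (∀ v ∈ q.support, v ∈ U) ∧ (∀ v ∈ p.support, v ∉ q.support) ∧
    c a = (κ x ^^ p.length.bodd) ∧ c b = (κ y ^^ q.length.bodd)

theorem Lnk.symm {G : SimpleGraph V} {A : Set V} {c : V → Bool} {U : Set V} {κ : V → Bool} {x y : V}
    (h : Lnk G A c U κ x y) : Lnk G A c U κ y x := by
  obtain ⟨a, b, p, q, h1, h2, h3, h4, h5, h6, h7, h8, h9⟩ := h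
  exact ⟨b, a, q, p, h2, h1, h4, h3, h6, h5, fun v hv hv' => h7 v hv' hv, h9, h8⟩

theorem Lnk.extend {G : SimpleGraph V} {A : Set V} {c : V → Bool} {U U' : Set V} {κ κ' : V → Bool}
    {x y z w : V} (h : Lnk G A c U κ x y) (hUU : U ⊆ U') (s : G.Walk z x) (t : G.Walk w y)
    (hs : s.IsPath) (ht : t.IsPath) (hsU : ∀ v ∈ s.support, v ∈ U → v = x)
    (htU : ∀ v ∈ t.support, v ∈ U → v = y) (hst : ∀ v ∈ s.support, v ∉ t.support)
    (hsU' : ∀ v ∈ s.support, v ∈ U') (htU' : ∀ v ∈ t.support, v ∈ U')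
    (hks : κ x = (κ' z ^^ s.length.bodd)) (hkt : κ y = (κ' w ^^ t.length.bodd)) :
    Lnk G A c U' κ' z w := by
  obtain ⟨a, b, p, q, h1, h2, h3, h4, h5, h6, h7, h8, h9⟩ := h
  refine ⟨a, b, s.append p, t.append q, append_isPath hs h1 fun v hv hv' => hsU v hv (h5 v hv'),
    append_isPath ht h2 fun v hv hv' => htU v hv (h6 v hv'), h3, h4, ?_, ?_, ?_, ?_, ?_⟩
  · intro v hv
    rw [Walk.mem_support_append_iff] at hv
    exact hv.elim (hsU' v) fun h => hUU (h5 v h)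
  · intro v hv
    rw [Walk.mem_support_append_iff] at hv
    exact hv.elim (htU' v) fun h => hUU (h6 v h)
  · intro v hv hv'
    rw [Walk.mem_support_append_iff] at hv hv'
    rcases hv with hv | hv <;> rcases hv' with hv' | hv'
    · exact hst v hv hv'
    · have := hsU v hv (h6 v hv')
      subst this
      exact h7 v p.start_mem_support hv'
    · have := htU v hv' (h5 v hv)
      subst this
      exact h7 v hv q.start_mem_support
    · exact h7 v hv hv'
  · rw [h8, hks, Walk.length_append, Nat.bodd_add, Bool.xor_assoc]
  · rw [h9, hkt, Walk.length_append, Nat.bodd_add, Bool.xor_assoc]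

theorem ear_consistent {G : SimpleGraph V} {A X : Set V} {c : V → Bool}
    (hX : ∀ P : BPath G A c, ∃ w ∈ P.p.support, w ∈ X) {U : Set V} {κ : V → Bool} {x y : V}
    (hUX : ∀ v ∈ U, v ∉ X) (h : Lnk G A c U κ x y) (e : G.Walk x y) (he : e.IsPath)
    (heU : ∀ v ∈ e.support, v ∈ U → v = x ∨ v = y) (heX : ∀ v ∈ e.support, v ∉ X) :
    κ y = (κ x ^^ e.length.bodd) := by
  obtain ⟨a, b, p, q, h1, h2, h3, h4, h5, h6, h7, h8, h9⟩ := h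
  have hpe : (p.reverse.append e).IsPath := by
    refine append_isPath h1.reverse he fun v hv hv' => ?_
    rcases heU v hv' (h5 v (by simpa using hv)) with h | h
    · exact h
    · subst h
      exact absurd q.start_mem_support (h7 v (by simpa using hv))
  have hpq : ((p.reverse.append e).append q).IsPath := by
    refine append_isPath hpe h2 fun v hv hv' => ?_
    rw [Walk.mem_support_append_iff] at hv
    rcases hv with hv | hv
    · exact absurd hv' (h7 v (by simpa using hv))
    · rcases heU v hv (h6 v hv') with h | h
      · subst h
        exact absurd hv' (h7 v p.start_mem_support)
      · exact h
  have := path_consistent hX _ _ _ _ le_rfl hpq h3 h4 (by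
    intro v hv
    rw [Walk.mem_support_append_iff, Walk.mem_support_append_iff] at hv
    rcases hv with (hv | hv) | hv
    · exact hUX v (h5 v (by simpa using hv))
    · exact heX v hv
    · exact hUX v (h6 v hv))
  rw [h8, h9, Walk.length_append, Walk.length_append, Walk.length_reverse, Nat.bodd_add,
    Nat.bodd_add] at this
  revert this
  cases κ x <;> cases κ y <;> cases p.length.bodd <;> cases q.length.bodd <;>
    cases e.length.bodd <;> simp

open Classical in
/-- adding an ear -/
theorem ear_add {G : SimpleGraph V} {A X : Set V} {c : V → Bool}
    (hX : ∀ P : BPath G A c, ∃ w ∈ P.p.support, w ∈ X) {U : Set V} {κ : V → Bool} {x y : V}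
    (hUX : ∀ v ∈ U, v ∉ X) (hL : ∀ x ∈ U, ∀ y ∈ U, x ≠ y → Lnk G A c U κ x y)
    (hx : x ∈ U) (hy : y ∈ U) (hxy : x ≠ y)
    (e : G.Walk x y) (he : e.IsPath)
    (heU : ∀ v ∈ e.support, v ∈ U → v = x ∨ v = y) (heX : ∀ v ∈ e.support, v ∉ X) :
    ∃ κ' : V → Bool, ∀ z ∈ U ∪ {v | v ∈ e.support}, ∀ w ∈ U ∪ {v | v ∈ e.support}, z ≠ w →
      Lnk G A c (U ∪ {v | v ∈ e.support}) κ' z w := by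
  have hcon := ear_consistent hX hUX (hL x hx y hy hxy) e he heU heX
  let κ' : V → Bool := fun v => if v ∈ U then κ v else (κ x ^^ (e.support.idxOf v).bodd)
  refine ⟨κ', ?_⟩
  have hkU : ∀ v ∈ U, κ' v = κ v := fun v hv => if_pos hv
  set U' := U ∪ {v | v ∈ e.support} with hU'
  have hUU : U ⊆ U' := Set.subset_union_left
  -- segments
  have seg : ∀ z ∈ e.support, z ∉ U → ∃ (s : G.Walk z x) (t : G.Walk z y), s.IsPath ∧ t.IsPath ∧
      e = s.reverse.append t ∧
      (∀ v ∈ s.support, v ∈ U → v = x) ∧ (∀ v ∈ t.support, v ∈ U → v = y) ∧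
      (∀ v ∈ s.support, v ∈ e.support) ∧ (∀ v ∈ t.support, v ∈ e.support) ∧
      κ x = (κ' z ^^ s.length.bodd) ∧ κ y = (κ' z ^^ t.length.bodd) := by
    intro z hz hzU
    obtain ⟨q, r, hqr⟩ := Walk.mem_support_iff_exists_append.1 hz
    have hp : (q.append r).IsPath := hqr ▸ he
    have s1 : ∀ v ∈ q.support, v ∈ e.support := fun v hv => by
      rw [hqr, Walk.mem_support_append_iff]; exact Or.inl hv
    have s2 : ∀ v ∈ r.support, v ∈ e.support := fun v hv => by
      rw [hqr, Walk.mem_support_append_iff]; exact Or.inr hv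
    have hk : κ' z = (κ x ^^ q.length.bodd) := by
      simp only [κ']
      rw [if_neg hzU, path_idx he hqr]
    refine ⟨q.reverse, r, hp.of_append_left.reverse, hp.of_append_right, by simpa using hqr, ?_, ?_,
      fun v hv => s1 v (by simpa using hv), s2, ?_, ?_⟩
    · intro v hv hvU
      have hv : v ∈ q.support := by simpa using hv
      rcases heU v (s1 v hv) hvU with h | h
      · exact h
      · have : v = z := append_path_inter hp hv (by rw [h]; simp)
        exact absurd (this ▸ hvU) hzU
    · intro v hv hvU
      rcases heU v (s2 v hv) hvU with h | h
      · have : v = z := append_path_inter hp (by rw [h]; simp) hv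
        exact absurd (this ▸ hvU) hzU
      · exact h
    · rw [hk, Walk.length_reverse]; simp
    · rw [hk, hcon, hqr, Walk.length_append, Nat.bodd_add]; simp
  -- one outside
  have one : ∀ z ∈ e.support, z ∉ U → ∀ w ∈ U, Lnk G A c U' κ' z w := by
    intro z hz hzU w hw
    obtain ⟨s, t, h1, h2, h3, h4, h5, h6, h7, h8, h9⟩ := seg z hz hzU
    by_cases hwx : w = x
    · subst hwx
      refine (hL y hy w hw hxy.symm).extend hUU t Walk.nil h2 (by simp) h5 (by simp) ?_
        (fun v hv => Or.inr (h7 v hv)) (by intro v hv; rw [show v = w by simpa using hv]; exact Or.inl hw) h9 (by simp [hkU w hw])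
      intro v hv hv'
      have : v = w := by simpa using hv'
      subst this
      exact hxy (h5 v hv hw)
    · refine (hL x hx w hw (Ne.symm hwx)).extend hUU s Walk.nil h1 (by simp) h4 (by simp) ?_
        (fun v hv => Or.inr (h6 v hv)) (by intro v hv; rw [show v = w by simpa using hv]; exact Or.inl hw) h8 (by simp [hkU w hw])
      intro v hv hv'
      have : v = w := by simpa using hv'
      subst this
      exact hwx (h4 v hv hw)
  -- both outside, ordered
  have both : ∀ z ∈ e.support, z ∉ U → ∀ w ∈ e.support, w ∉ U → z ≠ w →
      e.support.idxOf z ≤ e.support.idxOf w → Lnk G A c U' κ' z w := by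
    intro z hz hzU w hw hwU hne hle
    obtain ⟨s, t, h1, h2, h3, h4, h5, h6, h7, h8, h9⟩ := seg z hz hzU
    obtain ⟨s', t', h1', h2', h3', h4', h5', h6', h7', h8', h9'⟩ := seg w hw hwU
    refine (hL x hx y hy hxy).extend hUU s t' h1 h2' h4 h5' ?_
        (fun v hv => Or.inr (h6 v hv)) (fun v hv => Or.inr (h7' v hv)) h8 h9'
    intro v hv hv'
    obtain ⟨m1, m2, hm⟩ := Walk.mem_support_iff_exists_append.1
      (show v ∈ s.reverse.support by simpa using hv)
    obtain ⟨n1, n2, hn⟩ := Walk.mem_support_iff_exists_append.1 hv'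
    have i1 := path_idx he (q := m1) (r := m2.append t) (by
      rw [Walk.append_assoc, ← hm, ← h3])
    have i2 := path_idx he (q := s'.reverse.append n1) (r := n2) (by
      rw [← Walk.append_assoc, ← hn, ← h3'])
    have i3 := path_idx he h3
    have i4 := path_idx he h3'
    rw [hm, Walk.length_append] at i3
    rw [Walk.length_append] at i2
    have z1 : m2.length = 0 := by omega
    have z2 : n1.length = 0 := by omega
    exact hne ((Walk.eq_of_length_eq_zero z1).symm.trans (Walk.eq_of_length_eq_zero z2).symm)
  intro z hz w hw hne
  by_cases hzU : z ∈ U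
  · by_cases hwU : w ∈ U
    · exact (hL z hzU w hwU hne).extend hUU Walk.nil Walk.nil (by simp) (by simp) (by simp) (by simp)
        (by simpa using hne) (by simpa using hz) (by simpa using hw) (by simp [hkU z hzU])
        (by simp [hkU w hwU])
    · exact (one w (hw.resolve_left hwU) hwU z hzU).symm
  · have hz := hz.resolve_left hzU
    by_cases hwU : w ∈ U
    · exact one z hz hzU w hwU
    · have hw := hw.resolve_left hwU
      rcases le_total (e.support.idxOf z) (e.support.idxOf w) with h | h
      · exact both z hz hzU w hw hwU hne h
      · exact (both w hw hwU z hz hzU hne.symm h).symm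

theorem p6 [Finite V] {G : SimpleGraph V} {A X : Set V} {c : V → Bool}
    (hX : ∀ P : BPath G A c, ∃ w ∈ P.p.support, w ∈ X) :
    ∃ (U : Set V) (κ : V → Bool), A \ X ⊆ U ∧ (∀ v ∈ U, v ∉ X) ∧
      (∀ x ∈ U, ∀ y ∈ U, G.Adj x y → κ x ≠ κ y) ∧
      ∀ u ∈ U, ∀ u' ∈ U, ∀ x x', G.Adj u x → G.Adj u' x' → x ∉ X ∪ U →
        Reach G (X ∪ U)ᶜ x x' → u = u' := by
  classical
  let F : Set (Set V) := {U | A \ X ⊆ U ∧ (∀ v ∈ U, v ∉ X) ∧ ∃ κ : V → Bool,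
    ∀ x ∈ U, ∀ y ∈ U, x ≠ y → Lnk G A c U κ x y}
  have hne : F.Nonempty := by
    refine ⟨A \ X, subset_rfl, fun v hv => hv.2, c, ?_⟩
    intro x hx y hy hxy
    exact ⟨x, y, Walk.nil, Walk.nil, by simp, by simp, hx.1, hy.1, by simpa using hx,
      by simpa using hy, by simpa using hxy, by simp, by simp⟩
  obtain ⟨U, hU⟩ := (Set.toFinite F).exists_maximal hne
  obtain ⟨hAU, hUX, κ, hL⟩ := hU.1
  refine ⟨U, κ, hAU, hUX, ?_, ?_⟩
  · intro x hx y hy hxy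
    have := ear_consistent hX hUX (hL x hx y hy hxy.ne) (Walk.cons hxy Walk.nil)
      (by simp [Walk.cons_isPath_iff, hxy.ne]) (by simp) (by
        intro v hv
        simp only [Walk.support_cons, Walk.support_nil, List.mem_cons, List.not_mem_nil, or_false]
          at hv
        rcases hv with rfl | rfl
        · exact hUX _ hx
        · exact hUX _ hy)
    rw [this]
    cases κ x <;> simp
  · intro u hu u' hu' x x' hux hux' hx hr
    by_contra hne
    obtain ⟨p, hp, hps⟩ := hr.exists_path hx
    have hpU : ∀ v ∈ p.support, v ∉ U := fun v hv h => hps v hv (Or.inr h)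
    have hpX : ∀ v ∈ p.support, v ∉ X := fun v hv h => hps v hv (Or.inl h)
    let e : G.Walk u u' := Walk.cons hux (p.concat hux'.symm)
    have hsup : ∀ v, v ∈ e.support ↔ v = u ∨ v ∈ p.support ∨ v = u' := by
      intro v
      simp [e, Walk.support_concat]
    have he : e.IsPath := by
      rw [Walk.cons_isPath_iff]
      constructor
      · rw [Walk.concat_isPath_iff]
        exact ⟨hp, fun h => hpU u' h hu'⟩
      · intro h
        rw [Walk.support_concat] at h
        simp only [List.mem_append, List.mem_singleton] at h
        rcases h with h | h
        · exact hpU u h hu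
        · exact hne h
    have heX : ∀ v ∈ e.support, v ∉ X := by
      intro v hv
      rcases (hsup v).1 hv with rfl | h | rfl
      · exact hUX _ hu
      · exact hpX v h
      · exact hUX _ hu'
    have heU : ∀ v ∈ e.support, v ∈ U → v = u ∨ v = u' := by
      intro v hv hvU
      rcases (hsup v).1 hv with h | h | h
      · exact Or.inl h
      · exact absurd hvU (hpU v h)
      · exact Or.inr h
    obtain ⟨κ', hκ'⟩ := ear_add hX hUX hL hu hu' hne e he heU heX
    have hle := hU.2 (y := U ∪ {v | v ∈ e.support}) ⟨hAU.trans Set.subset_union_left, by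
      rintro v (hv | hv)
      · exact hUX v hv
      · exact heX v hv, κ', hκ'⟩ Set.subset_union_left
    exact hx (Or.inr (hle (Or.inr ((hsup x).2 (Or.inr (Or.inl p.start_mem_support))))))

theorem KModel.castLE {G : SimpleGraph V} {n m : ℕ} {ρ : Fin n → Set V} (h : KModel G n ρ)
    (hm : m ≤ n) : KModel G m (fun i => ρ (Fin.castLE hm i)) :=
  ⟨fun i => h.conn _, fun i j hij => h.disj _ _ fun h => hij (Fin.castLE_injective hm h),
    fun i j hij => h.adj _ _ fun h => hij (Fin.castLE_injective hm h)⟩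

/-- the local structure -/
theorem local_lemma (l : ℕ) : ∃ N0 : ℕ, ∀ N, N0 ≤ N → ∀ (V : Type) [Finite V] (G : SimpleGraph V)
    (ρ : Fin N → Set V), KModel G N ρ → OddModel G l ∨
    ∃ (X U : Set V) (κ : V → Bool), X.ncard ≤ 12 * l ∧ (∀ v ∈ U, v ∉ X) ∧
      (∀ x ∈ U, ∀ y ∈ U, G.Adj x y → κ x ≠ κ y) ∧
      (∀ u ∈ U, ∀ u' ∈ U, ∀ x x', G.Adj u x → G.Adj u' x' → x ∉ X ∪ U →
        Reach G (X ∪ U)ᶜ x x' → u = u') ∧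
      ∀ (D : Set V) (S : Set V), S.ncard ≤ 1 → D ⊆ (X ∪ U)ᶜ →
        (∀ x ∈ D, ∀ y, G.Adj x y → y ∈ D ∨ y ∈ X ∪ S) → ∃ m, Disjoint (ρ m) (D ∪ (X ∪ S)) := by
  obtain ⟨N0, hN0⟩ := ramsey_model l (4 * (24 * l + 2))
  refine ⟨N0, fun N hN V _ G ρ hρ => ?_⟩
  rcases hN0 V G _ (hρ.castLE hN) with h | ⟨c, g, hg, hmod⟩
  · exact Or.inl h
  obtain ⟨a, R, hST, hsub⟩ := exists_superTrees hmod
  rcases erdosPosa G (Set.range a) c (3 * l) with ⟨P, hP⟩ | ⟨X, hXc, hX⟩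
  · exact Or.inl (p5 hST (by omega) P hP)
  right
  obtain ⟨U, κ, hAU, hUX, h1, h2⟩ := p6 hX
  refine ⟨X, U, κ, by omega, hUX, h1, h2, ?_⟩
  intro D S hS hD hcl
  -- choose a super tree avoiding `X ∪ S`
  obtain ⟨i, hi⟩ : ∃ i, Disjoint (stSet a R i) (X ∪ S) := by
    by_contra hcon
    push Not at hcon
    have : ∀ i, ∃ v, v ∈ stSet a R i ∧ v ∈ X ∪ S := fun i => Set.not_disjoint_iff.1 (hcon i)
    choose v hv hv' using this
    have hinj : Function.Injective v := by
      intro i j hij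
      exact st_idx hST (hv i) (hij ▸ hv j)
    have h3 : (Set.range v).ncard = 24 * l + 2 := by
      rw [← Set.image_univ, Set.ncard_image_of_injective _ hinj, Set.ncard_univ]
      simp
    have h4 : (Set.range v).ncard ≤ (X ∪ S).ncard := Set.ncard_le_ncard (by
      rintro _ ⟨i, rfl⟩; exact hv' i)
    have h5 := Set.ncard_union_le X S
    omega
  have hiD : ∀ v ∈ stSet a R i, v ∉ D := by
    intro v hv hvD
    have haU : a i ∈ U := hAU ⟨⟨i, rfl⟩, fun h => Set.disjoint_left.1 hi (Or.inl rfl) (Or.inl h)⟩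
    have haD : a i ∉ D := fun h => hD h (Or.inr haU)
    obtain ⟨s, t, hst, hs, ht, hsD, htD⟩ :=
      ((stSet_conn hST i).2 v hv (a i) (Or.inl rfl)).exists_cross hvD haD
    rcases hcl s hsD t hst.1 with h | h
    · exact htD h
    · exact Set.disjoint_left.1 hi ht h
  obtain ⟨m, hm⟩ := hsub i
  refine ⟨Fin.castLE hN (g m), Set.disjoint_left.2 fun v hv hv' => ?_⟩
  rcases hv' with hv' | hv'
  · exact hiD v (hm hv) hv'
  · exact Set.disjoint_left.1 hi (hm hv) hv'

end P6





section P7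
variable {V : Type}

/-- separations -/
def IsSep (L : SimpleGraph V) (C D : Set V) : Prop :=
  (∀ v, v ∈ C ∨ v ∈ D) ∧ ∀ x y, L.Adj x y → x ∈ C → x ∉ D → y ∈ D → y ∈ C

/-- restriction of a graph to the edges inside a set -/
def resG (L : SimpleGraph V) (A : Set V) : SimpleGraph V where
  Adj x y := L.Adj x y ∧ x ∈ A ∧ y ∈ A
  symm := ⟨fun _ _ h => ⟨h.1.symm, h.2.2, h.2.1⟩⟩
  loopless := ⟨fun _ h => L.loopless.irrefl _ h.1⟩

theorem resG_le (L : SimpleGraph V) (A : Set V) : resG L A ≤ L := fun _ _ h => h.1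

theorem conn_resG_subset {L : SimpleGraph V} {A P : Set V} (h : Conn (resG L A) P) {s : V}
    (hs : s ∈ P) (hsA : s ∈ A) : P ⊆ A := by
  intro v hv
  exact (h.2 s hs v hv).invariant (P := A) hsA (fun a b hab _ _ _ => hab.2.2)

theorem conn_resG {L : SimpleGraph V} {A P : Set V} (h : Conn L P) (hP : P ⊆ A) :
    Conn (resG L A) P :=
  ⟨h.1, fun x hx y hy => (h.2 x hx y hy).mono' fun a ha b hb hab =>
    Reach.single ⟨hab, hP ha, hP hb⟩ ha hb⟩

theorem IsSep.mono {L L' : SimpleGraph V} {C D : Set V} (h : IsSep L C D) (hL : L' ≤ L) :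
    IsSep L' C D := ⟨h.1, fun x y hxy => h.2 x y (hL hxy)⟩

theorem IsSep.symm {L : SimpleGraph V} {C D : Set V} (h : IsSep L C D) : IsSep L D C :=
  ⟨fun v => (h.1 v).symm, fun x y hxy hx hx' hy => by
    by_contra hy'
    exact hx' (h.2 y x hxy.symm hy hy' hx)⟩

theorem IsSep.inter_union {L : SimpleGraph V} {C D C' D' : Set V} (h : IsSep L C D)
    (h' : IsSep L C' D') : IsSep L (C ∩ C') (D ∪ D') := by
  refine ⟨fun v => ?_, ?_⟩
  · rcases h.1 v with h1 | h1 <;> rcases h'.1 v with h2 | h2 <;> simp [h1, h2]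
  · rintro x y hxy ⟨hx1, hx2⟩ hx3 hy
    simp only [Set.mem_union, not_or] at hx3
    refine ⟨?_, ?_⟩
    · rcases h.1 y with h1 | h1
      · exact h1
      · exact h.2 x y hxy hx1 hx3.1 h1
    · rcases h'.1 y with h1 | h1
      · exact h1
      · exact h'.2 x y hxy hx2 hx3.2 h1

theorem IsSep.union_inter {L : SimpleGraph V} {C D C' D' : Set V} (h : IsSep L C D)
    (h' : IsSep L C' D') : IsSep L (C ∪ C') (D ∩ D') :=
  (h.symm.inter_union h'.symm).symm

/-- a connected set avoiding the cut lies on one side -/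
theorem IsSep.conn_side {L : SimpleGraph V} {C D P : Set V} (h : IsSep L C D) (hP : Conn L P)
    (hd : ∀ v ∈ P, ¬ (v ∈ C ∧ v ∈ D)) : (∀ v ∈ P, v ∈ C ∧ v ∉ D) ∨ (∀ v ∈ P, v ∈ D ∧ v ∉ C) := by
  obtain ⟨x, hx⟩ := hP.1
  rcases h.1 x with hxC | hxD
  · left
    intro v hv
    have : v ∈ C := (hP.2 x hx v hv).invariant (P := C) hxC (by
      intro a b hab ha hb haC
      rcases h.1 b with h1 | h1
      · exact h1
      · exact h.2 a b hab haC (fun h2 => hd a ha ⟨haC, h2⟩) h1)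
    exact ⟨this, fun h2 => hd v hv ⟨this, h2⟩⟩
  · right
    intro v hv
    have : v ∈ D := (hP.2 x hx v hv).invariant (P := D) hxD (by
      intro a b hab ha hb haC
      rcases h.1 b with h1 | h1
      · exact h.symm.2 a b hab haC (fun h2 => hd a ha ⟨h2, haC⟩) h1
      · exact h1)
    exact ⟨this, fun h2 => hd v hv ⟨h2, this⟩⟩

theorem ncard_submod [Finite V] {X Y P P' : Set V} (h1 : X ∪ Y ⊆ P ∪ P') (h2 : X ∩ Y ⊆ P ∩ P') :
    X.ncard + Y.ncard ≤ P.ncard + P'.ncard := by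
  rw [← Set.ncard_union_add_ncard_inter X Y, ← Set.ncard_union_add_ncard_inter P P']
  exact Nat.add_le_add (Set.ncard_le_ncard h1) (Set.ncard_le_ncard h2)

/-- Menger's theorem (set version). -/
theorem menger [Finite V] (k : ℕ) : ∀ (L : SimpleGraph V), L.edgeSet.ncard ≤ k → ∀ (S R : Set V),
    (∀ C D, IsSep L C D → S ⊆ C → R ⊆ D → S.ncard ≤ (C ∩ D).ncard) →
    ∃ P : V → Set V, (∀ s ∈ S, s ∈ P s ∧ Conn L (P s) ∧ ∃ r ∈ P s, r ∈ R) ∧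
      ∀ s ∈ S, ∀ s' ∈ S, s ≠ s' → Disjoint (P s) (P s') := by
  classical
  induction k with
  | zero =>
    intro L hL S R h
    have hL0 : ∀ x y, ¬ L.Adj x y := by
      intro x y hxy
      have : L.edgeSet = ∅ := by
        rwa [Nat.le_zero, Set.ncard_eq_zero] at hL
      have h2 : s(x, y) ∈ L.edgeSet := hxy
      rw [this] at h2
      exact h2
    have h1 := h (S ∪ Rᶜ) R ⟨fun v => by
      by_cases hv : v ∈ R
      · exact Or.inr hv
      · exact Or.inl (Or.inr hv), fun x y hxy => absurd hxy (hL0 x y)⟩ Set.subset_union_left subset_rfl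
    have h2 : (S ∪ Rᶜ) ∩ R ⊆ S := by
      rintro v ⟨hv | hv, hv'⟩
      · exact hv
      · exact absurd hv' hv
    have h3 := Set.eq_of_subset_of_ncard_le h2 h1
    refine ⟨fun s => {s}, fun s hs => ⟨rfl, conn_singleton _ _, s, rfl, ?_⟩, ?_⟩
    · rw [← h3] at hs; exact hs.2
    · intro s _ s' _ hne
      simpa using hne
  | succ k ih =>
    intro L hL S R h
    by_cases hne : L.edgeSet = ∅
    · exact ih L (by rw [hne]; simp) S R h
    obtain ⟨e, he⟩ := Set.nonempty_iff_ne_empty.2 hne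
    have hcard : ∀ L' : SimpleGraph V, L' ≤ L.deleteEdges {e} → L'.edgeSet.ncard ≤ k := by
      intro L' hL'
      have h1 : L'.edgeSet ⊆ L.edgeSet \ {e} := by
        rw [← edgeSet_deleteEdges]
        exact edgeSet_mono hL'
      have h2 := Set.ncard_le_ncard h1
      rw [Set.ncard_sdiff_singleton_of_mem he] at h2
      omega
    by_cases hdel : ∀ C D, IsSep (L.deleteEdges {e}) C D → S ⊆ C → R ⊆ D → S.ncard ≤ (C ∩ D).ncard
    · obtain ⟨P, h1, h2⟩ := ih _ (hcard _ le_rfl) S R hdel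
      exact ⟨P, fun s hs => ⟨(h1 s hs).1, (h1 s hs).2.1.mono (deleteEdges_le _), (h1 s hs).2.2⟩, h2⟩
    push Not at hdel
    obtain ⟨C, D, hsep, hSC, hRD, hlt⟩ := hdel
    have hns : ¬ IsSep L C D := fun h' => absurd (h C D h' hSC hRD) (not_le.2 hlt)
    obtain ⟨x, y, hxy, hxC, hxD, hyD, hyC⟩ : ∃ x y, L.Adj x y ∧ x ∈ C ∧ x ∉ D ∧ y ∈ D ∧ y ∉ C := by
      by_contra hcon
      push Not at hcon
      exact hns ⟨hsep.1, hcon⟩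
    have hexy : e = s(x, y) := by
      by_contra hne'
      exact hyC (hsep.2 x y (by
        rw [deleteEdges_adj]
        exact ⟨hxy, fun h' => hne' h'.symm⟩) hxC hxD hyD)
    subst hexy
    set L' := L.deleteEdges {s(x, y)} with hL'
    have hadj : ∀ a b, L.Adj a b → (a = x → b ≠ y) → (a = y → b ≠ x) → L'.Adj a b := by
      intro a b hab h1 h2
      rw [hL', deleteEdges_adj]
      refine ⟨hab, fun h3 => ?_⟩
      simp only [Set.mem_singleton_iff, Sym2.eq_iff] at h3
      rcases h3 with ⟨h3, h4⟩ | ⟨h3, h4⟩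
      · exact h1 h3 h4
      · exact h2 h3 h4
    set Z := C ∩ D with hZ
    have hxZ : x ∉ Z := fun h' => hxD h'.2
    have hyZ : y ∉ Z := fun h' => hyC h'.1
    have hZc : Z.ncard + 1 = S.ncard := by
      have h1 := h (insert y C) D ⟨fun v => (hsep.1 v).imp_left Or.inr, by
        intro a b hab ha haD hb
        by_cases hby : b = y
        · exact Or.inl hby
        refine Or.inr ?_
        rcases ha with ha | ha
        · exact absurd (ha ▸ hyD) haD
        · exact hsep.2 a b (hadj a b hab (fun _ => hby) (fun h' => absurd (h' ▸ hyD) haD)) ha haD hb⟩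
          (hSC.trans (Set.subset_insert _ _)) hRD
      have h2 : insert y C ∩ D ⊆ insert y Z := by
        rintro v ⟨hv | hv, hv'⟩
        · exact Or.inl hv
        · exact Or.inr ⟨hv, hv'⟩
      have h3 := Set.ncard_le_ncard h2
      rw [Set.ncard_insert_of_notMem hyZ] at h3
      omega
    have hZx : (insert x Z).ncard = S.ncard := by rw [Set.ncard_insert_of_notMem hxZ, hZc]
    have hZy : (insert y Z).ncard = S.ncard := by rw [Set.ncard_insert_of_notMem hyZ, hZc]
    obtain ⟨P1, hP1, hd1⟩ := ih (resG L' C) (hcard _ (resG_le _ _)) S (insert x Z) (by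
      intro A B hAB hSA hZB
      have hxB : x ∈ B := hZB (Or.inl rfl)
      refine (h (A ∩ C) (B ∪ D) ⟨fun v => ?_, ?_⟩ (fun v hv => ⟨hSA hv, hSC hv⟩)
        (hRD.trans Set.subset_union_right)).trans (Set.ncard_le_ncard ?_)
      · rcases hAB.1 v with h1 | h1 <;> rcases hsep.1 v with h2 | h2 <;> simp [h1, h2]
      · rintro a b hab ⟨haA, haC⟩ ha hb
        simp only [Set.mem_union, not_or] at ha
        have hax : a ≠ x := fun h' => ha.1 (h' ▸ hxB)
        have hay : a ≠ y := fun h' => hyC (h' ▸ haC)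
        have hab' := hadj a b hab (fun h' => absurd h' hax) (fun h' => absurd h' hay)
        have hbC : b ∈ C := by
          rcases hsep.1 b with h1 | h1
          · exact h1
          · exact hsep.2 a b hab' haC ha.2 h1
        refine ⟨?_, hbC⟩
        rcases hAB.1 b with h1 | h1
        · exact h1
        · exact hAB.2 a b ⟨hab', haC, hbC⟩ haA ha.1 h1
      · rintro v ⟨⟨h1, h2⟩, h3 | h3⟩
        · exact ⟨h1, h3⟩
        · exact ⟨h1, hZB (Or.inr ⟨h2, h3⟩)⟩)
    obtain ⟨P2, hP2, hd2⟩ := ih (resG L' D) (hcard _ (resG_le _ _)) (insert y Z) R (by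
      intro A B hAB hSA hRB
      have hyA : y ∈ A := hSA (Or.inl rfl)
      rw [hZy]
      refine (h (A ∪ C) (B ∩ D) (IsSep.symm ⟨fun v => ?_, ?_⟩) (hSC.trans Set.subset_union_right)
        (fun v hv => ⟨hRB hv, hRD hv⟩)).trans (Set.ncard_le_ncard ?_)
      · rcases hAB.1 v with h1 | h1 <;> rcases hsep.1 v with h2 | h2 <;> simp [h1, h2]
      · rintro a b hab ⟨haA, haC⟩ ha hb
        simp only [Set.mem_union, not_or] at ha
        have hax : a ≠ x := fun h' => hxD (h' ▸ haC)
        have hay : a ≠ y := fun h' => ha.1 (h' ▸ hyA)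
        have hab' := hadj a b hab (fun h' => absurd h' hax) (fun h' => absurd h' hay)
        have hbC : b ∈ D := by
          rcases hsep.1 b with h1 | h1
          · exact hsep.symm.2 a b hab' haC ha.2 h1
          · exact h1
        refine ⟨?_, hbC⟩
        rcases hAB.1 b with h1 | h1
        · exact hAB.symm.2 a b ⟨hab', haC, hbC⟩ haA ha.1 h1
        · exact h1
      · rintro v ⟨h1 | h1, h2, h3⟩
        · exact ⟨h1, h2⟩
        · exact ⟨hSA (Or.inr ⟨h1, h3⟩), h2⟩)
    choose! hs1 hc1 σ hσ hσ' using hP1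
    choose! hs2 hc2 ω hω hω' using hP2
    have hinj : Set.InjOn σ S := by
      intro s hs s' hs' hss
      by_contra hne'
      exact Set.disjoint_left.1 (hd1 s hs s' hs' hne') (hσ s hs) (hss ▸ hσ s' hs')
    have himg : σ '' S = insert x Z := by
      refine Set.eq_of_subset_of_ncard_le ?_ ?_
      · rintro _ ⟨s, hs, rfl⟩; exact hσ' s hs
      · rw [hinj.ncard_image, hZx]
    have huniq : ∀ s ∈ S, ∀ v ∈ P1 s, v ∈ Z → v = σ s := by
      intro s hs v hv hvZ
      have : v ∈ σ '' S := by rw [himg]; exact Or.inr hvZ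
      obtain ⟨s', hs', rfl⟩ := this
      by_contra hne'
      exact Set.disjoint_left.1 (hd1 s hs s' hs' fun h' => hne' (by rw [h'])) hv (hσ s' hs')
    have hsub1 : ∀ s ∈ S, P1 s ⊆ C := fun s hs => conn_resG_subset (hc1 s hs) (hs1 s hs) (hSC hs)
    have hyZD : insert y Z ⊆ D := by
      rintro v (hv | hv)
      · exact hv ▸ hyD
      · exact hv.2
    have hsub2 : ∀ s ∈ insert y Z, P2 s ⊆ D := fun s hs =>
      conn_resG_subset (hc2 s hs) (hs2 s hs) (hyZD hs)
    have hLL : ∀ A, resG L' A ≤ L := fun A => (resG_le _ _).trans (deleteEdges_le _)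
    let τ : V → V := fun v => if v = x then y else v
    have hτ : ∀ s ∈ S, τ (σ s) ∈ insert y Z := by
      intro s hs
      by_cases h1 : σ s = x
      · simp [τ, h1]
      · simp only [τ, h1, if_false]
        exact Or.inr ((hσ' s hs).resolve_left h1)
    have hcross : ∀ s ∈ S, ∀ s' ∈ S, s ≠ s' → Disjoint (P1 s) (P2 (τ (σ s'))) := by
      intro s hs s' hs' hne'
      refine Set.disjoint_left.2 fun v hv hv' => ?_
      have hvZ : v ∈ Z := ⟨hsub1 s hs hv, hsub2 _ (hτ s' hs') hv'⟩
      have h1 := huniq s hs v hv hvZ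
      have h2 : v = τ (σ s') := by
        by_contra h3
        exact Set.disjoint_left.1 (hd2 v (Or.inr hvZ) _ (hτ s' hs') h3) (hs2 v (Or.inr hvZ)) hv'
      by_cases h3 : σ s' = x
      · simp only [τ, h3, if_true] at h2
        exact hyZ (h2 ▸ hvZ)
      · simp only [τ, h3, if_false] at h2
        exact hne' (hinj hs hs' (h1.symm.trans h2))
    refine ⟨fun s => P1 s ∪ P2 (τ (σ s)), fun s hs => ⟨Or.inl (hs1 s hs), ?_, ω (τ (σ s)),
      Or.inr (hω _ (hτ s hs)), hω' _ (hτ s hs)⟩, ?_⟩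
    · have c1 := (hc1 s hs).mono (hLL _)
      have c2 := (hc2 _ (hτ s hs)).mono (hLL _)
      refine c1.union_reach c2 (hσ s hs) (hs2 _ (hτ s hs)) ?_
      by_cases h1 : σ s = x
      · refine Reach.single ?_ (Or.inl (hσ s hs)) (Or.inr (hs2 _ (hτ s hs)))
        simp only [τ, h1, if_true]
        exact hxy
      · have : τ (σ s) = σ s := by simp [τ, h1]
        rw [this]
        exact Reach.refl _ _ _
    · intro s hs s' hs' hne'
      simp only [Set.disjoint_union_left, Set.disjoint_union_right]
      refine ⟨⟨hd1 s hs s' hs' hne', (hcross s' hs' s hs hne'.symm).symm⟩,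
        hcross s hs s' hs' hne', hd2 _ (hτ s hs) _ (hτ s' hs') fun h1 => ?_⟩
      have h4 : ∀ s ∈ S, σ s ≠ y := by
        intro s hs h5
        rcases hσ' s hs with h6 | h6
        · exact hxD (h6 ▸ h5 ▸ hyD)
        · exact hyZ (h5 ▸ h6)
      by_cases h2 : σ s = x <;> by_cases h3 : σ s' = x
      · exact hne' (hinj hs hs' (h2.trans h3.symm))
      · simp only [τ, h2, h3, if_true, if_false] at h1
        exact h4 s' hs' h1.symm
      · simp only [τ, h2, h3, if_true, if_false] at h1
        exact h4 s hs h1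
      · simp only [τ, h2, h3, if_false] at h1
        exact hne' (hinj hs hs' h1)

end P7





section rooted
variable {V : Type}

/-- saturated sets -/
def Sat {N : ℕ} (q : Fin N → Set V) (Q : Finset (Fin N)) (C : Set V) : Prop :=
  ∀ i ∈ Q, q i ⊆ C ∨ ∀ v ∈ q i, v ∉ C

/-- representatives -/
def Fx {N : ℕ} (q : Fin N → Set V) (r : Fin N → V) (Q : Finset (Fin N)) : Set V :=
  {x | ∀ i ∈ Q, x ∈ q i → x = r i}

open Classical in
/-- contraction map -/
noncomputable def ctr {N : ℕ} (q : Fin N → Set V) (r : Fin N → V) (Q : Finset (Fin N)) (x : V) : V :=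
  if h : ∃ i, i ∈ Q ∧ x ∈ q i then r h.choose else x

/-- admissible separations -/
def Adm {N : ℕ} (L : SimpleGraph V) (S : Set V) (q : Fin N → Set V) (Q : Finset (Fin N))
    (C D : Set V) : Prop :=
  IsSep L C D ∧ Sat q Q C ∧ Sat q Q D ∧ S ⊆ C ∧ ∀ i ∈ Q, q i ⊆ D

theorem Sat.union {N : ℕ} {q : Fin N → Set V} {Q : Finset (Fin N)} {C C' : Set V} (h : Sat q Q C)
    (h' : Sat q Q C') : Sat q Q (C ∪ C') := by
  intro i hi
  rcases h i hi with h1 | h1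
  · exact Or.inl (h1.trans Set.subset_union_left)
  · rcases h' i hi with h2 | h2
    · exact Or.inl (h2.trans Set.subset_union_right)
    · refine Or.inr fun v hv hv' => ?_
      rcases hv' with hv' | hv'
      · exact h1 v hv hv'
      · exact h2 v hv hv'

theorem Sat.inter {N : ℕ} {q : Fin N → Set V} {Q : Finset (Fin N)} {C C' : Set V} (h : Sat q Q C)
    (h' : Sat q Q C') : Sat q Q (C ∩ C') := by
  intro i hi
  rcases h i hi with h1 | h1
  · rcases h' i hi with h2 | h2
    · exact Or.inl (Set.subset_inter h1 h2)
    · exact Or.inr fun v hv hv' => h2 v hv hv'.2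
  · exact Or.inr fun v hv hv' => h1 v hv hv'.1

theorem ctr_of_mem {N : ℕ} {q : Fin N → Set V} {r : Fin N → V} {Q : Finset (Fin N)}
    (hd : ∀ i ∈ Q, ∀ j ∈ Q, i ≠ j → Disjoint (q i) (q j)) {x : V} {i : Fin N} (hi : i ∈ Q)
    (hx : x ∈ q i) : ctr q r Q x = r i := by
  have h : ∃ i, i ∈ Q ∧ x ∈ q i := ⟨i, hi, hx⟩
  unfold ctr
  rw [dif_pos h]
  congr 1
  by_contra hne
  exact Set.disjoint_left.1 (hd _ h.choose_spec.1 i hi hne) h.choose_spec.2 hx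

theorem ctr_of_not {N : ℕ} {q : Fin N → Set V} {r : Fin N → V} {Q : Finset (Fin N)}
    {x : V} (h : ¬ ∃ i, i ∈ Q ∧ x ∈ q i) : ctr q r Q x = x := by
  unfold ctr
  rw [dif_neg h]

theorem ctr_fx {N : ℕ} {q : Fin N → Set V} {r : Fin N → V} {Q : Finset (Fin N)}
    (hd : ∀ i ∈ Q, ∀ j ∈ Q, i ≠ j → Disjoint (q i) (q j)) {x : V} (hx : x ∈ Fx q r Q) :
    ctr q r Q x = x := by
  by_cases h : ∃ i, i ∈ Q ∧ x ∈ q i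
  · obtain ⟨i, hi, hxi⟩ := h
    rw [ctr_of_mem hd hi hxi, hx i hi hxi]
  · exact ctr_of_not h

/-- the number of atoms contained in a set is at most the number of representatives -/
theorem card_reps [Finite V] {N : ℕ} {q : Fin N → Set V} {r : Fin N → V} {Q K : Finset (Fin N)}
    (hr : ∀ i ∈ Q, r i ∈ q i)
    (hd : ∀ i ∈ Q, ∀ j ∈ Q, i ≠ j → Disjoint (q i) (q j)) (hK : K ⊆ Q) {C : Set V}
    (h : ∀ i ∈ K, q i ⊆ C) : K.card ≤ (C ∩ Fx q r Q).ncard := by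
  have hinj : Set.InjOn r (K : Set (Fin N)) := by
    intro i hi j hj hij
    by_contra hne
    exact Set.disjoint_left.1 (hd i (hK hi) j (hK hj) hne) (hr i (hK hi)) (hij ▸ hr j (hK hj))
  rw [← Set.ncard_coe_finset, ← hinj.ncard_image]
  refine Set.ncard_le_ncard ?_
  rintro _ ⟨i, hi, rfl⟩
  refine ⟨h i hi (hr i (hK hi)), fun j hj hij => ?_⟩
  by_contra hne
  exact Set.disjoint_left.1 (hd i (hK hi) j hj fun h => hne (by rw [h])) (hr i (hK hi)) hij

theorem rooted_claim [Finite V] {N : ℕ} (L : SimpleGraph V) (S : Set V) (q : Fin N → Set V)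
    (r : Fin N → V) (I : Finset (Fin N)) (hr : ∀ i ∈ I, r i ∈ q i) (hconn : ∀ i ∈ I, Conn L (q i))
    (hd : ∀ i ∈ I, ∀ j ∈ I, i ≠ j → Disjoint (q i) (q j))
    (hadj : ∀ i ∈ I, ∀ j ∈ I, i ≠ j → ∃ x ∈ q i, ∃ y ∈ q j, L.Adj x y)
    (t : ℕ) (hI : t * t + t + 1 ≤ I.card)
    (hsep : ∀ C D, IsSep L C D → S ⊆ C → ∀ i ∈ I, (∀ v ∈ q i, v ∈ D ∧ v ∉ C) →
      t ≤ (C ∩ D).ncard) (j : ℕ) (hj : j ≤ t) :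
    ∃ Q ⊆ I, I.card ≤ Q.card + j * t ∧ ∀ C D, Adm L S q Q C D → j ≤ (C ∩ D ∩ Fx q r Q).ncard := by
  classical
  induction j with
  | zero => exact ⟨I, subset_rfl, by omega, fun _ _ _ => Nat.zero_le _⟩
  | succ j ih =>
    obtain ⟨Q, hQI, hQc, hQ⟩ := ih (by omega)
    by_cases hgood : ∀ C D, Adm L S q Q C D → j + 1 ≤ (C ∩ D ∩ Fx q r Q).ncard
    · exact ⟨Q, hQI, by rw [Nat.succ_mul]; omega, hgood⟩
    push Not at hgood
    let F : Set (Set V) := {D | ∃ C, Adm L S q Q C D ∧ (C ∩ D ∩ Fx q r Q).ncard ≤ j}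
    obtain ⟨C0, D0, hA0, hlt0⟩ := hgood
    obtain ⟨D, hDmin⟩ := (Set.toFinite F).exists_minimal ⟨D0, C0, hA0, by omega⟩
    obtain ⟨C, hA, hcost⟩ := hDmin.1
    have hmin : ∀ D', D' ∈ F → D' ⊆ D → D ⊆ D' := fun D' h1 h2 => hDmin.2 h1 h2
    let K := Q.filter fun i => q i ⊆ C
    let Q' := Q.filter fun i => ¬ q i ⊆ C
    have hKQ : K ⊆ Q := Finset.filter_subset _ _
    have hQQ : Q' ⊆ Q := Finset.filter_subset _ _
    have hcardKQ : K.card + Q'.card = Q.card := Finset.card_filter_add_card_filter_not _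
    have hdQ : ∀ i ∈ Q, ∀ j ∈ Q, i ≠ j → Disjoint (q i) (q j) := fun i hi j hj =>
      hd i (hQI hi) j (hQI hj)
    have hrQ : ∀ i ∈ Q, r i ∈ q i := fun i hi => hr i (hQI hi)
    have hKc : K.card ≤ j := by
      refine (card_reps hrQ hdQ hKQ (C := C ∩ D) ?_).trans hcost
      intro i hi
      exact Set.subset_inter (Finset.mem_filter.1 hi).2 (hA.2.2.2.2 i (hKQ hi))
    have hjt : (j + 1) * t ≤ t * t := Nat.mul_le_mul_right _ hj
    have hexp : (j + 1) * t = j * t + t := Nat.succ_mul _ _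
    refine ⟨Q', hQQ.trans hQI, by omega, ?_⟩
    intro C' D' hA'
    by_contra hcon
    push Not at hcon
    have hcost' : (C' ∩ D' ∩ Fx q r Q').ncard ≤ j := by omega
    obtain ⟨hs', hC', hD', hSC', hQD'⟩ := hA'
    have hQ'big : j < Q'.card := by omega
    have hdQ' : ∀ i ∈ Q', ∀ j ∈ Q', i ≠ j → Disjoint (q i) (q j) := fun i hi j hj =>
      hdQ i (hQQ hi) j (hQQ hj)
    have hrQ' : ∀ i ∈ Q', r i ∈ q i := fun i hi => hrQ i (hQQ hi)
    -- an atom strictly on the right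
    obtain ⟨i0, hi0, hi0C⟩ : ∃ i ∈ Q', ∀ v ∈ q i, v ∉ C' := by
      by_contra hno
      push Not at hno
      have h1 : ∀ i ∈ Q', q i ⊆ C' ∩ D' := by
        intro i hi
        obtain ⟨v, hv, hvC⟩ := hno i hi
        exact Set.subset_inter ((hC' i hi).resolve_right fun h => h v hv hvC) (hQD' i hi)
      have := card_reps hrQ' hdQ' subset_rfl h1
      omega
    by_cases hcut : ∃ i ∈ Q', ∃ v ∈ q i, v ∈ C'
    · obtain ⟨i1, hi1, v1, hv1, hv1C⟩ := hcut
      have hi1C : q i1 ⊆ C' := (hC' i1 hi1).resolve_right fun h => h v1 hv1 hv1C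
      let M : Set V := {v | ∃ i ∈ Q, v ∈ q i ∧ ∃ w ∈ q i, w ∈ C' ∧ w ∈ D'}
      have hsatM : ∀ i ∈ Q, (∃ w ∈ q i, w ∈ C' ∧ w ∈ D') → q i ⊆ M :=
        fun i hi hw v hv => ⟨i, hi, hv, hw⟩
      have hnM : ∀ i ∈ Q, (¬ ∃ w ∈ q i, w ∈ C' ∧ w ∈ D') → ∀ v ∈ q i, v ∉ M := by
        rintro i hi hw v hv ⟨i', hi', hv', hw'⟩
        by_cases h : i = i'
        · subst h; exact hw hw'
        · exact Set.disjoint_left.1 (hdQ i hi i' hi' h) hv hv'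
      have hside : ∀ i ∈ Q, (¬ ∃ w ∈ q i, w ∈ C' ∧ w ∈ D') →
          (∀ v ∈ q i, v ∈ C' ∧ v ∉ D') ∨ (∀ v ∈ q i, v ∈ D' ∧ v ∉ C') := by
        intro i hi hw
        exact hs'.conn_side (hconn i (hQI hi)) fun v hv hv' => hw ⟨v, hv, hv'⟩
      have hA'' : Adm L S q Q (C' ∪ M) (D' ∪ M) := by
        refine ⟨⟨fun v => (hs'.1 v).imp Or.inl Or.inl, ?_⟩, ?_, ?_, hSC'.trans Set.subset_union_left,
          ?_⟩
        · intro x y hxy hx hxD hy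
          simp only [Set.mem_union, not_or] at hxD
          rcases hy with hy | hy
          · exact Or.inl (hs'.2 x y hxy (hx.resolve_right hxD.2) hxD.1 hy)
          · exact Or.inr hy
        · intro i hi
          by_cases hw : ∃ w ∈ q i, w ∈ C' ∧ w ∈ D'
          · exact Or.inl ((hsatM i hi hw).trans Set.subset_union_right)
          · rcases hside i hi hw with h | h
            · exact Or.inl fun v hv => Or.inl (h v hv).1
            · refine Or.inr fun v hv hv' => ?_
              rcases hv' with hv' | hv'
              · exact (h v hv).2 hv'
              · exact hnM i hi hw v hv hv'
        · intro i hi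
          by_cases hw : ∃ w ∈ q i, w ∈ C' ∧ w ∈ D'
          · exact Or.inl ((hsatM i hi hw).trans Set.subset_union_right)
          · rcases hside i hi hw with h | h
            · refine Or.inr fun v hv hv' => ?_
              rcases hv' with hv' | hv'
              · exact (h v hv).2 hv'
              · exact hnM i hi hw v hv hv'
            · exact Or.inl fun v hv => Or.inl (h v hv).1
        · intro i hi
          by_cases hw : ∃ w ∈ q i, w ∈ C' ∧ w ∈ D'
          · exact (hsatM i hi hw).trans Set.subset_union_right
          · rcases hside i hi hw with h | h
            · exfalso
              by_cases hii : i0 = i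
              · subst hii
                obtain ⟨v, hv⟩ := (hconn i0 (hQI hi)).1
                exact hi0C v hv (h v hv).1
              · obtain ⟨x, hx, y, hy, hxy⟩ := hadj i0 (hQI (hQQ hi0)) i (hQI hi) hii
                exact hi0C x hx (hs'.symm.1 x |>.elim (fun h1 => by
                  by_contra h2
                  exact (h y hy).2 (hs'.symm.2 x y hxy h1 h2 (h y hy).1)) id)
            · exact fun v hv => Or.inl (h v hv).1
      have hcost'' : ((C' ∪ M) ∩ (D' ∪ M) ∩ Fx q r Q).ncard ≤ j := by
        refine le_trans ?_ hcost'
        refine le_trans (Set.ncard_le_ncard ?_) (Set.ncard_image_le (f := ctr q r Q) (Set.toFinite _))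
        rintro x ⟨⟨hxC, hxD⟩, hxF⟩
        by_cases hx : x ∈ C' ∧ x ∈ D'
        · exact ⟨x, ⟨hx, fun i hi => hxF i (hQQ hi)⟩, ctr_fx hdQ hxF⟩
        · have hxM : x ∈ M := by
            by_contra hM
            exact hx ⟨hxC.resolve_right hM, hxD.resolve_right hM⟩
          obtain ⟨i, hi, hxi, w, hw, hwC, hwD⟩ := hxM
          have hxr : x = r i := hxF i hi hxi
          refine ⟨w, ⟨⟨hwC, hwD⟩, ?_⟩, ?_⟩
          · intro i' hi' hwi'
            have : i' = i := by
              by_contra hne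
              exact Set.disjoint_left.1 (hdQ i' (hQQ hi') i hi hne) hwi' hw
            subst this
            exfalso
            apply hx
            exact ⟨(hC' i' hi').resolve_right (fun h => h w hw hwC) hxi, hQD' i' hi' hxi⟩
          · rw [ctr_of_mem hdQ hi hw, hxr]
      have hsm := ncard_submod (X := (C ∩ (C' ∪ M)) ∩ (D ∪ (D' ∪ M)) ∩ Fx q r Q)
        (Y := (C ∪ (C' ∪ M)) ∩ (D ∩ (D' ∪ M)) ∩ Fx q r Q) (P := C ∩ D ∩ Fx q r Q)
        (P' := (C' ∪ M) ∩ (D' ∪ M) ∩ Fx q r Q)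
        (by
          generalize C' ∪ M = C''
          generalize D' ∪ M = D''
          intro v
          simp only [Set.mem_union, Set.mem_inter_iff]
          tauto)
        (by
          generalize C' ∪ M = C''
          generalize D' ∪ M = D''
          intro v
          simp only [Set.mem_union, Set.mem_inter_iff]
          tauto)
      have h1 := hQ (C ∩ (C' ∪ M)) (D ∪ (D' ∪ M)) ⟨hA.1.inter_union hA''.1, hA.2.1.inter hA''.2.1,
        hA.2.2.1.union hA''.2.2.1, Set.subset_inter hA.2.2.2.1 hA''.2.2.2.1,
        fun i hi => (hA.2.2.2.2 i hi).trans Set.subset_union_left⟩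
      have h2 : ((C ∪ (C' ∪ M)) ∩ (D ∩ (D' ∪ M)) ∩ Fx q r Q).ncard ≤ j := by omega
      have h3 : D ⊆ D ∩ (D' ∪ M) := hmin _ ⟨C ∪ (C' ∪ M), ⟨hA.1.union_inter hA''.1,
        hA.2.1.union hA''.2.1, hA.2.2.1.inter hA''.2.2.1,
        hA.2.2.2.1.trans Set.subset_union_left,
        fun i hi => Set.subset_inter (hA.2.2.2.2 i hi) (hA''.2.2.2.2 i hi)⟩, h2⟩ Set.inter_subset_left
      have h4 : C ∩ D ∩ Fx q r Q = (C ∪ (C' ∪ M)) ∩ (D ∩ (D' ∪ M)) ∩ Fx q r Q := by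
        refine Set.eq_of_subset_of_ncard_le ?_ (h2.trans (hQ C D hA))
        rintro v ⟨⟨hv1, hv2⟩, hv3⟩
        exact ⟨⟨Or.inl hv1, h3 hv2⟩, hv3⟩
      have hr1 : r i1 ∈ q i1 := hrQ' i1 hi1
      have h5 : r i1 ∈ C ∩ D ∩ Fx q r Q := by
        rw [h4]
        refine ⟨⟨Or.inr (Or.inl (hi1C hr1)), h3 (hA.2.2.2.2 i1 (hQQ hi1) hr1)⟩, ?_⟩
        intro i hi hri
        by_contra hne
        exact Set.disjoint_left.1 (hdQ i1 (hQQ hi1) i hi fun h => hne (by rw [h])) hr1 hri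
      exact ((hA.2.1 i1 (hQQ hi1)).resolve_left (Finset.mem_filter.1 hi1).2) _ hr1 h5.1.1
    · push Not at hcut
      have h1 := hsep C' D' hs' hSC' i0 (hQI (hQQ hi0)) fun v hv => ⟨hQD' i0 hi0 hv, hi0C v hv⟩
      have h2 : (C' ∩ D').ncard ≤ (C' ∩ D' ∩ Fx q r Q').ncard := by
        refine Set.ncard_le_ncard fun v hv => ⟨hv, fun i hi hvi => ?_⟩
        exact absurd hv.1 (hcut i hi v hvi)
      omega

/-- rooted clique models -/
theorem rooted_clique [Finite V] {N : ℕ} (L : SimpleGraph V) (S : Set V) (q : Fin N → Set V)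
    (I : Finset (Fin N)) (hconn : ∀ i ∈ I, Conn L (q i))
    (hd : ∀ i ∈ I, ∀ j ∈ I, i ≠ j → Disjoint (q i) (q j))
    (hadj : ∀ i ∈ I, ∀ j ∈ I, i ≠ j → ∃ x ∈ q i, ∃ y ∈ q j, L.Adj x y)
    (hS : ∀ i ∈ I, Disjoint (q i) S)
    (hI : S.ncard * S.ncard + S.ncard + 1 ≤ I.card)
    (hsep : ∀ C D, IsSep L C D → S ⊆ C → ∀ i ∈ I, (∀ v ∈ q i, v ∈ D ∧ v ∉ C) →
      S.ncard ≤ (C ∩ D).ncard) :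
    ∃ P : V → Set V, (∀ s ∈ S, s ∈ P s ∧ Conn L (P s)) ∧
      (∀ s ∈ S, ∀ s' ∈ S, s ≠ s' → Disjoint (P s) (P s')) ∧
      ∀ s ∈ S, ∀ s' ∈ S, s ≠ s' → ∃ x ∈ P s, ∃ y ∈ P s', L.Adj x y := by
  classical
  have hex : ∀ i ∈ I, ∃ x, x ∈ q i := fun i hi => (hconn i hi).1
  by_cases hS0 : S = ∅
  · subst hS0
    exact ⟨fun _ => ∅, by simp, by simp, by simp⟩
  obtain ⟨s0, hs0⟩ := Set.nonempty_iff_ne_empty.2 hS0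
  let r : Fin N → V := fun i => if h : ∃ x, x ∈ q i then h.choose else s0
  have hr : ∀ i ∈ I, r i ∈ q i := by
    intro i hi
    simp only [r, dif_pos (hex i hi)]
    exact (hex i hi).choose_spec
  obtain ⟨Q, hQI, hQc, hQ⟩ := rooted_claim L S q r I hr hconn hd hadj S.ncard hI hsep S.ncard le_rfl
  have hdQ : ∀ i ∈ Q, ∀ j ∈ Q, i ≠ j → Disjoint (q i) (q j) := fun i hi j hj =>
    hd i (hQI hi) j (hQI hj)
  have hrQ : ∀ i ∈ Q, r i ∈ q i := fun i hi => hr i (hQI hi)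
  let f := ctr q r Q
  have hfi : ∀ i ∈ Q, ∀ x ∈ q i, f x = r i := fun i hi x hx => ctr_of_mem hdQ hi hx
  have hff : ∀ x, f (f x) = f x := by
    intro x
    by_cases h : ∃ i, i ∈ Q ∧ x ∈ q i
    · obtain ⟨i, hi, hxi⟩ := h
      rw [hfi i hi x hxi, hfi i hi _ (hrQ i hi)]
    · have : f x = x := ctr_of_not h
      rw [this, this]
  let LQ : SimpleGraph V :=
    { Adj := fun x y => x ≠ y ∧ ∃ a b, f a = x ∧ f b = y ∧ L.Adj a b
      symm := ⟨fun x y h => ⟨h.1.symm, h.2.choose_spec.choose, h.2.choose,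
        h.2.choose_spec.choose_spec.2.1, h.2.choose_spec.choose_spec.1,
        h.2.choose_spec.choose_spec.2.2.symm⟩⟩
      loopless := ⟨fun x h => h.1 rfl⟩ }
  have hfS : ∀ s ∈ S, f s = s := by
    intro s hs
    exact ctr_of_not fun ⟨i, hi, hsi⟩ => Set.disjoint_left.1 (hS i (hQI hi)) hsi hs
  obtain ⟨P, hP, hPd⟩ := menger LQ.edgeSet.ncard LQ le_rfl S (r '' Q) (by
    intro C D hCD hSC hRD
    have h1 : Adm L S q Q (f ⁻¹' C) (f ⁻¹' D) := by
      refine ⟨⟨fun v => hCD.1 (f v), ?_⟩, ?_, ?_, ?_, ?_⟩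
      · intro x y hxy hx hx' hy
        by_cases hne : f x = f y
        · show f y ∈ C
          rw [← hne]; exact hx
        · exact hCD.2 (f x) (f y) ⟨hne, x, y, rfl, rfl, hxy⟩ hx hx' hy
      · intro i hi
        by_cases h : r i ∈ C
        · left; intro v hv
          show f v ∈ C
          rwa [hfi i hi v hv]
        · right; intro v hv hv'
          have : f v ∈ C := hv'
          rw [hfi i hi v hv] at this
          exact h this
      · intro i hi
        left; intro v hv
        show f v ∈ D
        rw [hfi i hi v hv]
        exact hRD ⟨i, hi, rfl⟩
      · intro s hs
        show f s ∈ C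
        rw [hfS s hs]; exact hSC hs
      · intro i hi v hv
        show f v ∈ D
        rw [hfi i hi v hv]
        exact hRD ⟨i, hi, rfl⟩
    refine (hQ _ _ h1).trans (Set.ncard_le_ncard ?_)
    rintro v ⟨⟨hv1, hv2⟩, hv3⟩
    have h2 : f v = v := ctr_fx hdQ hv3
    have hv1' : f v ∈ C := hv1
    have hv2' : f v ∈ D := hv2
    rw [h2] at hv1' hv2'
    exact ⟨hv1', hv2'⟩)
  choose! h1 h2 ω h3 h4 using hP
  -- fibres
  have hfib : ∀ (s : V) (a : V), f a ∈ P s → Reach L (f ⁻¹' P s) a (f a) := by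
    intro s a ha
    by_cases h : ∃ i, i ∈ Q ∧ a ∈ q i
    · obtain ⟨i, hi, hai⟩ := h
      rw [hfi i hi a hai] at ha ⊢
      refine ((hconn i (hQI hi)).2 a hai _ (hrQ i hi)).mono le_rfl ?_
      intro v hv
      show f v ∈ P s
      rwa [hfi i hi v hv]
    · have : f a = a := ctr_of_not h
      rw [this]; exact Reach.refl _ _ _
  refine ⟨fun s => f ⁻¹' P s, ?_, ?_, ?_⟩
  · intro s hs
    have hs' : s ∈ f ⁻¹' P s := by
      show f s ∈ P s
      rw [hfS s hs]; exact h1 s hs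
    refine ⟨hs', Conn.of_root hs' ?_⟩
    intro x hx
    refine (hfib s x hx).trans ?_
    refine ((h2 s hs).2 (f x) hx s (h1 s hs)).mono' ?_
    rintro u hu v hv ⟨_, a, b, hau, hbv, hab⟩
    have e1 := hfib s a (by rw [hau]; exact hu)
    have e2 := hfib s b (by rw [hbv]; exact hv)
    rw [hau] at e1
    rw [hbv] at e2
    refine e1.symm.trans (Reach.trans (Reach.single hab ?_ ?_) e2)
    · show f a ∈ P s
      rw [hau]; exact hu
    · show f b ∈ P s
      rw [hbv]; exact hv
  · intro s hs s' hs' hne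
    exact Set.disjoint_left.2 fun v hv hv' => Set.disjoint_left.1 (hPd s hs s' hs' hne) hv hv'
  · intro s hs s' hs' hne
    obtain ⟨i, hi, hir⟩ := h4 s hs
    obtain ⟨i', hi', hir'⟩ := h4 s' hs'
    have hii : i ≠ i' := by
      intro h
      apply Set.disjoint_left.1 (hPd s hs s' hs' hne) (h3 s hs)
      rw [← hir, h, hir']
      exact h3 s' hs'
    obtain ⟨x, hx, y, hy, hxy⟩ := hadj i (hQI hi) i' (hQI hi') hii
    refine ⟨x, ?_, y, ?_, hxy⟩
    · show f x ∈ P s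
      rw [hfi i hi x hx, hir]; exact h3 s hs
    · show f y ∈ P s'
      rw [hfi i' hi' y hy, hir']; exact h3 s' hs'

end rooted





section P8
variable {V : Type}

open Classical in
theorem card_meet [Finite V] {N : ℕ} {ρ : Fin N → Set V}
    (hd : ∀ i j, i ≠ j → Disjoint (ρ i) (ρ j)) (K : Set V) :
    (Finset.univ.filter fun i => ¬ Disjoint (ρ i) K).card ≤ K.ncard := by
  have h : ∀ i, ¬ Disjoint (ρ i) K → ∃ v, v ∈ ρ i ∧ v ∈ K := fun i => Set.not_disjoint_iff.1
  rcases isEmpty_or_nonempty V with hV | hV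
  · rw [Finset.filter_false_of_mem]
    · simp
    · intro i _ hi
      exact hV.elim (h i hi).choose
  choose! g hg hg' using h
  have hinj : Set.InjOn g ((Finset.univ.filter fun i => ¬ Disjoint (ρ i) K : Finset (Fin N)) : Set (Fin N)) := by
    intro i hi j hj hij
    simp only [Finset.coe_filter, Finset.mem_univ, true_and, Set.mem_ofPred_eq] at hi hj
    by_contra hne
    exact Set.disjoint_left.1 (hd i j hne) (hg i hi) (hij ▸ hg j hj)
  rw [← Set.ncard_coe_finset, ← hinj.ncard_image]
  refine Set.ncard_le_ncard ?_
  rintro _ ⟨i, hi, rfl⟩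
  simp only [Finset.coe_filter, Finset.mem_univ, true_and, Set.mem_ofPred_eq] at hi
  exact hg' i hi

theorem exists_avoid [Finite V] {N : ℕ} {ρ : Fin N → Set V}
    (hd : ∀ i j, i ≠ j → Disjoint (ρ i) (ρ j)) (K : Set V) (hK : K.ncard < N) :
    ∃ i, ∀ v ∈ ρ i, v ∉ K := by
  classical
  by_contra hcon
  push Not at hcon
  have h := card_meet hd K
  rw [Finset.filter_true_of_mem (by
    intro i _
    obtain ⟨v, hv, hvK⟩ := hcon i
    exact Set.not_disjoint_iff.2 ⟨v, hv, hvK⟩)] at h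
  simp at h
  omega

/-- small separations -/
def TS (J : SimpleGraph V) (Y : Set V) (m : ℕ) (A B : Set V) : Prop :=
  IsSep J A B ∧ (A ∩ B).ncard < m ∧ (Y ∩ (A \ B)).ncard ≤ m

/-- every model is separated -/
def I2 (J : SimpleGraph V) (Y : Set V) (m N : ℕ) : Prop :=
  ∀ ρ : Fin N → Set V, KModel J N ρ → ∃ A B i, TS J Y m A B ∧ ∀ v ∈ ρ i, v ∈ A ∧ v ∉ B

theorem TS.sub [Finite V] {J : SimpleGraph V} {Y : Set V} {m : ℕ} {A B A' B' : Set V}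
    (h : TS J Y m A B) {J' : SimpleGraph V} (hs : IsSep J' A' B') (ho : (A' ∩ B').ncard < m)
    (hsub : ∀ v, v ∈ A' → v ∉ B' → v ∈ A ∧ v ∉ B) : TS J' Y m A' B' :=
  ⟨hs, ho, (Set.ncard_le_ncard (t := Y ∩ (A \ B))
    (fun v hv => ⟨hv.1, hsub v hv.2.1 hv.2.2⟩)).trans h.2.2⟩

theorem TS.union [Finite V] {J : SimpleGraph V} {Y : Set V} {m : ℕ} {A B A' B' : Set V}
    (hY : Y.ncard = 5 * m)
    (hbal : ∀ A B, IsSep J A B → (A ∩ B).ncard < m → (Y ∩ (A \ B)).ncard ≤ m ∨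
      (Y ∩ (B \ A)).ncard ≤ m)
    (h : TS J Y m A B) (h' : TS J Y m A' B') (ho : ((A ∪ A') ∩ (B ∩ B')).ncard < m) :
    TS J Y m (A ∪ A') (B ∩ B') := by
  have hs := h.1.union_inter h'.1
  refine ⟨hs, ho, (hbal _ _ hs ho).resolve_right fun h1 => ?_⟩
  have hsub : Y ⊆ (((Y ∩ (A \ B)) ∪ (Y ∩ (A' \ B'))) ∪ ((A ∪ A') ∩ (B ∩ B'))) ∪
      (Y ∩ ((B ∩ B') \ (A ∪ A'))) := by
    intro v hv
    have a1 := h.1.1 v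
    have a2 := h'.1.1 v
    simp only [Set.mem_union, Set.mem_inter_iff, Set.mem_sdiff]
    tauto
  have h2 := Set.ncard_le_ncard hsub
  have h3 := Set.ncard_union_le (((Y ∩ (A \ B)) ∪ (Y ∩ (A' \ B'))) ∪ ((A ∪ A') ∩ (B ∩ B')))
    (Y ∩ ((B ∩ B') \ (A ∪ A')))
  have h4 := Set.ncard_union_le ((Y ∩ (A \ B)) ∪ (Y ∩ (A' \ B'))) ((A ∪ A') ∩ (B ∩ B'))
  have h5 := Set.ncard_union_le (Y ∩ (A \ B)) (Y ∩ (A' \ B'))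
  have h6 := h.2.2
  have h7 := h'.2.2
  omega

/-- adding a clique -/
def addCl (J : SimpleGraph V) (S : Set V) : SimpleGraph V where
  Adj x y := J.Adj x y ∨ (x ≠ y ∧ x ∈ S ∧ y ∈ S)
  symm := ⟨fun _ _ h => h.elim (fun h => Or.inl h.symm) fun h => Or.inr ⟨h.1.symm, h.2.2, h.2.1⟩⟩
  loopless := ⟨fun _ h => h.elim (fun h => J.loopless.irrefl _ h) fun h => h.1 rfl⟩

theorem IsSep.addCl {J : SimpleGraph V} {S A B : Set V} (h : IsSep J A B) (hS : S ⊆ A) :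
    IsSep (addCl J S) A B := by
  refine ⟨h.1, ?_⟩
  rintro x y (hxy | hxy) hx hx' hy
  · exact h.2 x y hxy hx hx' hy
  · exact hS hxy.2.2

/-- models adjacent to a branch on the left avoiding the cut lie on the left -/
theorem IsSep.model_side {J : SimpleGraph V} {A B : Set V} (h : IsSep J A B) {N : ℕ}
    {ρ : Fin N → Set V} (hρ : KModel J N ρ) {i j : Fin N} (hi : ∀ v ∈ ρ i, v ∈ A ∧ v ∉ B)
    (hj : ∀ v ∈ ρ j, ¬ (v ∈ A ∧ v ∈ B)) : ∀ v ∈ ρ j, v ∈ A ∧ v ∉ B := by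
  by_cases hij : i = j
  · subst hij; exact hi
  rcases h.conn_side (hρ.conn j) hj with h1 | h1
  · exact h1
  · obtain ⟨x, hx, y, hy, hxy⟩ := hρ.adj i j hij
    exact absurd (h.2 x y hxy (hi x hx).1 (hi x hx).2 (h1 y hy).1) (h1 y hy).2

/-- lifting a model through a rooted clique -/
theorem lift_model {J : SimpleGraph V} {A B : Set V} (hs : IsSep J A B) {N : ℕ}
    {ρ : Fin N → Set V} (hρ : KModel (addCl J (A ∩ B)) N ρ)
    (hB : ∀ i, ∃ v ∈ ρ i, v ∈ B) (P : V → Set V)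
    (hP : ∀ s ∈ A ∩ B, s ∈ P s ∧ Conn J (P s)) (hPA : ∀ s ∈ A ∩ B, P s ⊆ A)
    (hPd : ∀ s ∈ A ∩ B, ∀ s' ∈ A ∩ B, s ≠ s' → Disjoint (P s) (P s'))
    (hPa : ∀ s ∈ A ∩ B, ∀ s' ∈ A ∩ B, s ≠ s' → ∃ x ∈ P s, ∃ y ∈ P s', J.Adj x y) :
    KModel J N (fun i => (ρ i ∩ B) ∪ {v | ∃ s ∈ A ∩ B, s ∈ ρ i ∧ v ∈ P s}) := by
  have hs' : IsSep (addCl J (A ∩ B)) A B := hs.addCl Set.inter_subset_left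
  have hmeet : ∀ i, ∀ v ∈ ρ i, v ∈ A → ∃ s ∈ A ∩ B, s ∈ ρ i := by
    intro i v hv hvA
    by_contra hno
    push Not at hno
    rcases hs'.conn_side (hρ.conn i) fun w hw hw' => hno w hw' hw with h | h
    · obtain ⟨w, hw, hwB⟩ := hB i
      exact (h w hw).2 hwB
    · exact (h v hv).2 hvA
  have hmut : ∀ i, ∀ s ∈ A ∩ B, s ∈ ρ i → ∀ s' ∈ A ∩ B, s' ∈ ρ i →
      Reach J ((ρ i ∩ B) ∪ {v | ∃ s ∈ A ∩ B, s ∈ ρ i ∧ v ∈ P s}) s s' := by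
    intro i s hsS hsi s' hsS' hsi'
    by_cases hne : s = s'
    · subst hne; exact Reach.refl _ _ _
    obtain ⟨x, hx, y, hy, hxy⟩ := hPa s hsS s' hsS' hne
    have c1 : P s ⊆ (ρ i ∩ B) ∪ {v | ∃ s ∈ A ∩ B, s ∈ ρ i ∧ v ∈ P s} :=
      fun v hv => Or.inr ⟨s, hsS, hsi, hv⟩
    have c2 : P s' ⊆ (ρ i ∩ B) ∪ {v | ∃ s ∈ A ∩ B, s ∈ ρ i ∧ v ∈ P s} :=
      fun v hv => Or.inr ⟨s', hsS', hsi', hv⟩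
    exact (((hP s hsS).2.2 s (hP s hsS).1 x hx).mono le_rfl c1).trans
      ((Reach.single hxy (c1 hx) (c2 hy)).trans
        (((hP s' hsS').2.2 y hy s' (hP s' hsS').1).mono le_rfl c2))
  refine ⟨fun i => ?_, fun i j hij => ?_, fun i j hij => ?_⟩
  · obtain ⟨x, hx, hxB⟩ := hB i
    have key : ∀ y ∈ ρ i, y ∈ B →
        Reach J ((ρ i ∩ B) ∪ {v | ∃ s ∈ A ∩ B, s ∈ ρ i ∧ v ∈ P s}) x y := by
      intro y hy hyB
      have := ((hρ.conn i).2 x hx y hy).invariant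
        (P := {v | (v ∈ B → Reach J ((ρ i ∩ B) ∪ {v | ∃ s ∈ A ∩ B, s ∈ ρ i ∧ v ∈ P s}) x v) ∧
          (v ∉ B → ∃ s ∈ A ∩ B, s ∈ ρ i ∧
            Reach J ((ρ i ∩ B) ∪ {v | ∃ s ∈ A ∩ B, s ∈ ρ i ∧ v ∈ P s}) x s)})
        ⟨fun _ => Reach.refl _ _ _, fun h => absurd hxB h⟩ (by
          rintro a b hab ha hb ⟨h1, h2⟩
          refine ⟨fun hbB => ?_, fun hbB => ?_⟩
          · by_cases haB : a ∈ B
            · rcases hab with hab | hab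
              · exact (h1 haB).trans (Reach.single hab (Or.inl ⟨ha, haB⟩) (Or.inl ⟨hb, hbB⟩))
              · exact (h1 haB).trans (hmut i a hab.2.1 ha b hab.2.2 hb)
            · obtain ⟨s, hsS, hsi, hr⟩ := h2 haB
              have haA := (hs.1 a).resolve_right haB
              have hbA : b ∈ A := hs'.2 a b hab haA haB hbB
              exact hr.trans (hmut i s hsS hsi b ⟨hbA, hbB⟩ hb)
          · by_cases haB : a ∈ B
            · have hbA := (hs.1 b).resolve_right hbB
              have haA : a ∈ A := hs'.2 b a hab.symm hbA hbB haB
              exact ⟨a, ⟨haA, haB⟩, ha, h1 haB⟩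
            · exact h2 haB)
      exact this.1 hyB
    refine Conn.of_root (r := x) (Or.inl ⟨hx, hxB⟩) ?_
    rintro z (hz | ⟨s, hsS, hsi, hz⟩)
    · exact (key z hz.1 hz.2).symm
    · refine Reach.trans ?_ (key s hsi hsS.2).symm
      exact ((hP s hsS).2.2 z hz s (hP s hsS).1).mono le_rfl fun v hv => Or.inr ⟨s, hsS, hsi, hv⟩
  · have hdij := hρ.disj i j hij
    have mixed : ∀ i j, Disjoint (ρ i) (ρ j) → ∀ v ∈ ρ i ∩ B, ∀ s ∈ A ∩ B, s ∈ ρ j → v ∉ P s := by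
      intro i j hd v hv s hsS hsj hvP
      have hvS : v ∈ A ∩ B := ⟨hPA s hsS hvP, hv.2⟩
      by_cases hne : v = s
      · subst hne
        exact Set.disjoint_left.1 hd hv.1 hsj
      · exact Set.disjoint_left.1 (hPd v hvS s hsS hne) (hP v hvS).1 hvP
    refine Set.disjoint_left.2 fun v hv hv' => ?_
    rcases hv with hv | ⟨s, hsS, hsi, hv⟩ <;> rcases hv' with hv' | ⟨s', hsS', hsi', hv'⟩
    · exact Set.disjoint_left.1 hdij hv.1 hv'.1
    · exact mixed i j hdij v hv s' hsS' hsi' hv'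
    · exact mixed j i hdij.symm v hv' s hsS hsi hv
    · by_cases hne : s = s'
      · subst hne
        exact Set.disjoint_left.1 hdij hsi hsi'
      · exact Set.disjoint_left.1 (hPd s hsS s' hsS' hne) hv hv'
  · obtain ⟨x, hx, y, hy, hxy⟩ := hρ.adj i j hij
    have bothA : x ∈ A → y ∈ A → ∃ x ∈ (ρ i ∩ B) ∪ {v | ∃ s ∈ A ∩ B, s ∈ ρ i ∧ v ∈ P s},
        ∃ y ∈ (ρ j ∩ B) ∪ {v | ∃ s ∈ A ∩ B, s ∈ ρ j ∧ v ∈ P s}, J.Adj x y := by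
      intro hxA hyA
      obtain ⟨s, hsS, hsi⟩ := hmeet i x hx hxA
      obtain ⟨s', hsS', hsj⟩ := hmeet j y hy hyA
      have hne : s ≠ s' := by
        rintro rfl
        exact Set.disjoint_left.1 (hρ.disj i j hij) hsi hsj
      obtain ⟨a, ha, b, hb, hab⟩ := hPa s hsS s' hsS' hne
      exact ⟨a, Or.inr ⟨s, hsS, hsi, ha⟩, b, Or.inr ⟨s', hsS', hsj, hb⟩, hab⟩
    by_cases hxA : x ∈ A
    · by_cases hyA : y ∈ A
      · exact bothA hxA hyA
      · have hyB := (hs.1 y).resolve_left hyA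
        have hxB : x ∈ B := hs'.symm.2 y x hxy.symm hyB hyA hxA
        rcases hxy with hxy | hxy
        · exact ⟨x, Or.inl ⟨hx, hxB⟩, y, Or.inl ⟨hy, hyB⟩, hxy⟩
        · exact absurd hxy.2.2.1 hyA
    · have hxB := (hs.1 x).resolve_left hxA
      have hyB : y ∈ B := by
        rcases hs.1 y with h | h
        · exact hs'.symm.2 x y hxy hxB hxA h
        · exact h
      rcases hxy with hxy | hxy
      · exact ⟨x, Or.inl ⟨hx, hxB⟩, y, Or.inl ⟨hy, hyB⟩, hxy⟩
      · exact absurd hxy.2.1.1 hxA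

/-- the core of an edge-maximal completion has no large clique minor -/
theorem no_core_model [Finite V] {J : SimpleGraph V} {Y : Set V} {m N : ℕ}
    (hN : m * m + 2 * m + 1 ≤ N) (hY : Y.ncard = 5 * m)
    (hbal : ∀ A B, IsSep J A B → (A ∩ B).ncard < m → (Y ∩ (A \ B)).ncard ≤ m ∨
      (Y ∩ (B \ A)).ncard ≤ m)
    (hI : I2 J Y m N) (hmax : ∀ J', J ≤ J' → I2 J' Y m N → J' ≤ J) {μ : Fin N → Set V}
    (hμ : KModel J N μ)
    (hW : ∀ i, ∀ v ∈ μ i, ∀ A B, TS J Y m A B → J.IsClique (A ∩ B) → v ∈ A → v ∈ B) : False := by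
  classical
  -- a minimum separation
  let F : Set ℕ := {t | ∃ A B i, TS J Y m A B ∧ (∀ v ∈ μ i, v ∈ A ∧ v ∉ B) ∧ (A ∩ B).ncard = t}
  have hF : F.Nonempty := by
    obtain ⟨A, B, i, h1, h2⟩ := hI μ hμ
    exact ⟨_, A, B, i, h1, h2, rfl⟩
  obtain ⟨A, B, b0, hT, hb0, ht⟩ := Nat.sInf_mem hF
  have hmin : ∀ A' B' i, TS J Y m A' B' → (∀ v ∈ μ i, v ∈ A' ∧ v ∉ B') →
      (A ∩ B).ncard ≤ (A' ∩ B').ncard := by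
    intro A' B' i h1 h2
    rw [ht]
    exact Nat.sInf_le ⟨A', B', i, h1, h2, rfl⟩
  have hs := hT.1
  have htm := hT.2.1
  have hncl : ¬ J.IsClique (A ∩ B) := by
    intro hcl
    obtain ⟨v, hv⟩ := (hμ.conn b0).1
    exact (hb0 v hv).2 (hW b0 v hv A B hT hcl (hb0 v hv).1)
  -- rooted clique
  let I : Finset (Fin N) := Finset.univ.filter fun i => ∀ v ∈ μ i, v ∈ A ∧ v ∉ B
  have hImem : ∀ i ∈ I, ∀ v ∈ μ i, v ∈ A ∧ v ∉ B := fun i hi => (Finset.mem_filter.1 hi).2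
  have hIc : N ≤ I.card + (A ∩ B).ncard := by
    have h1 := card_meet hμ.disj (A ∩ B)
    have h2 : (Finset.univ : Finset (Fin N)) ⊆
        I ∪ Finset.univ.filter fun i => ¬ Disjoint (μ i) (A ∩ B) := by
      intro i _
      by_cases h : Disjoint (μ i) (A ∩ B)
      · refine Finset.mem_union_left _ (Finset.mem_filter.2 ⟨Finset.mem_univ _, ?_⟩)
        exact hs.model_side hμ hb0 fun v hv hv' => Set.disjoint_left.1 h hv hv'
      · exact Finset.mem_union_right _ (Finset.mem_filter.2 ⟨Finset.mem_univ _, h⟩)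
    have h3 := (Finset.card_le_card h2).trans (Finset.card_union_le _ _)
    simp only [Finset.card_univ, Fintype.card_fin] at h3
    omega
  have hsq : (A ∩ B).ncard * (A ∩ B).ncard ≤ m * m := Nat.mul_le_mul htm.le htm.le
  obtain ⟨P, hP1, hPd, hPa⟩ := rooted_clique (resG J A) (A ∩ B) μ I
    (fun i hi => conn_resG (hμ.conn i) fun v hv => (hImem i hi v hv).1)
    (fun i _ j _ hij => hμ.disj i j hij)
    (fun i hi j hj hij => by
      obtain ⟨x, hx, y, hy, hxy⟩ := hμ.adj i j hij
      exact ⟨x, hx, y, hy, hxy, (hImem i hi x hx).1, (hImem j hj y hy).1⟩)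
    (fun i hi => Set.disjoint_left.2 fun v hv hv' => (hImem i hi v hv).2 hv'.2)
    (by omega)
    (by
      intro C D hCD hSC i hi hiD
      by_contra hcon
      push Not at hcon
      have hsub : (D ∩ A) ∩ (C ∪ B) ⊆ C ∩ D := by
        rintro v ⟨⟨h1, h2⟩, h3 | h3⟩
        · exact ⟨h3, h1⟩
        · exact ⟨hSC ⟨h2, h3⟩, h1⟩
      have hle := Set.ncard_le_ncard hsub
      have hsep : IsSep J (D ∩ A) (C ∪ B) := by
        refine ⟨fun v => ?_, ?_⟩
        · have a1 := hCD.1 v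
          have a2 := hs.1 v
          simp only [Set.mem_union, Set.mem_inter_iff]
          tauto
        · rintro x y hxy ⟨hxD, hxA⟩ hx _
          simp only [Set.mem_union, not_or] at hx
          have hyA : y ∈ A := (hs.1 y).elim id fun h => hs.2 x y hxy hxA hx.2 h
          exact ⟨(hCD.1 y).elim (fun h => hCD.symm.2 x y ⟨hxy, hxA, hyA⟩ hxD hx.1 h) id, hyA⟩
      have hT' : TS J Y m (D ∩ A) (C ∪ B) := hT.sub hsep (by omega) fun v hv hv' =>
        ⟨hv.2, fun h => hv' (Or.inr h)⟩
      have := hmin _ _ i hT' fun v hv => ⟨⟨(hiD v hv).1, (hImem i hi v hv).1⟩, by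
        simp only [Set.mem_union, not_or]
        exact ⟨(hiD v hv).2, (hImem i hi v hv).2⟩⟩
      omega)
  have hPA : ∀ s ∈ A ∩ B, P s ⊆ A := fun s hs => conn_resG_subset (hP1 s hs).2 (hP1 s hs).1 hs.1
  -- the completed graph
  apply hncl
  have hle : J ≤ addCl J (A ∩ B) := fun x y h => Or.inl h
  suffices h : I2 (addCl J (A ∩ B)) Y m N by
    intro x hx y hy hxy
    exact hmax _ hle h (Or.inr ⟨hxy, hx, hy⟩)
  intro ρ hρ
  have hs' : IsSep (addCl J (A ∩ B)) A B := hs.addCl Set.inter_subset_left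
  by_cases hex : ∃ i, ∀ v ∈ ρ i, v ∈ A ∧ v ∉ B
  · obtain ⟨i, hi⟩ := hex
    exact ⟨A, B, i, ⟨hs', hT.2⟩, hi⟩
  push Not at hex
  have hB : ∀ i, ∃ v ∈ ρ i, v ∈ B := by
    intro i
    obtain ⟨v, hv, hv'⟩ := hex i
    exact ⟨v, hv, (hs.1 v).elim hv' id⟩
  have hlift := lift_model hs hρ hB P
    (fun s hs => ⟨(hP1 s hs).1, (hP1 s hs).2.mono (resG_le _ _)⟩) hPA hPd
    (fun s hs s' hs' hne => by
      obtain ⟨x, hx, y, hy, hxy⟩ := hPa s hs s' hs' hne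
      exact ⟨x, hx, y, hy, hxy.1⟩)
  obtain ⟨A', B', i, hT', hi⟩ := hI _ hlift
  have htm' := hT'.2.1
  have hcut : ((A ∩ B) ∪ (A' ∩ B')).ncard < N := by
    have := Set.ncard_union_le (A ∩ B) (A' ∩ B')
    nlinarith
  obtain ⟨j, hj⟩ := exists_avoid hρ.disj _ hcut
  simp only [Set.mem_union, not_or] at hj
  have hjB : ∀ v ∈ ρ j, v ∈ B ∧ v ∉ A := by
    rcases hs'.conn_side (hρ.conn j) fun v hv => (hj v hv).1 with h | h
    · obtain ⟨v, hv, hvB⟩ := hB j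
      exact absurd hvB (h v hv).2
    · exact h
  have hjA' : ∀ v ∈ ρ j, v ∈ A' ∧ v ∉ B' := by
    have h := hT'.1.model_side hlift hi (j := j) (by
      rintro v (hv | ⟨s, hsS, hsj, _⟩)
      · exact (hj v hv.1).2
      · exact absurd hsS (hj s hsj).1)
    intro v hv
    exact h v (Or.inl ⟨hv, (hjB v hv).1⟩)
  obtain ⟨b, hb⟩ := exists_avoid hμ.disj _ hcut
  simp only [Set.mem_union, not_or] at hb
  have hbA : ∀ v ∈ μ b, v ∈ A ∧ v ∉ B := hs.model_side hμ hb0 fun v hv => (hb v hv).1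
  rcases hT'.1.conn_side (hμ.conn b) fun v hv => (hb v hv).2 with hb' | hb'
  · -- uncrossing, first kind
    have hsm := ncard_submod (X := (A ∩ A') ∩ (B ∪ B')) (Y := (A ∪ A') ∩ (B ∩ B')) (P := A ∩ B)
      (P' := A' ∩ B') (by intro v; simp only [Set.mem_union, Set.mem_inter_iff]; tauto)
      (by intro v; simp only [Set.mem_union, Set.mem_inter_iff]; tauto)
    have hge : (A ∩ B).ncard ≤ ((A ∩ A') ∩ (B ∪ B')).ncard := by
      by_contra hcon
      push Not at hcon
      have hT2 : TS J Y m (A ∩ A') (B ∪ B') := hT.sub (hs.inter_union hT'.1) (by omega)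
        fun v hv hv' => ⟨hv.1, fun h => hv' (Or.inl h)⟩
      have := hmin _ _ b hT2 fun v hv => ⟨⟨(hbA v hv).1, (hb' v hv).1⟩, by
        simp only [Set.mem_union, not_or]
        exact ⟨(hbA v hv).2, (hb' v hv).2⟩⟩
      omega
    have hT3 := hT.union hY hbal hT' (by omega)
    refine ⟨A ∪ A', B ∩ B', j, ⟨hT3.1.addCl fun v hv => Or.inl hv.1, hT3.2⟩, fun v hv => ?_⟩
    exact ⟨Or.inr (hjA' v hv).1, fun h => (hjA' v hv).2 h.2⟩
  · have hsm := ncard_submod (X := (A ∩ B') ∩ (B ∪ A')) (Y := (B ∩ A') ∩ (A ∪ B')) (P := A ∩ B)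
      (P' := A' ∩ B') (by intro v; simp only [Set.mem_union, Set.mem_inter_iff]; tauto)
      (by intro v; simp only [Set.mem_union, Set.mem_inter_iff]; tauto)
    have hge : (A ∩ B).ncard ≤ ((A ∩ B') ∩ (B ∪ A')).ncard := by
      by_contra hcon
      push Not at hcon
      have hT2 : TS J Y m (A ∩ B') (B ∪ A') := hT.sub (hs.inter_union hT'.1.symm) (by omega)
        fun v hv hv' => ⟨hv.1, fun h => hv' (Or.inl h)⟩
      have := hmin _ _ b hT2 fun v hv => ⟨⟨(hbA v hv).1, (hb' v hv).1⟩, by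
        simp only [Set.mem_union, not_or]
        exact ⟨(hbA v hv).2, (hb' v hv).2⟩⟩
      omega
    have hsep3 : IsSep (addCl J (A ∩ B)) (B ∩ A') (A ∪ B') :=
      ((hs.union_inter hT'.1.symm).addCl fun v hv => Or.inl hv.1).symm
    refine ⟨B ∩ A', A ∪ B', j, hT'.sub hsep3 (by omega) fun v hv hv' =>
      ⟨hv.2, fun h => hv' (Or.inr h)⟩, fun v hv => ?_⟩
    refine ⟨⟨(hjB v hv).1, (hjA' v hv).1⟩, ?_⟩
    simp only [Set.mem_union, not_or]
    exact ⟨(hjB v hv).2, (hjA' v hv).2⟩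

end P8





section step
variable {V : Type}

/-- component outside `K` -/
def cmp (G : SimpleGraph V) (K : Set V) (v : V) : Set V := {w | Reach G Kᶜ v w}

/-- neighbourhood of a set -/
def Nb (G : SimpleGraph V) (D : Set V) : Set V := {w | w ∉ D ∧ ∃ x ∈ D, G.Adj x w}

theorem cmp_not {G : SimpleGraph V} {K : Set V} {v w : V} (hv : v ∉ K) (hw : w ∈ cmp G K v) :
    w ∉ K := Reach.mem_of_ne (s := Kᶜ) hw hv

theorem cmp_step {G : SimpleGraph V} {K : Set V} {v x y : V} (hv : v ∉ K) (hx : x ∈ cmp G K v)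
    (hxy : G.Adj x y) (hy : y ∉ K) : y ∈ cmp G K v :=
  Reach.trans (s := Kᶜ) hx (Reach.single hxy (cmp_not hv hx) hy)

theorem Nb_cmp {G : SimpleGraph V} {K : Set V} {v : V} (hv : v ∉ K) : Nb G (cmp G K v) ⊆ K := by
  rintro w ⟨hw, x, hx, hxw⟩
  by_contra hwK
  exact hw (cmp_step hv hx hxw hwK)

theorem cmp_eq {G : SimpleGraph V} {K : Set V} {v w x : V} (hv : x ∈ cmp G K v)
    (hw : x ∈ cmp G K w) : cmp G K v = cmp G K w := by
  ext z
  constructor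
  · intro hz
    exact (Reach.trans (s := Kᶜ) hw (Reach.symm hv)).trans hz
  · intro hz
    exact (Reach.trans (s := Kᶜ) hv (Reach.symm hw)).trans hz

theorem cmp_conn {G : SimpleGraph V} {K : Set V} {v : V} (hv : v ∉ K) : Conn G (cmp G K v) := by
  refine Conn.of_root (r := v) (Reach.refl _ _ _) ?_
  intro x hx
  have : ∀ x, Reach G Kᶜ v x → Reach G (cmp G K v) v x := by
    intro x hx
    induction hx with
    | refl => exact Reach.refl _ _ _
    | @tail b c hb hbc ih => exact ih.trans (Reach.single hbc.1 hb (hb.tail hbc))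
  exact (this x hx).symm

/-- torso-like graph -/
def torG (G : SimpleGraph V) (𝓐 : Set (Set V)) : SimpleGraph V where
  Adj x y := x ≠ y ∧ (G.Adj x y ∨ ∃ M ∈ 𝓐, x ∈ M ∧ y ∈ M)
  symm := ⟨fun _ _ h => ⟨h.1.symm, h.2.imp (fun h => h.symm)
    fun ⟨M, h1, h2, h3⟩ => ⟨M, h1, h3, h2⟩⟩⟩
  loopless := ⟨fun _ h => h.1 rfl⟩

/-- good bags -/
def Good (r ξ : ℕ) (G : SimpleGraph V) (b : Set V) (𝓐 : Set (Set V)) : Prop :=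
  (∀ ρ : Fin r → Set V, (∀ i, ρ i ⊆ b) → ¬ KModel (torG G 𝓐) r ρ) ∨
  ∃ (Z : Set V) (κ : V → Bool), Z.ncard ≤ ξ ∧
    (∀ x ∈ b, x ∉ Z → ∀ y ∈ b, y ∉ Z → G.Adj x y → κ x ≠ κ y) ∧
    ∀ M ∈ 𝓐, ((M ∩ b) \ Z).ncard ≤ 1

/-- one step of the decomposition -/
structure StepOut (r ξ θ : ℕ) (G : SimpleGraph V) (Y b : Set V) (𝓡 : Set (Set V)) : Prop where
  sub : Y ⊆ b
  cover : ∀ v, v ∈ b ∨ ∃ Ω ∈ 𝓡, v ∈ Ω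
  edge : ∀ x y, G.Adj x y → (x ∈ b ∧ y ∈ b) ∨ ∃ Ω ∈ 𝓡, x ∈ Ω ∧ y ∈ Ω
  inter : ∀ Ω ∈ 𝓡, ∀ Ω' ∈ 𝓡, Ω ≠ Ω' → Ω ∩ Ω' ⊆ b
  small : ∀ Ω ∈ 𝓡, ¬ Y ⊆ Ω
  bound : ∀ Ω ∈ 𝓡, (Ω ∩ b).ncard ≤ θ
  good : Good r ξ G b (insert Y {M | ∃ Ω ∈ 𝓡, M = Ω ∩ b})

theorem stepOut_comps [Finite V] {r ξ m : ℕ} (hm : 0 < m) {G : SimpleGraph V} {Y K : Set V}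
    (hY : Y.ncard = 5 * m) (hK : ∀ v, v ∉ K → (Nb G (cmp G K v)).ncard ≤ m ∧
      (Y ∩ cmp G K v).ncard ≤ m)
    (hgood : Good r ξ G (K ∪ Y) (insert Y {M | ∃ v, v ∉ K ∧
      M = Nb G (cmp G K v) ∪ (Y ∩ cmp G K v)})) :
    StepOut r ξ (5 * m) G Y (K ∪ Y) {Ω | ∃ v, v ∉ K ∧ Ω = cmp G K v ∪ Nb G (cmp G K v)} := by
  have hYY : ∀ v, v ∉ K → (cmp G K v ∪ Nb G (cmp G K v)) ∩ (K ∪ Y) =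
      Nb G (cmp G K v) ∪ (Y ∩ cmp G K v) := by
    intro v hv
    ext w
    constructor
    · rintro ⟨h1 | h1, h2⟩
      · exact Or.inr ⟨h2.resolve_left (cmp_not hv h1), h1⟩
      · exact Or.inl h1
    · rintro (h1 | h1)
      · exact ⟨Or.inr h1, Or.inl (Nb_cmp hv h1)⟩
      · exact ⟨Or.inl h1.2, Or.inr h1.1⟩
  refine ⟨Set.subset_union_right, ?_, ?_, ?_, ?_, ?_, ?_⟩
  · intro v
    by_cases hv : v ∈ K
    · exact Or.inl (Or.inl hv)
    · exact Or.inr ⟨_, ⟨v, hv, rfl⟩, Or.inl (Reach.refl _ _ _)⟩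
  · intro x y hxy
    have key : ∀ x y, G.Adj x y → x ∉ K → ∃ Ω, (∃ v, v ∉ K ∧ Ω = cmp G K v ∪ Nb G (cmp G K v)) ∧
        x ∈ Ω ∧ y ∈ Ω := by
      intro x y hxy hx
      have hxx : x ∈ cmp G K x := Reach.refl _ _ _
      refine ⟨_, ⟨x, hx, rfl⟩, Or.inl hxx, ?_⟩
      by_cases hy : y ∈ cmp G K x
      · exact Or.inl hy
      · exact Or.inr ⟨hy, x, hxx, hxy⟩
    by_cases hx : x ∈ K
    · by_cases hy : y ∈ K
      · exact Or.inl ⟨Or.inl hx, Or.inl hy⟩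
      · obtain ⟨Ω, h1, h2, h3⟩ := key y x hxy.symm hy
        exact Or.inr ⟨Ω, h1, h3, h2⟩
    · obtain ⟨Ω, h1, h2, h3⟩ := key x y hxy hx
      exact Or.inr ⟨Ω, h1, h2, h3⟩
  · rintro _ ⟨v, hv, rfl⟩ _ ⟨w, hw, rfl⟩ hne x ⟨hx, hx'⟩
    left
    rcases hx with hx | hx
    · rcases hx' with hx' | hx'
      · exact absurd (by rw [cmp_eq hx hx']) hne
      · exact Nb_cmp hw hx'
    · exact Nb_cmp hv hx
  · rintro _ ⟨v, hv, rfl⟩ hsub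
    have h1 : Y ⊆ (Y ∩ cmp G K v) ∪ Nb G (cmp G K v) := by
      intro y hy
      rcases hsub hy with h | h
      · exact Or.inl ⟨hy, h⟩
      · exact Or.inr h
    have h2 := (Set.ncard_le_ncard h1).trans (Set.ncard_union_le _ _)
    have := hK v hv
    omega
  · rintro _ ⟨v, hv, rfl⟩
    rw [hYY v hv]
    have := Set.ncard_union_le (Nb G (cmp G K v)) (Y ∩ cmp G K v)
    have := hK v hv
    omega
  · convert hgood using 2
    ext M
    constructor
    · rintro ⟨_, ⟨v, hv, rfl⟩, rfl⟩
      exact ⟨v, hv, hYY v hv⟩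
    · rintro ⟨v, hv, rfl⟩
      exact ⟨_, ⟨v, hv, rfl⟩, (hYY v hv).symm⟩

/-- case (c) -/
theorem step_c [Finite V] {G : SimpleGraph V} {Y : Set V} {m N ξ : ℕ} (hm : 0 < m)
    (hN : m * m + 2 * m + 1 ≤ N) (hY : Y.ncard = 5 * m)
    (hbal : ∀ A B, IsSep G A B → (A ∩ B).ncard < m → (Y ∩ (A \ B)).ncard ≤ m ∨
      (Y ∩ (B \ A)).ncard ≤ m) (hI : I2 G Y m N) :
    ∃ b 𝓡, StepOut (N + 5 * m) ξ (5 * m) G Y b 𝓡 := by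
  classical
  obtain ⟨J, hJ⟩ := (Set.toFinite {J : SimpleGraph V | G ≤ J ∧ I2 J Y m N}).exists_maximal
    ⟨G, le_rfl, hI⟩
  obtain ⟨hGJ, hIJ⟩ := hJ.1
  have hmax : ∀ J', J ≤ J' → I2 J' Y m N → J' ≤ J := fun J' h1 h2 => hJ.2 ⟨hGJ.trans h1, h2⟩ h1
  have hbalJ : ∀ A B, IsSep J A B → (A ∩ B).ncard < m → (Y ∩ (A \ B)).ncard ≤ m ∨
      (Y ∩ (B \ A)).ncard ≤ m := fun A B h => hbal A B (h.mono hGJ)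
  let W : Set V := {v | ∀ A B, TS J Y m A B → J.IsClique (A ∩ B) → v ∈ A → v ∈ B}
  -- separations for vertices outside `W`
  have hout : ∀ v, v ∉ W → ∃ A B, TS J Y m A B ∧ J.IsClique (A ∩ B) ∧ v ∈ A ∧ v ∉ B ∧
      A ∩ B ⊆ W ∧ W ⊆ B := by
    intro v hv
    have hv' : ∃ A B, TS J Y m A B ∧ J.IsClique (A ∩ B) ∧ v ∈ A ∧ v ∉ B := by
      by_contra hno
      push Not at hno
      exact hv hno
    let F : Set (Set V) := {E | ∃ A B, TS J Y m A B ∧ J.IsClique (A ∩ B) ∧ v ∈ A ∧ v ∉ B ∧ E = A \ B}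
    obtain ⟨A0, B0, h0⟩ := hv'
    obtain ⟨E, hE⟩ := (Set.toFinite F).exists_maximal ⟨_, A0, B0, h0.1, h0.2.1, h0.2.2.1, h0.2.2.2, rfl⟩
    obtain ⟨A, B, hT, hcl, hvA, hvB, rfl⟩ := hE.1
    refine ⟨A, B, hT, hcl, hvA, hvB, ?_, ?_⟩
    · intro s hs
      by_contra hsW
      have hs' : ∃ A' B', TS J Y m A' B' ∧ J.IsClique (A' ∩ B') ∧ s ∈ A' ∧ s ∉ B' := by
        by_contra hno
        push Not at hno
        exact hsW hno
      obtain ⟨A', B', hT', hcl', hsA, hsB⟩ := hs'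
      have hsub : A ∩ B ⊆ A' := by
        intro x hx
        by_cases hxs : x = s
        · exact hxs ▸ hsA
        · have := hcl hs hx (Ne.symm hxs)
          exact (hT'.1.1 x).elim id fun h => hT'.1.2 s x this hsA hsB h
      have hcut : (A ∪ A') ∩ (B ∩ B') ⊆ A' ∩ B' := by
        rintro x ⟨h1 | h1, h2, h3⟩
        · exact ⟨hsub ⟨h1, h2⟩, h3⟩
        · exact ⟨h1, h3⟩
      have hT2 := hT.union hY hbalJ hT' ((Set.ncard_le_ncard hcut).trans_lt hT'.2.1)
      have hle := hE.2 (y := (A ∪ A') \ (B ∩ B')) ⟨A ∪ A', B ∩ B', hT2, hcl'.subset hcut, Or.inl hvA,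
        fun h => hvB h.1, rfl⟩ (fun x hx => ⟨Or.inl hx.1, fun h => hx.2 h.1⟩)
      exact (hle (⟨Or.inl hs.1, fun h => hsB h.2⟩ : s ∈ (A ∪ A') \ (B ∩ B'))).2 hs.2
    · intro w hw
      by_contra hwB
      exact hwB (hw A B hT hcl ((hT.1.1 w).resolve_right hwB))
  have hcomp : ∀ v, v ∉ W → (Nb G (cmp G W v)).ncard ≤ m ∧ (Y ∩ cmp G W v).ncard ≤ m ∧
      J.IsClique (Nb G (cmp G W v)) := by
    intro v hv
    obtain ⟨A, B, hT, hcl, hvA, hvB, hSW, hWB⟩ := hout v hv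
    have hD : ∀ w ∈ cmp G W v, w ∈ A ∧ w ∉ B := by
      rcases hT.1.conn_side ((cmp_conn hv).mono hGJ) fun w hw h => cmp_not hv hw (hSW h) with h | h
      · exact h
      · exact absurd hvA (h v (Reach.refl _ _ _)).2
    have hNb : Nb G (cmp G W v) ⊆ A ∩ B := by
      intro w hw
      have hwB := hWB (Nb_cmp hv hw)
      obtain ⟨_, x, hx, hxw⟩ := hw
      exact ⟨hT.1.2 x w (hGJ hxw) (hD x hx).1 (hD x hx).2 hwB, hwB⟩
    refine ⟨(Set.ncard_le_ncard hNb).trans hT.2.1.le, ?_, hcl.subset hNb⟩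
    exact (Set.ncard_le_ncard (t := Y ∩ (A \ B)) (fun w hw => ⟨hw.1, hD w hw.2⟩)).trans hT.2.2
  refine ⟨_, _, stepOut_comps hm hY (K := W) (fun v hv => ⟨(hcomp v hv).1, (hcomp v hv).2.1⟩) ?_⟩
  left
  intro ρ hρb hρ
  -- branches avoiding `Y`
  have hc := card_meet hρ.disj Y
  have hcc := Finset.card_filter_add_card_filter_not
    (s := (Finset.univ : Finset (Fin (N + 5 * m)))) (fun i => ¬ Disjoint (ρ i) Y)
  simp only [Finset.card_univ, Fintype.card_fin, not_not] at hcc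
  have hge : N ≤ (Finset.univ.filter fun i => Disjoint (ρ i) Y).card := by omega
  obtain ⟨Q, hQ, hQc⟩ := Finset.exists_subset_card_eq hge
  let e : Fin N → Fin (N + 5 * m) := fun i => Q.orderEmbOfFin hQc i
  have he : Function.Injective e := (Q.orderEmbOfFin hQc).injective
  have heQ : ∀ i, Disjoint (ρ (e i)) Y := fun i =>
    (Finset.mem_filter.1 (hQ (Finset.orderEmbOfFin_mem Q hQc i))).2
  have hW' : ∀ i, ∀ v ∈ ρ (e i), v ∈ W := fun i v hv =>
    (hρb (e i) hv).resolve_right fun h => Set.disjoint_left.1 (heQ i) hv h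
  have hadj : ∀ x y, x ∈ W → y ∈ W → x ∉ Y → y ∉ Y → (torG G (insert Y {M | ∃ v, v ∉ W ∧
      M = Nb G (cmp G W v) ∪ (Y ∩ cmp G W v)})).Adj x y → J.Adj x y := by
    rintro x y hx hy hxY hyY ⟨hne, h | ⟨M, hM | ⟨v, hv, rfl⟩, hxM, hyM⟩⟩
    · exact hGJ h
    · subst hM
      exact absurd hxM hxY
    · exact (hcomp v hv).2.2 (hxM.resolve_right fun h => hxY h.1)
        (hyM.resolve_right fun h => hyY h.1) hne
  have hnY : ∀ i, ∀ v ∈ ρ (e i), v ∉ Y := fun i v hv h => Set.disjoint_left.1 (heQ i) hv h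
  refine no_core_model hN hY hbalJ hIJ hmax (μ := fun i => ρ (e i)) ⟨fun i => ?_, ?_, ?_⟩ hW'
  · refine ⟨(hρ.conn (e i)).1, fun x hx y hy => ((hρ.conn (e i)).2 x hx y hy).mono' ?_⟩
    intro a ha b hb hab
    exact Reach.single (hadj a b (hW' i a ha) (hW' i b hb) (hnY i a ha) (hnY i b hb) hab) ha hb
  · intro i j hij
    exact hρ.disj _ _ fun h => hij (he h)
  · intro i j hij
    obtain ⟨x, hx, y, hy, hxy⟩ := hρ.adj _ _ fun h => hij (he h)
    exact ⟨x, hx, y, hy, hadj x y (hW' i x hx) (hW' j y hy) (hnY i x hx) (hnY j y hy) hxy⟩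

/-- the decomposition step -/
theorem step (l : ℕ) : ∃ m r : ℕ, 0 < m ∧ 0 < r ∧ ∀ (V : Type) [Finite V] (G : SimpleGraph V)
    (Y : Set V), ¬ OddModel G l → Y.ncard = 5 * m →
    ∃ b 𝓡, StepOut r (6 * m) (5 * m) G Y b 𝓡 := by
  classical
  obtain ⟨N0, hN0⟩ := local_lemma l
  let m := 12 * l + 3
  let N := N0 + (m * m + 2 * m + 1)
  have hm : 0 < m := by simp [m]
  refine ⟨m, N + 5 * m, hm, by omega, ?_⟩
  intro V _ G Y hodd hY
  by_cases hbal : ∀ A B, IsSep G A B → (A ∩ B).ncard < m → (Y ∩ (A \ B)).ncard ≤ m ∨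
      (Y ∩ (B \ A)).ncard ≤ m
  · by_cases hI : I2 G Y m N
    · exact step_c hm (by omega) hY hbal hI
    · unfold I2 at hI
      push Not at hI
      obtain ⟨ρ, hρ, hnT⟩ := hI
      obtain ⟨X, U, κ, hX, hUX, hκ, hU, hD⟩ := (hN0 N (by omega) V G ρ hρ).resolve_left hodd
      have hS1 : ∀ v, v ∉ X ∪ U → (Nb G (cmp G (X ∪ U) v) ∩ U).ncard ≤ 1 := by
        intro v hv
        rw [Set.ncard_le_one]
        rintro u ⟨⟨_, x, hx, hxu⟩, hu⟩ u' ⟨⟨_, x', hx', hxu'⟩, hu'⟩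
        exact hU u hu u' hu' x x' hxu.symm hxu'.symm (cmp_not hv hx) (Reach.trans (Reach.symm hx) hx')
      have hNsub : ∀ v, v ∉ X ∪ U → Nb G (cmp G (X ∪ U) v) ⊆
          X ∪ (Nb G (cmp G (X ∪ U) v) ∩ U) := by
        intro v hv w hw
        rcases Nb_cmp hv hw with h | h
        · exact Or.inl h
        · exact Or.inr ⟨hw, h⟩
      refine ⟨_, _, stepOut_comps hm hY (K := X ∪ U) ?_ ?_⟩
      · intro v hv
        have hXS := Set.ncard_union_le X (Nb G (cmp G (X ∪ U) v) ∩ U)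
        have h1 := hS1 v hv
        refine ⟨?_, ?_⟩
        · have := Set.ncard_le_ncard (hNsub v hv)
          omega
        · obtain ⟨i, hi⟩ := hD (cmp G (X ∪ U) v) (Nb G (cmp G (X ∪ U) v) ∩ U) h1
            (fun w hw => cmp_not hv hw) (by
              intro x hx y hxy
              by_cases hy : y ∈ cmp G (X ∪ U) v
              · exact Or.inl hy
              · exact Or.inr (hNsub v hv ⟨hy, x, hx, hxy⟩))
          set D := cmp G (X ∪ U) v with hDdef
          set S := Nb G D ∩ U with hSdef
          have hsep : IsSep G Dᶜ (D ∪ (X ∪ S)) := by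
            refine ⟨fun w => ?_, ?_⟩
            · by_cases hw : w ∈ D
              · exact Or.inr (Or.inl hw)
              · exact Or.inl hw
            · intro x y hxy hx hx' hy hyD
              apply hx'
              right
              exact hNsub v hv ⟨hx, y, hyD, hxy.symm⟩
          have hcutsub : Dᶜ ∩ (D ∪ (X ∪ S)) ⊆ X ∪ S := by
            rintro w ⟨hw, hw' | hw'⟩
            · exact absurd hw' hw
            · exact hw'
          have hcut : (Dᶜ ∩ (D ∪ (X ∪ S))).ncard < m := by
            have := Set.ncard_le_ncard hcutsub
            omega
          have hbig : m < (Y ∩ (Dᶜ \ (D ∪ (X ∪ S)))).ncard := by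
            by_contra hcon
            push Not at hcon
            obtain ⟨w, hw, hw'⟩ := hnT _ _ i ⟨hsep, hcut, hcon⟩
            have hnot : w ∉ D ∪ (X ∪ S) := fun h => Set.disjoint_left.1 hi hw h
            exact hnot (hw' fun h => hnot (Or.inl h))
          have := (hbal _ _ hsep hcut).resolve_left (by omega)
          refine le_trans (Set.ncard_le_ncard ?_) this
          rintro w ⟨hw1, hw2⟩
          exact ⟨hw1, Or.inl hw2, fun h => h hw2⟩
      · right
        refine ⟨X ∪ Y, κ, ?_, ?_, ?_⟩
        · have := Set.ncard_union_le X Y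
          omega
        · intro x hx hxZ y hy hyZ hxy
          have mem : ∀ x, x ∈ X ∪ U ∪ Y → x ∉ X ∪ Y → x ∈ U := by
            intro x hx hx'
            simp only [Set.mem_union, not_or] at hx hx'
            tauto
          exact hκ x (mem x hx hxZ) y (mem y hy hyZ) hxy
        · rintro M (rfl | ⟨v, hv, rfl⟩)
          · have : (M ∩ (X ∪ U ∪ M)) \ (X ∪ M) = ∅ := by
              ext w
              simp only [Set.mem_sdiff, Set.mem_inter_iff, Set.mem_union, Set.mem_empty_iff_false]
              tauto
            rw [this]; simp
          · refine le_trans (Set.ncard_le_ncard ?_) (hS1 v hv)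
            rintro w ⟨⟨hw, _⟩, hwZ⟩
            simp only [Set.mem_union, not_or] at hwZ
            rcases hw with hw | hw
            · exact ⟨hw, (Nb_cmp hv hw).resolve_left hwZ.1⟩
            · exact absurd hw.1 hwZ.2
  · push Not at hbal
    obtain ⟨A, B, hs, ho, hA, hB⟩ := hbal
    have hcl : ∀ A B : Set V, (A ∩ B).ncard < m → m < (Y ∩ (B \ A)).ncard →
        ¬ Y ⊆ A ∧ (A ∩ (Y ∪ (A ∩ B))).ncard ≤ 5 * m := by
      intro A B ho hB
      have h1 : (Y ∩ A).ncard + (Y ∩ (B \ A)).ncard ≤ Y.ncard := by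
        rw [← Set.ncard_union_eq]
        · exact Set.ncard_le_ncard (Set.union_subset Set.inter_subset_left Set.inter_subset_left)
        · exact Set.disjoint_left.2 fun v hv hv' => hv'.2.2 hv.2
      refine ⟨fun h => ?_, ?_⟩
      · rw [Set.inter_eq_left.2 h] at h1
        omega
      · have h2 : A ∩ (Y ∪ (A ∩ B)) ⊆ (Y ∩ A) ∪ (A ∩ B) := by
          rintro v ⟨h3, h4 | h4⟩
          · exact Or.inl ⟨h4, h3⟩
          · exact Or.inr h4
        have h3 := (Set.ncard_le_ncard h2).trans (Set.ncard_union_le _ _)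
        omega
    have hclA := hcl A B ho hB
    have hclB := hcl B A (by rwa [Set.inter_comm]) hA
    rw [Set.inter_comm B A] at hclB
    refine ⟨Y ∪ (A ∩ B), {A, B}, Set.subset_union_left, ?_, ?_, ?_, ?_, ?_, ?_⟩
    · intro v
      rcases hs.1 v with h | h
      · exact Or.inr ⟨A, Or.inl rfl, h⟩
      · exact Or.inr ⟨B, Or.inr rfl, h⟩
    · intro x y hxy
      right
      by_cases hx : x ∈ A ∧ y ∈ A
      · exact ⟨A, Or.inl rfl, hx⟩
      · refine ⟨B, Or.inr rfl, ?_⟩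
        have a1 := hs.1 x
        have a2 := hs.1 y
        have a3 := hs.2 x y hxy
        have a4 := hs.2 y x hxy.symm
        tauto
    · rintro Ω (rfl | rfl) Ω' (rfl | rfl) hne
      · exact absurd rfl hne
      · exact Set.subset_union_right
      · rw [Set.inter_comm]; exact Set.subset_union_right
      · exact absurd rfl hne
    · rintro Ω (rfl | rfl)
      · exact hclA.1
      · exact hclB.1
    · rintro Ω (rfl | rfl)
      · exact hclA.2
      · exact hclB.2
    · right
      refine ⟨Y ∪ (A ∩ B), fun _ => true, ?_, ?_, ?_⟩
      · have := Set.ncard_union_le Y (A ∩ B)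
        omega
      · intro x hx hx'
        exact absurd hx hx'
      · intro M _
        have : (M ∩ (Y ∪ (A ∩ B))) \ (Y ∪ (A ∩ B)) = ∅ := by
          ext w
          simp only [Set.mem_sdiff, Set.mem_inter_iff, Set.mem_empty_iff_false]
          tauto
        rw [this]; simp

end step





section glue
variable {V : Type}

theorem Good.mono {r ξ : ℕ} {G G' : SimpleGraph V} [Finite V] {b b' : Set V} {A A' : Set (Set V)}
    (h : Good r ξ G b A) (hb : b' ⊆ b)
    (hG : ∀ x ∈ b', ∀ y ∈ b', G'.Adj x y → G.Adj x y)
    (hA : ∀ M' ∈ A', ∃ M ∈ A, M' ∩ b' ⊆ M) : Good r ξ G' b' A' := by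
  rcases h with h | ⟨Z, κ, h1, h2, h3⟩
  · left
    intro ρ hρ hK
    have key : ∀ x ∈ b', ∀ y ∈ b', (torG G' A').Adj x y → (torG G A).Adj x y := by
      rintro x hx y hy ⟨hne, hxy | ⟨M', hM', hxM, hyM⟩⟩
      · exact ⟨hne, Or.inl (hG x hx y hy hxy)⟩
      · obtain ⟨M, hM, hsub⟩ := hA M' hM'
        exact ⟨hne, Or.inr ⟨M, hM, hsub ⟨hxM, hx⟩, hsub ⟨hyM, hy⟩⟩⟩
    refine h ρ (fun i => (hρ i).trans hb) ⟨?_, hK.disj, ?_⟩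
    · intro i
      refine ⟨(hK.conn i).1, fun x hx y hy => ?_⟩
      exact ((hK.conn i).2 x hx y hy).mono' fun a ha c hc hac =>
        Reach.single (key a (hρ i ha) c (hρ i hc) hac) ha hc
    · intro i j hij
      obtain ⟨x, hx, y, hy, hxy⟩ := hK.adj i j hij
      exact ⟨x, hx, y, hy, key x (hρ i hx) y (hρ j hy) hxy⟩
  · right
    refine ⟨Z, κ, h1, fun x hx hxZ y hy hyZ hxy =>
      h2 x (hb hx) hxZ y (hb hy) hyZ (hG x hx y hy hxy), ?_⟩
    intro M' hM'
    obtain ⟨M, hM, hsub⟩ := hA M' hM'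
    refine le_trans (Set.ncard_le_ncard (t := (M ∩ b) \ Z) ?_) (h3 M hM)
    rintro x ⟨hx, hxZ⟩
    exact ⟨⟨hsub hx, hb hx.2⟩, hxZ⟩

/-- the tree of a parent function -/
def parG {ι : Type} (par : ι → Option ι) (dep : ι → ℕ)
    (hdep : ∀ x y, par x = some y → dep y < dep x) : SimpleGraph ι where
  Adj x y := par x = some y ∨ par y = some x
  symm := ⟨fun _ _ h => h.symm⟩
  loopless := ⟨fun x h => by
    rcases h with h | h <;> exact absurd (hdep x x h) (lt_irrefl _)⟩

theorem parG_isTree {ι : Type} (par : ι → Option ι) (dep : ι → ℕ) (root : ι)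
    (hroot : ∀ x, par x = none → x = root)
    (hdep : ∀ x y, par x = some y → dep y < dep x) : (parG par dep hdep).IsTree := by
  have hreach : ∀ n x, dep x = n → (parG par dep hdep).Reachable x root := by
    intro n
    induction n using Nat.strong_induction_on with
    | _ n ih =>
      intro x hx
      cases hp : par x with
      | none => rw [hroot x hp]
      | some y =>
        have h1 : (parG par dep hdep).Adj x y := Or.inl hp
        exact h1.reachable.trans (ih (dep y) (hx ▸ hdep x y hp) y rfl)
  have hconn : (parG par dep hdep).Connected := by
    have : Nonempty ι := ⟨root⟩
    exact ⟨fun x y => (hreach _ x rfl).trans (hreach _ y rfl).symm⟩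
  have hbr : ∀ x y, par x = some y → (parG par dep hdep).IsBridge s(x, y) := by
    intro x y hxy
    rw [isBridge_iff, reachable_iff_reflTransGen]
    intro hR
    have hinv : ∀ z, Relation.ReflTransGen
        ((parG par dep hdep).deleteEdges {s(x, y)}).Adj x z →
        Relation.ReflTransGen (fun a b => par a = some b) z x := by
      intro z hz
      induction hz with
      | refl => exact Relation.ReflTransGen.refl
      | @tail a b _ hab ih =>
        rw [deleteEdges_adj] at hab
        obtain ⟨hab, hne⟩ := hab
        rcases hab with hab | hab
        · rcases Relation.ReflTransGen.cases_head ih with h | ⟨c, hc, hcx⟩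
          · exfalso
            subst h
            rw [hxy] at hab
            cases hab
            exact hne rfl
          · rw [hab] at hc
            cases hc
            exact hcx
        · exact Relation.ReflTransGen.head hab ih
    have h1 := hinv y hR
    have h2 : ∀ z, Relation.ReflTransGen (fun a b => par a = some b) z x → dep x ≤ dep z := by
      intro z hz
      induction hz using Relation.ReflTransGen.head_induction_on with
      | refl => exact le_rfl
      | head h _ ih => exact ih.trans (hdep _ _ h).le
    exact absurd (h2 y h1) (not_le.mpr (hdep x y hxy))
  refine ⟨hconn, ?_⟩
  rw [isAcyclic_iff_forall_adj_isBridge]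
  intro x y hxy
  rcases hxy with h | h
  · exact hbr x y h
  · rw [Sym2.eq_swap]
    exact hbr y x h

/-- the family of adhesion sets at a node -/
def fam {ι : Type} (par : ι → Option ι) (root : ι) (B : ι → Set V) (Y : Set V) (x : ι) :
    Set (Set V) :=
  {M | (∃ y, (par x = some y ∨ par y = some x) ∧ M = B y) ∨ (x = root ∧ M = Y)}

/-- rooted decomposition of a region -/
structure Dec (r ξ : ℕ) (G : SimpleGraph V) (Ω Y : Set V) {ι : Type} (par : ι → Option ι)
    (root : ι) (dep : ι → ℕ) (B : ι → Set V) : Prop where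
  par_root : par root = none
  root_uniq : ∀ x, par x = none → x = root
  dep_lt : ∀ x y, par x = some y → dep y < dep x
  sub : ∀ x, B x ⊆ Ω
  conn : ∀ v ∈ Ω, ∃ t, v ∈ B t ∧ ∀ x, v ∈ B x → x = t ∨ ∃ y, par x = some y ∧ v ∈ B y
  edge : ∀ a b, G.Adj a b → a ∈ Ω → b ∈ Ω → ∃ x, a ∈ B x ∧ b ∈ B x
  top : Y ⊆ B root
  good : ∀ x, Good r ξ G (B x) (fam par root B Y x)

/-- existence of a rooted decomposition -/
def HasDec (r ξ : ℕ) (G : SimpleGraph V) (Ω Y : Set V) : Prop :=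
  ∃ (ι : Type) (_ : Finite ι) (par : ι → Option ι) (root : ι) (dep : ι → ℕ) (B : ι → Set V),
    Dec r ξ G Ω Y par root dep B

theorem HasDec.single {r ξ : ℕ} [Finite V] (G : SimpleGraph V) {Ω Y : Set V} (hY : Y ⊆ Ω)
    (hΩ : Ω.ncard ≤ ξ) : HasDec r ξ G Ω Y := by
  refine ⟨Unit, inferInstance, fun _ => none, (), fun _ => 0, fun _ => Ω, ?_⟩
  refine ⟨rfl, fun _ _ => rfl, fun _ _ h => (by cases h), fun _ => subset_rfl,
    fun v hv => ⟨(), hv, fun _ _ => Or.inl rfl⟩, fun a b _ ha hb => ⟨(), ha, hb⟩, hY, ?_⟩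
  intro x
  right
  refine ⟨Ω, fun _ => true, hΩ, fun x hx hx' => absurd hx hx', fun M _ => ?_⟩
  have : (M ∩ Ω) \ Ω = ∅ := by
    ext z
    simp
  rw [this]
  simp

theorem HasDec.weaken {r ξ : ℕ} [Finite V] {G : SimpleGraph V} {Ω Y Y' : Set V}
    (h : HasDec r ξ G Ω Y) (hY : Y' ⊆ Y) : HasDec r ξ G Ω Y' := by
  obtain ⟨ι, hf, par, root, dep, B, D⟩ := h
  refine ⟨ι, hf, par, root, dep, B, D.par_root, D.root_uniq, D.dep_lt, D.sub, D.conn, D.edge,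
    hY.trans D.top, fun x => (D.good x).mono subset_rfl (fun _ _ _ _ h => h) ?_⟩
  rintro M' (hM' | ⟨hx, rfl⟩)
  · exact ⟨M', Or.inl hM', Set.inter_subset_left⟩
  · exact ⟨Y, Or.inr ⟨hx, rfl⟩, Set.inter_subset_left.trans hY⟩

theorem HasDec.glue {r ξ : ℕ} [Finite V] {G : SimpleGraph V} {Ω Y b : Set V}
    {𝓡 : Set (Set V)} (hYb : Y ⊆ b) (hb : b ⊆ Ω) (h𝓡 : ∀ R ∈ 𝓡, R ⊆ Ω)
    (cover : ∀ v ∈ Ω, v ∈ b ∨ ∃ R ∈ 𝓡, v ∈ R)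
    (edge : ∀ x y, G.Adj x y → x ∈ Ω → y ∈ Ω → (x ∈ b ∧ y ∈ b) ∨ ∃ R ∈ 𝓡, x ∈ R ∧ y ∈ R)
    (inter : ∀ R ∈ 𝓡, ∀ R' ∈ 𝓡, R ≠ R' → R ∩ R' ⊆ b)
    (good : Good r ξ G b (insert Y {M | ∃ R ∈ 𝓡, M = R ∩ b}))
    (rec : ∀ R ∈ 𝓡, HasDec r ξ G R (R ∩ b)) : HasDec r ξ G Ω Y := by
  have rec' : ∀ R : 𝓡, HasDec r ξ G (R : Set V) (R ∩ b) := fun R => rec R R.2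
  choose ι hf par root dep B D using rec'
  let par' : Option (Σ R : 𝓡, ι R) → Option (Option (Σ R : 𝓡, ι R)) := fun x =>
    match x with
    | none => none
    | some ⟨R, z⟩ => match par R z with
      | none => some none
      | some w => some (some ⟨R, w⟩)
  let dep' : Option (Σ R : 𝓡, ι R) → ℕ := fun x =>
    match x with
    | none => 0
    | some ⟨R, z⟩ => dep R z + 1
  let B' : Option (Σ R : 𝓡, ι R) → Set V := fun x =>
    match x with
    | none => b
    | some ⟨R, z⟩ => B R z
  have hp0 : par' none = none := rfl
  have hp1 : ∀ R z, par R z = none → par' (some ⟨R, z⟩) = some none := by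
    intro R z h
    simp only [par', h]
  have hp2 : ∀ R z w, par R z = some w → par' (some ⟨R, z⟩) = some (some ⟨R, w⟩) := by
    intro R z w h
    simp only [par', h]
  refine ⟨Option (Σ R : 𝓡, ι R), inferInstance, par', none, dep', B', hp0, ?_, ?_, ?_, ?_, ?_,
    hYb, ?_⟩
  · rintro (_ | ⟨R, z⟩) h
    · rfl
    · exfalso
      cases hz : par R z with
      | none => rw [hp1 R z hz] at h; cases h
      | some w => rw [hp2 R z w hz] at h; cases h
  · rintro (_ | ⟨R, z⟩) y h
    · cases h
    · cases hz : par R z with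
      | none =>
        rw [hp1 R z hz] at h
        cases h
        exact Nat.succ_pos _
      | some w =>
        rw [hp2 R z w hz] at h
        cases h
        exact Nat.succ_lt_succ ((D R).dep_lt z w hz)
  · rintro (_ | ⟨R, z⟩)
    · exact hb
    · exact ((D R).sub z).trans (h𝓡 R R.2)
  · intro v hv
    by_cases hvb : v ∈ b
    · refine ⟨none, hvb, ?_⟩
      rintro (_ | ⟨R, z⟩) hz
      · exact Or.inl rfl
      · right
        have hvR : v ∈ (R : Set V) := (D R).sub z hz
        have hroot : v ∈ B R (root R) := (D R).top ⟨hvR, hvb⟩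
        obtain ⟨t, ht, htop⟩ := (D R).conn v hvR
        have htr : root R = t := by
          rcases htop _ hroot with h | ⟨y, hy, _⟩
          · exact h
          · rw [(D R).par_root] at hy
            cases hy
        rcases htop z hz with h | ⟨y, hy, hvy⟩
        · refine ⟨none, hp1 R z ?_, hvb⟩
          rw [h, ← htr]
          exact (D R).par_root
        · exact ⟨some ⟨R, y⟩, hp2 R z y hy, hvy⟩
    · obtain ⟨R, hR, hvR⟩ := (cover v hv).resolve_left hvb
      obtain ⟨t, ht, htop⟩ := (D ⟨R, hR⟩).conn v hvR
      refine ⟨some ⟨⟨R, hR⟩, t⟩, ht, ?_⟩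
      rintro (_ | ⟨⟨R', hR'⟩, z⟩) hz
      · exact absurd hz hvb
      · have hvR' : v ∈ R' := (D ⟨R', hR'⟩).sub z hz
        have hEq : R' = R := by
          by_contra hne
          exact hvb (inter R' hR' R hR hne ⟨hvR', hvR⟩)
        subst hEq
        rcases htop z hz with h | ⟨y, hy, hvy⟩
        · left
          rw [h]
        · right
          exact ⟨some ⟨⟨R', hR⟩, y⟩, hp2 _ z y hy, hvy⟩
  · intro x y hxy hx hy
    rcases edge x y hxy hx hy with h | ⟨R, hR, hxR, hyR⟩
    · exact ⟨none, h⟩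
    · obtain ⟨z, hz⟩ := (D ⟨R, hR⟩).edge x y hxy hxR hyR
      exact ⟨some ⟨⟨R, hR⟩, z⟩, hz⟩
  · rintro (_ | ⟨R, z⟩)
    · refine good.mono subset_rfl (fun _ _ _ _ h => h) ?_
      rintro M' (⟨y, hy, rfl⟩ | ⟨_, rfl⟩)
      · rcases hy with hy | hy
        · cases hy
        · rcases y with _ | ⟨R, z⟩
          · cases hy
          · refine ⟨R ∩ b, Or.inr ⟨R, R.2, rfl⟩, ?_⟩
            exact Set.inter_subset_inter_left _ ((D R).sub z)
      · exact ⟨_, Or.inl rfl, Set.inter_subset_left⟩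
    · refine ((D R).good z).mono subset_rfl (fun _ _ _ _ h => h) ?_
      rintro M' (⟨y, hy, rfl⟩ | ⟨hx, _⟩)
      · rcases hy with hy | hy
        · cases hz : par R z with
          | none =>
            rw [hp1 R z hz] at hy
            cases hy
            refine ⟨R ∩ b, Or.inr ⟨(D R).root_uniq z hz, rfl⟩, ?_⟩
            rintro v ⟨hvb, hv⟩
            exact ⟨(D R).sub z hv, hvb⟩
          | some w =>
            rw [hp2 R z w hz] at hy
            cases hy
            exact ⟨B R w, Or.inl ⟨w, Or.inl hz, rfl⟩, Set.inter_subset_left⟩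
        · rcases y with _ | ⟨R', z'⟩
          · cases hy
          · cases hz : par R' z' with
            | none =>
              rw [hp1 R' z' hz] at hy
              cases hy
            | some w =>
              rw [hp2 R' z' w hz] at hy
              cases hy
              exact ⟨B R z', Or.inl ⟨z', Or.inr hz, rfl⟩, Set.inter_subset_left⟩
      · cases hx

theorem exists_hasDec {r m l : ℕ} [Finite V]
    (hstep : ∀ (G : SimpleGraph V) (Y : Set V), ¬ OddModel G l → Y.ncard = 5 * m →
      ∃ b 𝓡, StepOut r (6 * m) (5 * m) G Y b 𝓡)
    (G : SimpleGraph V) (hG : ¬ OddModel G l) :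
    ∀ (n : ℕ) (Ω Y : Set V), Ω.ncard = n → Y ⊆ Ω → Y.ncard ≤ 5 * m →
      HasDec r (6 * m) G Ω Y := by
  intro n
  induction n using Nat.strong_induction_on with
  | _ n ih =>
    intro Ω Y0 hn hY0 hY0c
    by_cases hsm : Ω.ncard ≤ 5 * m
    · exact HasDec.single G hY0 (by omega)
    · obtain ⟨Y, hYY, hYΩ, hYc⟩ := Set.exists_subsuperset_card_eq hY0 hY0c (le_of_not_ge hsm)
      refine HasDec.weaken ?_ hYY
      have hres : ¬ OddModel (resG G Ω) l := fun h => hG (h.mono (resG_le G Ω))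
      obtain ⟨b, 𝓡, S⟩ := hstep (resG G Ω) Y hres hYc
      refine HasDec.glue (b := b ∩ Ω) (𝓡 := {R' | ∃ R ∈ 𝓡, R' = R ∩ Ω})
        (fun v hv => ⟨S.sub hv, hYΩ hv⟩) Set.inter_subset_right ?_ ?_ ?_ ?_ ?_ ?_
      · rintro _ ⟨R, _, rfl⟩
        exact Set.inter_subset_right
      · intro v hv
        rcases S.cover v with h | ⟨R, hR, hvR⟩
        · exact Or.inl ⟨h, hv⟩
        · exact Or.inr ⟨_, ⟨R, hR, rfl⟩, hvR, hv⟩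
      · intro x y hxy hx hy
        rcases S.edge x y ⟨hxy, hx, hy⟩ with h | ⟨R, hR, hxR, hyR⟩
        · exact Or.inl ⟨⟨h.1, hx⟩, ⟨h.2, hy⟩⟩
        · exact Or.inr ⟨_, ⟨R, hR, rfl⟩, ⟨hxR, hx⟩, ⟨hyR, hy⟩⟩
      · rintro _ ⟨R, hR, rfl⟩ _ ⟨R', hR', rfl⟩ hne v ⟨hv, hv'⟩
        exact ⟨S.inter R hR R' hR' (fun h => hne (by rw [h])) ⟨hv.1, hv'.1⟩, hv.2⟩
      · refine S.good.mono Set.inter_subset_left (fun x hx y hy h => ⟨h, hx.2, hy.2⟩) ?_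
        rintro M' (rfl | ⟨_, ⟨R, hR, rfl⟩, rfl⟩)
        · exact ⟨_, Or.inl rfl, Set.inter_subset_left⟩
        · refine ⟨R ∩ b, Or.inr ⟨R, hR, rfl⟩, ?_⟩
          rintro v ⟨⟨h1, h2⟩, _⟩
          exact ⟨h1.1, h2.1⟩
      · rintro _ ⟨R, hR, rfl⟩
        refine ih (R ∩ Ω).ncard ?_ _ _ rfl Set.inter_subset_left ?_
        · rw [← hn]
          refine Set.ncard_lt_ncard ⟨Set.inter_subset_right, fun h => S.small R hR ?_⟩
          exact fun v hv => (h (hYΩ hv)).1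
        · refine le_trans (Set.ncard_le_ncard (t := R ∩ b) ?_) (S.bound R hR)
          rintro v ⟨h1, h2⟩
          exact ⟨h1.1, h2.1⟩

theorem Conn.image_val {G : SimpleGraph V} {b : Set V} {T : SimpleGraph b} {s : Set b}
    (h : Conn T s) (hT : ∀ x y : b, T.Adj x y → G.Adj x y) : Conn G (Subtype.val '' s) := by
  refine ⟨h.1.image _, ?_⟩
  rintro _ ⟨x, hx, rfl⟩ _ ⟨y, hy, rfl⟩
  have := h.2 x hx y hy
  induction this with
  | refl => exact Reach.refl _ _ _
  | @tail c d _ hcd ih =>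
    exact (ih hcd.2.1).trans
      (Reach.single (hT _ _ hcd.1) ⟨c, hcd.2.1, rfl⟩ ⟨d, hcd.2.2, rfl⟩)

theorem HasDec.final {r ξ : ℕ} [Finite V] {G : SimpleGraph V} (h : HasDec r ξ G Set.univ ∅) :
    ∃ (ι : Type) (_ : Fintype ι) (T : SimpleGraph ι) (B : ι → Set V),
          IsTreeDecomp G T B ∧
          ∀ x : ι,
            (¬ IsMinor (⊤ : SimpleGraph (Fin r)) (torso G T B x)) ∨
            ∃ Z : Set (B x), Z.ncard ≤ ξ ∧
              ((torso G T B x).induce Zᶜ).Colorable 2 ∧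
              (∀ a b : (B x), a ∉ Z → b ∉ Z →
                ((torso G T B x).Adj a b ↔ G.Adj (a : V) (b : V))) ∧
              ∀ M ∈ frame G T B x, (M \ Z).ncard ≤ 1 := by
  obtain ⟨ι, hf, par, root, dep, B, D⟩ := h
  refine ⟨ι, Fintype.ofFinite ι, parG par dep D.dep_lt, B, ⟨?_, ?_, ?_⟩, ?_⟩
  · exact parG_isTree par dep root D.root_uniq D.dep_lt
  · intro v
    rw [conn_iff]
    obtain ⟨t, ht, htop⟩ := D.conn v trivial
    refine Conn.of_root (r := t) ht ?_
    have : ∀ n x, dep x = n → v ∈ B x →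
        Reach (parG par dep D.dep_lt) {x | v ∈ B x} x t := by
      intro n
      induction n using Nat.strong_induction_on with
      | _ n ih =>
        intro x hx hvx
        rcases htop x hvx with rfl | ⟨y, hy, hvy⟩
        · exact Reach.refl _ _ _
        · have h1 : (parG par dep D.dep_lt).Adj x y := Or.inl hy
          exact (Reach.single h1 hvx hvy).trans
            (ih (dep y) (hx ▸ D.dep_lt x y hy) y rfl hvy)
    exact fun x hx => this _ x rfl hx
  · intro a c hac
    exact D.edge a c hac trivial trivial
  · intro x
    have hadj : ∀ a c : B x, (torso G (parG par dep D.dep_lt) B x).Adj a c →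
        (a : V) ≠ c ∧ (G.Adj (a : V) c ∨ ∃ M ∈ fam par root B ∅ x, (a : V) ∈ M ∧ (c : V) ∈ M) := by
      intro a c hac
      rw [torso, SimpleGraph.fromRel_adj] at hac
      obtain ⟨hne, h⟩ := hac
      refine ⟨fun h => hne (Subtype.ext h), ?_⟩
      rcases h with (h | ⟨y, hy, h1, h2⟩) | (h | ⟨y, hy, h1, h2⟩)
      · exact Or.inl h
      · exact Or.inr ⟨B y, Or.inl ⟨y, hy, rfl⟩, h1, h2⟩
      · exact Or.inl h.symm
      · exact Or.inr ⟨B y, Or.inl ⟨y, hy, rfl⟩, h2, h1⟩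
    rcases D.good x with h | ⟨Z, κ, h1, h2, h3⟩
    · left
      rintro ⟨ρ, hρ1, hρ2, hρ3⟩
      refine h (fun i => Subtype.val '' ρ i) ?_ ⟨?_, ?_, ?_⟩
      · rintro i _ ⟨a, _, rfl⟩
        exact a.2
      · intro i
        exact Conn.image_val (conn_iff.mp (hρ1 i)) fun a c hac => hadj a c hac
      · intro i j hij
        exact (Set.disjoint_image_iff Subtype.val_injective).mpr (hρ2 hij)
      · intro i j hij
        obtain ⟨a, ha, c, hc, hac⟩ := hρ3 (a := i) (b := j) hij
        exact ⟨a, ⟨a, ha, rfl⟩, c, ⟨c, hc, rfl⟩, hadj a c hac⟩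
    · right
      have hiff : ∀ a c : B x, (a : V) ∉ Z → (c : V) ∉ Z →
          ((torso G (parG par dep D.dep_lt) B x).Adj a c ↔ G.Adj (a : V) (c : V)) := by
        intro a c ha hc
        constructor
        · intro hac
          obtain ⟨hne, h | ⟨M, hM, haM, hcM⟩⟩ := hadj a c hac
          · exact h
          · exfalso
            have := h3 M hM
            rw [Set.ncard_le_one] at this
            exact hne (this a ⟨⟨haM, a.2⟩, ha⟩ c ⟨⟨hcM, c.2⟩, hc⟩)
        · intro h
          rw [torso, SimpleGraph.fromRel_adj]
          exact ⟨fun hEq => G.loopless.irrefl _ (hEq ▸ h), Or.inl (Or.inl h)⟩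
      refine ⟨Subtype.val ⁻¹' Z, ?_, ?_, hiff, ?_⟩
      · refine le_trans ?_ h1
        rw [← Set.ncard_image_of_injective _ Subtype.val_injective]
        exact Set.ncard_le_ncard (Set.image_preimage_subset _ _)
      · have C : ((torso G (parG par dep D.dep_lt) B x).induce (Subtype.val ⁻¹' Z)ᶜ).Coloring
            Bool := Coloring.mk (fun a => κ a.1.1) (by
          intro a c hac
          exact h2 a.1.1 a.1.2 a.2 c.1.1 c.1.2 c.2 ((hiff a.1 c.1 a.2 c.2).mp hac))
        simpa using C.colorable
      · rintro M ⟨y, hy, rfl⟩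
        refine le_trans ?_ (h3 (B y) (Or.inl ⟨y, hy, rfl⟩))
        rw [← Set.ncard_image_of_injective _ Subtype.val_injective]
        refine Set.ncard_le_ncard ?_
        rintro _ ⟨a, ⟨ha, haZ⟩, rfl⟩
        exact ⟨⟨ha, a.2⟩, haZ⟩

end glue


theorem stmt14 (α : Type) [Fintype α] (H : SimpleGraph α) :
    ∃ r ξ : ℕ, 0 < r ∧ 0 < ξ ∧
      ∀ (V : Type) [Fintype V] (G : SimpleGraph V), ¬ IsOddMinor H G →
        ∃ (ι : Type) (_ : Fintype ι) (T : SimpleGraph ι) (B : ι → Set V),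
          IsTreeDecomp G T B ∧
          ∀ x : ι,
            (¬ IsMinor (⊤ : SimpleGraph (Fin r)) (torso G T B x)) ∨
            ∃ Z : Set (B x), Z.ncard ≤ ξ ∧
              ((torso G T B x).induce Zᶜ).Colorable 2 ∧
              (∀ a b : (B x), a ∉ Z → b ∉ Z →
                ((torso G T B x).Adj a b ↔ G.Adj (a : V) (b : V))) ∧
              ∀ M ∈ frame G T B x, (M \ Z).ncard ≤ 1 := by
  obtain ⟨m, r, hm, hr, hstep⟩ := step (Fintype.card α)
  refine ⟨r, 6 * m, hr, by omega, ?_⟩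
  intro V _ G hG
  have hodd : ¬ OddModel G (Fintype.card α) := fun h => hG (isOddMinor_of_oddModel H G h)
  exact HasDec.final (exists_hasDec (fun G Y h1 h2 => hstep V G Y h1 h2) G hodd
    _ Set.univ ∅ rfl (Set.empty_subset _) (by simp))

end CFPaper
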